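/- Let A_0, ..., A_n be nonempty finite subsets of a lattice M of rank n. For i = 0, ..., n, the partial degree of the sparse resultant Res_{A_0,...,A_n} in the group of variables u_i (the coefficients of the i-th polynomial) equals the mixed volume MV_M(Delta_0, ..., Delta_{i-1}, Delta_{i+1}, ..., Delta_n), where Delta_j is the convex hull of A_j. This holds for any family of supports. -/

import Mathlib

open Pointwise MeasureTheory

noncomputable section

variable {n : ℕ}

/-- Evaluation of the character `χ^a` at a point `ξ` of the torus `(ℂˣ)^n`. -/
def chEval (ξ : Fin n → ℂˣ) (a : Fin n → ℤ) : ℂ :=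
  ∏ j, ((ξ j ^ (a j) : ℂˣ) : ℂ)

/-- `ξ` is a common root of the Laurent polynomials with supports `A i` and
coefficients `c i`. -/
def IsRootOf (A : Fin (n + 1) → Finset (Fin n → ℤ))
    (c : Fin (n + 1) → (Fin n → ℤ) → ℂ) (ξ : Fin n → ℂˣ) : Prop :=
  ∀ i, ∑ a ∈ A i, c i a * chEval ξ a = 0

/-- The family with supports `A` and coefficients `c` has a common root in the torus. -/
def HasRoot (A : Fin (n + 1) → Finset (Fin n → ℤ))
    (c : Fin (n + 1) → (Fin n → ℤ) → ℂ) : Prop :=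
  ∃ ξ, IsRootOf A c ξ

/-- Evaluation of an integer polynomial in the coefficient variables `u_{i,a}` at a
family of complex coefficients. -/
def evalCoeff (R : MvPolynomial (Fin (n + 1) × (Fin n → ℤ)) ℤ)
    (c : Fin (n + 1) → (Fin n → ℤ) → ℂ) : ℂ :=
  MvPolynomial.aeval (fun p => c p.1 p.2) R

/-- `E` is the sparse eliminant of the family of supports `A`. -/
def IsEliminant (A : Fin (n + 1) → Finset (Fin n → ℤ))
    (E : MvPolynomial (Fin (n + 1) × (Fin n → ℤ)) ℤ) : Prop :=
  (Irreducible E ∧ {c | evalCoeff E c = 0} = closure {c | HasRoot A c})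
  ∨ (E = 1 ∧ ∀ E' : MvPolynomial (Fin (n + 1) × (Fin n → ℤ)) ℤ,
      ¬ (Irreducible E' ∧ {c | evalCoeff E' c = 0} = closure {c | HasRoot A c}))

/-- `R` is the sparse resultant of the family of supports `A`: up to sign the power
`E^d` of the sparse eliminant, where `d` is the degree of the projection from the
incidence variety (the number of common roots of a generic coefficient family in the
vanishing locus). -/
def IsResultant (A : Fin (n + 1) → Finset (Fin n → ℤ))
    (R : MvPolynomial (Fin (n + 1) × (Fin n → ℤ)) ℤ) : Prop :=
  ∃ E d, IsEliminant A E ∧ (R = E ^ d ∨ R = -E ^ d) ∧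
    ∃ U : Set (Fin (n + 1) → (Fin n → ℤ) → ℂ), IsOpen U ∧
      closure (U ∩ {c | HasRoot A c}) = closure {c | HasRoot A c} ∧
      ∀ c ∈ U ∩ {c | HasRoot A c}, Nat.card {ξ // IsRootOf A c ξ} = d

/-- The partial degree of `R` in the group of variables `u_i = (u_{i,a})_a`. -/
def groupDeg (i : Fin (n + 1)) (R : MvPolynomial (Fin (n + 1) × (Fin n → ℤ)) ℤ) : ℕ :=
  R.support.sup fun m => ∑ p ∈ m.support.filter (fun p => p.1 = i), m p

/-- Mixed volume (inclusion-exclusion formula, normalized by `MV(Q,…,Q) = k! vol Q`),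
with the convention `MV = 1` for `k = 0`. -/
def mixedVolume (k : ℕ) {ι : Type*} [Fintype ι] (Q : ι → Set (Fin k → ℝ)) : ℝ :=
  if k = 0 then 1 else
    ∑ s ∈ (Finset.univ : Finset ι).powerset,
      if s.Nonempty then
        (-1 : ℝ) ^ (Fintype.card ι - s.card) * (volume (∑ i ∈ s, Q i)).toReal
      else 0

/-- The coordinatewise cast `ℤ^n → ℝ^n`. -/
def castR (n : ℕ) (x : Fin n → ℤ) : Fin n → ℝ := fun j => (x j : ℝ)

/-- The indices at which the lifted affine functional `ν f + ⟨b f, w⟩` attains its minimum. -/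
def minSet {I : Type*} (b : I → Fin n → ℝ) (ν : I → ℝ) (w : Fin n → ℝ) : Set I :=
  {f | ∀ g, ν f + b f ⬝ᵥ w ≤ ν g + b g ⬝ᵥ w}

lemma isLinearMap_dotProduct_right (w : Fin n → ℝ) : IsLinearMap ℝ (fun z : Fin n → ℝ => z ⬝ᵥ w) :=
  ⟨fun x y => add_dotProduct x y w, fun c x => smul_dotProduct c x w⟩

lemma exists_dotProduct_le_of_mem_convexHull {s : Set (Fin n → ℝ)} {y : Fin n → ℝ}
    (hy : y ∈ convexHull ℝ s) (w : Fin n → ℝ) : ∃ z ∈ s, z ⬝ᵥ w ≤ y ⬝ᵥ w := by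
  by_contra! h
  have hsub : convexHull ℝ s ⊆ {z | y ⬝ᵥ w < z ⬝ᵥ w} :=
    convexHull_min (fun z hz => h z hz)
      (convex_halfSpace_gt (isLinearMap_dotProduct_right w) _)
  exact lt_irrefl (y ⬝ᵥ w) (hsub hy)

lemma dotProduct_eq_of_mem_convexHull {s : Set (Fin n → ℝ)} {y : Fin n → ℝ}
    (hy : y ∈ convexHull ℝ s) (w : Fin n → ℝ) {c : ℝ} (h : ∀ z ∈ s, z ⬝ᵥ w = c) :
    y ⬝ᵥ w = c := by
  have hsub : convexHull ℝ s ⊆ {z | z ⬝ᵥ w = c} :=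
    convexHull_min (fun z hz => h z hz)
      (convex_hyperplane (isLinearMap_dotProduct_right w) _)
  exact hsub hy

lemma volume_hyperplane_eq_zero {v : Fin n → ℝ} (hv : v ≠ 0) (c : ℝ) :
    volume {z : Fin n → ℝ | z ⬝ᵥ v = c} = 0 := by
  rcases Set.eq_empty_or_nonempty {z : Fin n → ℝ | z ⬝ᵥ v = c} with h | ⟨z₀, hz₀⟩
  · rw [h]; simp
  let L : Submodule ℝ (Fin n → ℝ) := LinearMap.ker (isLinearMap_dotProduct_right v).mk'
  have hL : L ≠ ⊤ := by
    intro h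
    have : v ∈ L := by rw [h]; trivial
    have h2 : v ⬝ᵥ v = 0 := this
    exact hv (dotProduct_self_eq_zero.1 h2)
  have h0 := Measure.addHaar_submodule volume L hL
  have : {z : Fin n → ℝ | z ⬝ᵥ v = c} = (fun z => z + (-z₀)) ⁻¹' (L : Set (Fin n → ℝ)) := by
    ext z
    have : z + -z₀ ∈ L ↔ (z + -z₀) ⬝ᵥ v = 0 := Iff.rfl
    simp only [Set.mem_ofPred_eq, Set.mem_preimage, SetLike.mem_coe, this, add_dotProduct,
      neg_dotProduct]
    have hz₀' : z₀ ⬝ᵥ v = c := hz₀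
    rw [hz₀']
    constructor <;> intro h <;> linarith
  rw [this, measure_preimage_add_right, h0]

lemma exists_mem_convexHull_image_minSet {I : Type*} [Fintype I] (b : I → Fin n → ℝ) (ν : I → ℝ)
    {x : Fin n → ℝ} (hx : x ∈ interior (convexHull ℝ (Set.range b))) :
    ∃ w, x ∈ convexHull ℝ (b '' minSet b ν w) := by
  have hI : Nonempty I := by
    by_contra h
    rw [not_nonempty_iff] at h
    rw [Set.range_eq_empty, convexHull_empty, interior_empty] at hx
    exact hx
  let h : (Fin n → ℝ) → ℝ := fun w =>
    Finset.univ.sup' Finset.univ_nonempty (fun f => -(ν f + (b f - x) ⬝ᵥ w))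
  have hcont : Continuous h := by
    apply Continuous.finset_sup'_apply
    intro f _
    fun_prop
  obtain ⟨r, hr, hball⟩ := Metric.mem_nhds_iff.1 (mem_interior_iff_mem_nhds.1 hx)
  obtain ⟨C, hC⟩ : ∃ C, ∀ f, ν f ≤ C := by
    obtain ⟨C, hC⟩ := (Set.finite_range ν).bddAbove
    exact ⟨C, fun f => hC ⟨f, rfl⟩⟩
  have hlow : ∀ w, (r / 2) * ‖w‖ - C ≤ h w := by
    intro w
    have key : ∃ f, (b f - x) ⬝ᵥ w ≤ - (r / 2 * ‖w‖) := by
      by_cases hw : w = 0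
      · exact ⟨hI.some, by simp [hw]⟩
      have hw' : 0 < ‖w‖ := norm_pos_iff.2 hw
      have hy : x - (r / 2 / ‖w‖) • w ∈ convexHull ℝ (Set.range b) := by
        apply hball
        rw [Metric.mem_ball, dist_eq_norm, sub_sub_cancel_left, norm_neg, norm_smul,
          Real.norm_of_nonneg (by positivity), div_mul_cancel₀ _ hw'.ne']
        linarith
      obtain ⟨_, ⟨f, rfl⟩, hf⟩ := exists_dotProduct_le_of_mem_convexHull hy w
      refine ⟨f, ?_⟩
      rw [sub_dotProduct, smul_dotProduct, smul_eq_mul] at hf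
      have hsq : ‖w‖ ^ 2 ≤ w ⬝ᵥ w := by
        obtain ⟨i, hi⟩ : ∃ i, ‖w i‖ = ‖w‖ := by
          have hn : Nonempty (Fin n) := by
            by_contra hne
            rw [not_nonempty_iff] at hne
            exact hw (Subsingleton.elim _ _)
          obtain ⟨i, hi⟩ := Finite.exists_max (fun i => ‖w i‖)
          exact ⟨i, le_antisymm (norm_le_pi_norm w i) ((pi_norm_le_iff_of_nonneg (norm_nonneg _)).2 hi)⟩
        rw [← hi, Real.norm_eq_abs, sq_abs, sq]
        exact Finset.single_le_sum (f := fun i => w i * w i) (fun j _ => mul_self_nonneg _)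
          (Finset.mem_univ i)
      have h3 : r / 2 * ‖w‖ ≤ r / 2 / ‖w‖ * (w ⬝ᵥ w) := by
        calc r / 2 * ‖w‖ = r / 2 / ‖w‖ * ‖w‖ ^ 2 := by field_simp
          _ ≤ _ := by gcongr
      rw [sub_dotProduct]
      linarith
    obtain ⟨f, hf⟩ := key
    refine le_trans ?_ (Finset.le_sup' (fun f => -(ν f + (b f - x) ⬝ᵥ w)) (Finset.mem_univ f))
    have := hC f
    linarith
  have htend : Filter.Tendsto h (Filter.cocompact _) Filter.atTop := by
    refine Filter.tendsto_atTop_mono hlow ?_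
    refine Filter.tendsto_atTop_add_const_right _ _ ?_
    exact Filter.Tendsto.const_mul_atTop (by positivity) tendsto_norm_cocompact_atTop
  obtain ⟨w, hw⟩ := hcont.exists_forall_le htend
  refine ⟨w, ?_⟩
  by_contra hxK
  have hfin : (b '' minSet b ν w).Finite := (Set.toFinite _)
  obtain ⟨φ, u, h1, h2⟩ := geometric_hahn_banach_point_closed (convex_convexHull ℝ _)
    (hfin.isCompact_convexHull (𝕜 := ℝ)).isClosed hxK
  let v : Fin n → ℝ := fun j => φ (Pi.single j 1)
  have hφ : ∀ z, φ z = z ⬝ᵥ v := by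
    intro z
    conv_lhs => rw [pi_eq_sum_univ' z]
    simp [map_sum, dotProduct, v]
  have hall : ∀ f, ∀ᶠ ε in nhdsWithin (0 : ℝ) (Set.Ioi 0),
      -(ν f + (b f - x) ⬝ᵥ (w + ε • v)) < h w := by
    intro f
    by_cases hf : f ∈ minSet b ν w
    · have h3 : 0 < (b f - x) ⬝ᵥ v := by
        have := h2 (b f) (subset_convexHull _ _ ⟨f, hf, rfl⟩)
        rw [hφ] at this h1
        rw [sub_dotProduct]
        linarith
      have h4 : -(ν f + (b f - x) ⬝ᵥ w) ≤ h w :=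
        Finset.le_sup' (fun f => -(ν f + (b f - x) ⬝ᵥ w)) (Finset.mem_univ f)
      filter_upwards [self_mem_nhdsWithin] with ε hε
      rw [dotProduct_add, dotProduct_smul, smul_eq_mul]
      have := mul_pos (Set.mem_Ioi.1 hε) h3
      linarith
    · have h4 : -(ν f + (b f - x) ⬝ᵥ w) < h w := by
        simp only [minSet, Set.mem_ofPred_eq, not_forall, not_le] at hf
        obtain ⟨g, hg⟩ := hf
        refine lt_of_lt_of_le ?_ (Finset.le_sup' (fun f => -(ν f + (b f - x) ⬝ᵥ w)) (Finset.mem_univ g))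
        rw [sub_dotProduct, sub_dotProduct]
        linarith
      have h5 : Continuous fun ε : ℝ => -(ν f + (b f - x) ⬝ᵥ (w + ε • v)) := by fun_prop
      have h6 := (h5.tendsto 0).eventually_lt_const (u := h w)
        (by rw [zero_smul, add_zero]; exact h4)
      exact h6.filter_mono nhdsWithin_le_nhds
  obtain ⟨ε, hε⟩ := (Filter.eventually_all.2 hall).exists
  have : h (w + ε • v) < h w := (Finset.sup'_lt_iff _).2 fun f _ => hε f
  exact absurd (hw (w + ε • v)) (not_le.2 this)

/-- Heights compatible with a point of the cell selected by `w`. -/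
lemma exists_height_of_mem_cell {I : Type*} [Nonempty I] [Finite I] (b : I → Fin n → ℝ) (ν : I → ℝ)
    (w : Fin n → ℝ) {x : Fin n → ℝ} (hx : x ∈ convexHull ℝ (b '' minSet b ν w)) {f₀ : I}
    (hf₀ : f₀ ∈ minSet b ν w) :
    ∃ r, (x, r) ∈ convexHull ℝ (Set.range fun f => (b f, ν f)) ∧
      r + x ⬝ᵥ w = ν f₀ + b f₀ ⬝ᵥ w := by
  have himg : b '' minSet b ν w =
      (LinearMap.fst ℝ (Fin n → ℝ) ℝ) '' ((fun f => (b f, ν f)) '' minSet b ν w) := by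
    rw [Set.image_image]; rfl
  rw [himg, ← LinearMap.image_convexHull] at hx
  obtain ⟨⟨x', r⟩, hr, rfl⟩ := hx
  refine ⟨r, convexHull_mono (Set.image_subset_range _ _) hr, ?_⟩
  have hlin : IsLinearMap ℝ (fun z : (Fin n → ℝ) × ℝ => z.2 + z.1 ⬝ᵥ w) :=
    ⟨fun x y => by simp [add_dotProduct]; ring, fun c x => by simp [smul_dotProduct]; ring⟩
  have hsub : convexHull ℝ ((fun f => (b f, ν f)) '' minSet b ν w) ⊆
      {z | z.2 + z.1 ⬝ᵥ w = ν f₀ + b f₀ ⬝ᵥ w} := by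
    refine convexHull_min ?_ (convex_hyperplane hlin _)
    rintro _ ⟨f, hf, rfl⟩
    exact le_antisymm (hf f₀) (hf₀ f)
  exact hsub hr

lemma le_height {I : Type*} (b : I → Fin n → ℝ) (ν : I → ℝ)
    (w : Fin n → ℝ) {x : Fin n → ℝ} {r : ℝ} {f₀ : I} (hf₀ : f₀ ∈ minSet b ν w)
    (hr : (x, r) ∈ convexHull ℝ (Set.range fun f => (b f, ν f))) :
    ν f₀ + b f₀ ⬝ᵥ w ≤ r + x ⬝ᵥ w := by
  have hlin : IsLinearMap ℝ (fun z : (Fin n → ℝ) × ℝ => z.2 + z.1 ⬝ᵥ w) :=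
    ⟨fun x y => by simp [add_dotProduct]; ring, fun c x => by simp [smul_dotProduct]; ring⟩
  have hsub : convexHull ℝ (Set.range fun f => (b f, ν f)) ⊆
      {z | ν f₀ + b f₀ ⬝ᵥ w ≤ z.2 + z.1 ⬝ᵥ w} := by
    refine convexHull_min ?_ (convex_halfSpace_ge hlin _)
    rintro _ ⟨f, rfl⟩
    exact hf₀ f
  exact hsub hr

lemma minSet_nonempty {I : Type*} [Nonempty I] [Finite I] (b : I → Fin n → ℝ) (ν : I → ℝ)
    (w : Fin n → ℝ) : (minSet b ν w).Nonempty := by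
  obtain ⟨f, hf⟩ := Finite.exists_min (fun f => ν f + b f ⬝ᵥ w)
  exact ⟨f, hf⟩

/-- The cells of a regular subdivision fill up the volume of the polytope. -/
theorem volume_convexHull_range_eq_sum {I : Type*} [Nonempty I] [Fintype I] (b : I → Fin n → ℝ)
    (ν : I → ℝ) (W : Finset (Fin n → ℝ))
    (hW : ∀ w ∉ W, ∃ v : Fin n → ℝ, v ≠ 0 ∧
      ∀ f ∈ minSet b ν w, ∀ g ∈ minSet b ν w, (b f - b g) ⬝ᵥ v = 0) :
    volume (convexHull ℝ (Set.range b)) =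
      ∑ w ∈ W, volume (convexHull ℝ (b '' minSet b ν w)) := by
  rw [← measure_biUnion_finset₀]
  · refine le_antisymm ?_ ?_
    · have hcov : convexHull ℝ (Set.range b) ⊆ (⋃ w ∈ W, convexHull ℝ (b '' minSet b ν w)) ∪
          (frontier (convexHull ℝ (Set.range b)) ∪
            ⋃ S : {S : Set I // ∃ w ∉ W, S = minSet b ν w}, convexHull ℝ (b '' S.1)) := by
        intro x hx
        by_cases hxi : x ∈ interior (convexHull ℝ (Set.range b))
        · obtain ⟨w, hw⟩ := exists_mem_convexHull_image_minSet b ν hxi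
          by_cases hwW : w ∈ W
          · left
            exact Set.mem_biUnion hwW hw
          · right; right
            exact Set.mem_iUnion.2 ⟨⟨_, w, hwW, rfl⟩, hw⟩
        · right; left
          exact ⟨subset_closure hx, hxi⟩
      refine (measure_mono hcov).trans ((measure_union_le _ _).trans ?_)
      have hnull : volume (frontier (convexHull ℝ (Set.range b)) ∪
          ⋃ S : {S : Set I // ∃ w ∉ W, S = minSet b ν w}, convexHull ℝ (b '' S.1)) = 0 := ?_
      · rw [hnull, add_zero]
      refine measure_union_null ((convex_convexHull ℝ _).addHaar_frontier _) ?_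
      refine measure_iUnion_null ?_
      rintro ⟨_, w, hw, rfl⟩
      obtain ⟨v, hv, hvw⟩ := hW w hw
      obtain ⟨f₀, hf₀⟩ := minSet_nonempty b ν w
      refine measure_mono_null ?_ (volume_hyperplane_eq_zero hv (b f₀ ⬝ᵥ v))
      intro x hx
      refine dotProduct_eq_of_mem_convexHull hx v ?_
      rintro _ ⟨f, hf, rfl⟩
      have := hvw f hf f₀ hf₀
      rw [sub_dotProduct] at this
      linarith
    · refine measure_mono (Set.iUnion₂_subset fun w _ => convexHull_mono (Set.image_subset_range _ _))
  · intro w _ w' _ hne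
    obtain ⟨f₀, hf₀⟩ := minSet_nonempty b ν w
    obtain ⟨g₀, hg₀⟩ := minSet_nonempty b ν w'
    refine measure_mono_null ?_ (volume_hyperplane_eq_zero (sub_ne_zero.2 hne)
      ((ν f₀ + b f₀ ⬝ᵥ w) - (ν g₀ + b g₀ ⬝ᵥ w')))
    rintro x ⟨hx, hx'⟩
    obtain ⟨r, hr, hrw⟩ := exists_height_of_mem_cell b ν w hx hf₀
    obtain ⟨r', hr', hrw'⟩ := exists_height_of_mem_cell b ν w' hx' hg₀
    have h1 := le_height b ν w hf₀ hr'
    have h2 := le_height b ν w' hg₀ hr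
    simp only [Set.mem_ofPred_eq, dotProduct_sub]
    linarith
  · intro w _
    exact ((Set.toFinite _).isCompact_convexHull (𝕜 := ℝ)).isClosed.measurableSet.nullMeasurableSet

/-- The coordinatewise cast `ℤ^n → ℚ^n`. -/
def castQ (x : Fin n → ℤ) : Fin n → ℚ := fun j => (x j : ℚ)

lemma linearIndependent_sub_of_relations {ν : Fin n → (Fin n → ℤ) → ℝ}
    (hν : LinearIndependent ℚ (fun p : Fin n × (Fin n → ℤ) => ν p.1 p.2))
    (S : Fin n → Finset (Fin n → ℤ)) (a : Fin n → Fin n → ℤ)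
    (h : ∀ c : (Σ j, {x // x ∈ (S j).erase (a j)}) → ℚ,
      ∑ p, c p • (castQ p.2.1 - castQ (a p.1)) = 0 →
      ∑ p, (c p : ℝ) * (ν p.1 p.2.1 - ν p.1 (a p.1)) = 0) :
    LinearIndependent ℚ (fun p : (Σ j, {x // x ∈ (S j).erase (a j)}) =>
      castQ p.2.1 - castQ (a p.1)) := by
  classical
  rw [Fintype.linearIndependent_iff]
  intro g hg q
  have h0 := h g hg
  let X : (Fin n × (Fin n → ℤ)) →₀ ℚ :=
    ∑ p : (Σ j, {x // x ∈ (S j).erase (a j)}),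
      g p • (Finsupp.single (p.1, p.2.1) 1 - Finsupp.single (p.1, a p.1) 1)
  have hX : X = 0 := by
    apply hν
    rw [map_zero, map_sum, ← h0]
    refine Finset.sum_congr rfl fun p _ => ?_
    rw [map_smul, map_sub, Finsupp.linearCombination_single, Finsupp.linearCombination_single,
      one_smul, one_smul, Rat.smul_def]
  have hq : X (q.1, q.2.1) = g q := by
    simp only [X, Finsupp.finsetSum_apply]
    rw [Finset.sum_eq_single q]
    · have : a q.1 ≠ q.2.1 := fun h => (Finset.mem_erase.1 q.2.2).1 h.symm
      simp [this]
    · intro p _ hp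
      have h1 : ¬ (p.1 = q.1 ∧ p.2.1 = q.2.1) := by
        rintro ⟨h1, h2⟩
        apply hp
        obtain ⟨j, x⟩ := p
        obtain ⟨j', x'⟩ := q
        obtain rfl : j = j' := h1
        congr 1
        exact Subtype.ext h2
      have h2 : ¬ (p.1 = q.1 ∧ a p.1 = q.2.1) := by
        rintro ⟨h1, h2⟩
        rw [h1] at h2
        exact (Finset.mem_erase.1 q.2.2).1 h2.symm
      simp [Prod.ext_iff, h1, h2]
    · simp
  rw [← hq, hX]; rfl

lemma card_eq_two_of_linearIndependent {S : Fin n → Finset (Fin n → ℤ)} {a : Fin n → Fin n → ℤ}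
    (ha : ∀ j, a j ∈ S j) (hS : ∀ j, 2 ≤ (S j).card)
    (h : LinearIndependent ℚ (fun p : (Σ j, {x // x ∈ (S j).erase (a j)}) =>
      castQ p.2.1 - castQ (a p.1))) (j : Fin n) : (S j).card = 2 := by
  have h1 := h.fintype_card_le_finrank
  rw [Module.finrank_fin_fun, Fintype.card_sigma] at h1
  simp only [Fintype.card_coe, Finset.card_erase_of_mem (ha _)] at h1
  have h2 : ∀ j ∈ Finset.univ, 1 ≤ (S j).card - 1 := fun j _ => by have := hS j; omega
  have h3 : ∑ j : Fin n, 1 = ∑ j, ((S j).card - 1) :=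
    le_antisymm (Finset.sum_le_sum h2) (by simpa using h1)
  have h4 := (Finset.sum_eq_sum_iff_of_le h2).1 h3 j (Finset.mem_univ j)
  have := hS j
  omega

/-- The matrix whose rows are the edge vectors `b j - a j`. -/
def edgeMatrix (a b : Fin n → Fin n → ℤ) : Matrix (Fin n) (Fin n) ℤ :=
  Matrix.of fun j k => b j k - a j k

lemma det_edgeMatrix_ne_zero {S : Fin n → Finset (Fin n → ℤ)} {a b : Fin n → Fin n → ℤ}
    (hb : ∀ j, b j ∈ S j) (hab : ∀ j, a j ≠ b j)
    (h : LinearIndependent ℚ (fun p : (Σ j, {x // x ∈ (S j).erase (a j)}) =>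
      castQ p.2.1 - castQ (a p.1))) : (edgeMatrix a b).det ≠ 0 := by
  let e : Fin n → (Σ j, {x // x ∈ (S j).erase (a j)}) := fun j =>
    ⟨j, b j, Finset.mem_erase.2 ⟨(hab j).symm, hb j⟩⟩
  have he : Function.Injective e := fun j j' hj => congrArg Sigma.fst hj
  have h1 := h.comp e he
  have h2 : LinearIndependent ℚ ((edgeMatrix a b).map (Int.castRingHom ℚ)).row := by
    convert h1 using 1
    ext j k
    simp [edgeMatrix, e, castQ, Matrix.row]
  rw [Matrix.linearIndependent_rows_iff_isUnit, Matrix.isUnit_iff_isUnit_det] at h2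
  intro h3
  have h4 := RingHom.map_det (Int.castRingHom ℚ) (edgeMatrix a b)
  rw [h3, map_zero] at h4
  have h5 := h2.ne_zero
  exact h5 h4.symm

/-- The face of the support `A j` selected by the weight `w` and the lifting `ν`. -/
def faceSet (A : Fin n → Finset (Fin n → ℤ)) (ν : Fin n → (Fin n → ℤ) → ℝ) (w : Fin n → ℝ)
    (j : Fin n) : Finset (Fin n → ℤ) :=
  by classical exact (A j).filter fun a => ∀ b ∈ A j, ν j a + castR n a ⬝ᵥ w ≤ ν j b + castR n b ⬝ᵥ w

lemma mem_faceSet {A : Fin n → Finset (Fin n → ℤ)} {ν : Fin n → (Fin n → ℤ) → ℝ} {w : Fin n → ℝ}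
    {j : Fin n} {a : Fin n → ℤ} : a ∈ faceSet A ν w j ↔
      a ∈ A j ∧ ∀ b ∈ A j, ν j a + castR n a ⬝ᵥ w ≤ ν j b + castR n b ⬝ᵥ w := by
  classical
  simp [faceSet]

lemma faceSet_nonempty {A : Fin n → Finset (Fin n → ℤ)} (hA : ∀ j, (A j).Nonempty)
    (ν : Fin n → (Fin n → ℤ) → ℝ) (w : Fin n → ℝ) (j : Fin n) : (faceSet A ν w j).Nonempty := by
  obtain ⟨a, ha, h⟩ := Finset.exists_min_image (A j) (fun a => ν j a + castR n a ⬝ᵥ w) (hA j)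
  exact ⟨a, mem_faceSet.2 ⟨ha, h⟩⟩

lemma castR_sub_dotProduct_of_mem_faceSet {A : Fin n → Finset (Fin n → ℤ)}
    {ν : Fin n → (Fin n → ℤ) → ℝ} {w : Fin n → ℝ} {j : Fin n} {a b : Fin n → ℤ}
    (ha : a ∈ faceSet A ν w j) (hb : b ∈ faceSet A ν w j) :
    ν j a - ν j b = - ((castR n a - castR n b) ⬝ᵥ w) := by
  rw [mem_faceSet] at ha hb
  have h1 := ha.2 b hb.1
  have h2 := hb.2 a ha.1
  rw [sub_dotProduct]
  linarith

lemma cast_castQ (x : Fin n → ℤ) (k : Fin n) : ((castQ x k : ℚ) : ℝ) = castR n x k := by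
  simp [castQ, castR]

lemma sum_cast_mul_dotProduct {ι : Type*} [Fintype ι] {c : ι → ℚ} {x y : ι → Fin n → ℤ}
    (h : ∑ p, c p • (castQ (x p) - castQ (y p)) = 0) (w : Fin n → ℝ) :
    ∑ p, (c p : ℝ) * ((castR n (x p) - castR n (y p)) ⬝ᵥ w) = 0 := by
  have h1 : ∑ p, (c p : ℝ) • (castR n (x p) - castR n (y p)) = 0 := by
    ext k
    have h2 := congrArg (fun q : ℚ => (q : ℝ)) (congrFun h k)
    simp only [Finset.sum_apply, Pi.smul_apply, Pi.sub_apply, smul_eq_mul, Rat.cast_sum,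
      Rat.cast_mul, Rat.cast_sub, cast_castQ, Pi.zero_apply, Rat.cast_zero] at h2 ⊢
    exact h2
  have h3 := congrArg (fun z => z ⬝ᵥ w) h1
  simpa [sum_dotProduct, smul_dotProduct] using h3

lemma linearIndependent_faceSet {ν : Fin n → (Fin n → ℤ) → ℝ}
    (hν : LinearIndependent ℚ (fun p : Fin n × (Fin n → ℤ) => ν p.1 p.2))
    (A : Fin n → Finset (Fin n → ℤ)) (w : Fin n → ℝ) {a : Fin n → Fin n → ℤ}
    (ha : ∀ j, a j ∈ faceSet A ν w j) :
    LinearIndependent ℚ (fun p : (Σ j, {x // x ∈ (faceSet A ν w j).erase (a j)}) =>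
      castQ p.2.1 - castQ (a p.1)) := by
  refine linearIndependent_sub_of_relations hν _ a fun c hc => ?_
  have h1 := sum_cast_mul_dotProduct hc w
  rw [← neg_eq_zero, ← Finset.sum_neg_distrib, ← h1]
  refine Finset.sum_congr rfl fun p _ => ?_
  rw [castR_sub_dotProduct_of_mem_faceSet (Finset.mem_of_mem_erase p.2.2) (ha p.1)]
  ring

lemma Finset.sum_powerset_univ_split {ι : Type*} [Fintype ι] [DecidableEq ι] (k : ι)
    (f : Finset ι → ℝ) :
    ∑ s ∈ (Finset.univ : Finset ι).powerset, f s =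
      ∑ s ∈ (Finset.univ.erase k).powerset, (f s + f (insert k s)) := by
  have h := Finset.sum_powerset_insert (Finset.notMem_erase k (Finset.univ : Finset ι)) f
  rw [Finset.insert_erase (Finset.mem_univ k)] at h
  rw [h, Finset.sum_add_distrib]

/-- The mixed volume vanishes as soon as one of the bodies is a point. -/
lemma mixedVolume_eq_zero_of_singleton (hn : n ≠ 0) (C : Fin n → Set (Fin n → ℝ)) (k : Fin n)
    (p : Fin n → ℝ) (hk : C k = {p}) : mixedVolume n C = 0 := by
  classical
  rw [mixedVolume, if_neg hn, Finset.sum_powerset_univ_split k]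
  refine Finset.sum_eq_zero fun s hs => ?_
  have hks : k ∉ s := fun h => Finset.notMem_erase k _ (Finset.mem_powerset.1 hs h)
  rw [if_pos (Finset.insert_nonempty k s), Finset.sum_insert hks, hk, Finset.card_insert_of_notMem hks,
    Set.singleton_add, Set.image_add_left, measure_preimage_add, Fintype.card_fin]
  have hcard : s.card + 1 ≤ n := by
    rw [← Finset.card_insert_of_notMem hks]
    simpa using Finset.card_le_univ (insert k s)
  split_ifs with h
  · rw [show n - s.card = (n - (s.card + 1)) + 1 by omega, pow_succ]
    ring
  · rw [Finset.not_nonempty_iff_eq_empty] at h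
    subst h
    have : Nonempty (Fin n) := ⟨k⟩
    simp [← Set.singleton_zero]

lemma volume_sum_segment (a b : Fin n → Fin n → ℤ) :
    volume (∑ j, segment ℝ (castR n (a j)) (castR n (b j))) =
      ENNReal.ofReal |((edgeMatrix a b).det : ℝ)| := by
  have h1 : ∑ j, segment ℝ (castR n (a j)) (castR n (b j)) =
      {∑ j, castR n (a j)} + parallelepiped (fun j => castR n (b j) - castR n (a j)) := by
    rw [parallelepiped_eq_sum_segment, ← Set.finsetSum_singleton, ← Finset.sum_add_distrib]
    refine Finset.sum_congr rfl fun j _ => ?_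
    rw [Set.singleton_add, segment_translate_image]
    simp
  rw [h1, Set.singleton_add, Set.image_add_left, measure_preimage_add]
  have h2 : parallelepiped (fun j => castR n (b j) - castR n (a j)) =
      (Matrix.toLin' ((edgeMatrix a b).map (Int.cast : ℤ → ℝ)).transpose) '' Set.Icc 0 1 := by
    rw [parallelepiped]
    refine Set.image_congr fun t _ => ?_
    ext k
    simp [Matrix.mulVec, dotProduct, edgeMatrix, castR, mul_comm]
  rw [h2, Measure.addHaar_image_linearMap, LinearMap.det_toLin', Matrix.det_transpose,
    Real.volume_Icc_pi]
  have h3 : ((edgeMatrix a b).map (Int.cast : ℤ → ℝ)).det = ((edgeMatrix a b).det : ℝ) :=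
    (RingHom.map_det (Int.castRingHom ℝ) (edgeMatrix a b)).symm
  simp [h3]

lemma exists_orthogonal_of_det_ne_zero {a b : Fin n → Fin n → ℤ} (h : (edgeMatrix a b).det ≠ 0)
    (k : Fin n) : ∃ v : Fin n → ℝ, v ≠ 0 ∧ ∀ j ≠ k, (castR n (b j) - castR n (a j)) ⬝ᵥ v = 0 := by
  let E := (edgeMatrix a b).map (Int.castRingHom ℝ)
  have hE : IsUnit E := by
    rw [Matrix.isUnit_iff_isUnit_det, isUnit_iff_ne_zero]
    rw [show E.det = ((edgeMatrix a b).det : ℝ) from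
      (RingHom.map_det (Int.castRingHom ℝ) (edgeMatrix a b)).symm]
    exact_mod_cast h
  have hdet := (Matrix.isUnit_iff_isUnit_det _).1 hE
  have hv : E.mulVec (E⁻¹.mulVec (Pi.single k 1)) = Pi.single k 1 := by
    rw [Matrix.mulVec_mulVec, Matrix.mul_nonsing_inv _ hdet, Matrix.one_mulVec]
  refine ⟨E⁻¹.mulVec (Pi.single k 1), ?_, ?_⟩
  · intro h0
    rw [h0, Matrix.mulVec_zero] at hv
    have := congrFun hv k
    simp at this
  · intro j hj
    have h1 := congrFun hv j
    rw [Pi.single_eq_of_ne hj] at h1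
    rw [← h1]
    simp [Matrix.mulVec, E, edgeMatrix, castR, dotProduct]

/-- The mixed volume of `n` segments with independent directions. -/
lemma mixedVolume_segment (hn : n ≠ 0) {a b : Fin n → Fin n → ℤ}
    (h : (edgeMatrix a b).det ≠ 0) :
    mixedVolume n (fun j => segment ℝ (castR n (a j)) (castR n (b j))) =
      ((edgeMatrix a b).det.natAbs : ℝ) := by
  classical
  rw [mixedVolume, if_neg hn, Finset.sum_eq_single Finset.univ]
  · have : Nonempty (Fin n) := ⟨⟨0, Nat.pos_of_ne_zero hn⟩⟩
    rw [if_pos Finset.univ_nonempty, volume_sum_segment, ENNReal.toReal_ofReal (abs_nonneg _)]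
    simp [Nat.cast_natAbs]
  · intro s _ hs
    split_ifs with hne
    swap; rfl
    obtain ⟨k, hk⟩ : ∃ k, k ∉ s := by
      by_contra! hall
      exact hs (Finset.eq_univ_iff_forall.2 hall)
    obtain ⟨v, hv, hvo⟩ := exists_orthogonal_of_det_ne_zero h k
    rw [measure_mono_null ?_ (volume_hyperplane_eq_zero hv (∑ j ∈ s, castR n (a j) ⬝ᵥ v))]
    · simp
    · intro x hx
      rw [Set.mem_finsetSum] at hx
      obtain ⟨g, hg, rfl⟩ := hx
      change (∑ j ∈ s, g j) ⬝ᵥ v = _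
      rw [sum_dotProduct]
      refine Finset.sum_congr rfl fun j hj => ?_
      have hjk : j ≠ k := fun hjk => hk (hjk ▸ hj)
      have hgj := hg hj
      rw [← convexHull_pair] at hgj
      refine dotProduct_eq_of_mem_convexHull hgj v ?_
      rintro z (rfl | rfl)
      · rfl
      · have := hvo j hjk
        rw [sub_dotProduct] at this
        linarith
  · simp

lemma exists_finset_spanning_weights (A : Fin n → Finset (Fin n → ℤ))
    (ν : Fin n → (Fin n → ℤ) → ℝ) :
    ∃ W : Finset (Fin n → ℝ), ∀ w, w ∈ W ↔ ∀ v : Fin n → ℝ,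
      (∀ j, ∀ a ∈ faceSet A ν w j, ∀ b ∈ faceSet A ν w j,
        (castR n a - castR n b) ⬝ᵥ v = 0) → v = 0 := by
  classical
  let Z : Set (Fin n → ℝ) := {w | ∀ v : Fin n → ℝ,
      (∀ j, ∀ a ∈ faceSet A ν w j, ∀ b ∈ faceSet A ν w j,
        (castR n a - castR n b) ⬝ᵥ v = 0) → v = 0}
  have hfin : Z.Finite := by
    have hmaps : Set.MapsTo (fun w => faceSet A ν w) Z
        (↑(Fintype.piFinset fun j => (A j).powerset) : Set _) := by
      intro w _
      rw [Finset.mem_coe, Fintype.mem_piFinset]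
      exact fun j => Finset.mem_powerset.2 fun a ha => (mem_faceSet.1 ha).1
    refine Set.Finite.of_injOn hmaps ?_ (Finset.finite_toSet _)
    intro w hw w' _ hww
    refine sub_eq_zero.1 (hw (w - w') fun j a ha b hb => ?_)
    have h1 := castR_sub_dotProduct_of_mem_faceSet ha hb
    have hj : faceSet A ν w j = faceSet A ν w' j := congrFun hww j
    rw [hj] at ha hb
    have h2 := castR_sub_dotProduct_of_mem_faceSet ha hb
    rw [dotProduct_sub]
    linarith
  exact ⟨hfin.toFinset, fun w => by rw [Set.Finite.mem_toFinset]; rfl⟩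

lemma volume_sum_convexHull_eq_sum {A : Fin n → Finset (Fin n → ℤ)} (hA : ∀ j, (A j).Nonempty)
    (ν : Fin n → (Fin n → ℤ) → ℝ) {W : Finset (Fin n → ℝ)} (hW : ∀ w, w ∈ W ↔ ∀ v : Fin n → ℝ,
      (∀ j, ∀ a ∈ faceSet A ν w j, ∀ b ∈ faceSet A ν w j,
        (castR n a - castR n b) ⬝ᵥ v = 0) → v = 0) (s : Finset (Fin n)) :
    volume (∑ j ∈ s, convexHull ℝ (castR n '' ↑(A j))) =
      ∑ w ∈ W, volume (∑ j ∈ s, convexHull ℝ (castR n '' ↑(faceSet A ν w j))) := by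
  classical
  have : ∀ j, Nonempty (A j) := fun j => (hA j).to_subtype
  let b : (∀ j, A j) → Fin n → ℝ := fun f => ∑ j ∈ s, castR n (f j)
  let μ : (∀ j, A j) → ℝ := fun f => ∑ j ∈ s, ν j (f j)
  have hval : ∀ f w, μ f + b f ⬝ᵥ w = ∑ j ∈ s, (ν j (f j) + castR n (f j) ⬝ᵥ w) := fun f w => by
    simp only [μ, b, sum_dotProduct, Finset.sum_add_distrib]
  have hmin : ∀ w f, f ∈ minSet b μ w ↔ ∀ j ∈ s, (f j : Fin n → ℤ) ∈ faceSet A ν w j := by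
    intro w f
    constructor
    · intro hf j hj
      refine mem_faceSet.2 ⟨(f j).2, fun c hc => ?_⟩
      have h1 := hf (Function.update f j ⟨c, hc⟩)
      rw [hval, hval, ← Finset.add_sum_erase _ _ hj, ← Finset.add_sum_erase _ _ hj,
        Function.update_self] at h1
      have h2 : ∑ x ∈ s.erase j, (ν x (Function.update f j ⟨c, hc⟩ x) +
          castR n (Function.update f j ⟨c, hc⟩ x) ⬝ᵥ w) =
          ∑ x ∈ s.erase j, (ν x (f x) + castR n (f x) ⬝ᵥ w) :=
        Finset.sum_congr rfl fun x hx => by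
          rw [Function.update_of_ne (Finset.ne_of_mem_erase hx)]
      rw [h2] at h1
      exact le_of_add_le_add_right h1
    · intro hf g
      rw [hval, hval]
      exact Finset.sum_le_sum fun j hj => (mem_faceSet.1 (hf j hj)).2 _ (g j).2
  have hrange : Set.range b = ∑ j ∈ s, castR n '' ↑(A j) := by
    ext x
    rw [Set.mem_finsetSum]
    constructor
    · rintro ⟨f, rfl⟩
      exact ⟨fun j => castR n (f j), fun {j} _ => ⟨f j, (f j).2, rfl⟩, rfl⟩
    · rintro ⟨g, hg, rfl⟩
      have hex : ∀ j, ∃ a : A j, j ∈ s → castR n a = g j := by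
        intro j
        by_cases hj : j ∈ s
        · obtain ⟨a, ha, hag⟩ := hg hj
          exact ⟨⟨a, ha⟩, fun _ => hag⟩
        · exact ⟨Classical.arbitrary _, fun h => absurd h hj⟩
      choose f hf using hex
      exact ⟨f, Finset.sum_congr rfl hf⟩
  have hcell : ∀ w, b '' minSet b μ w = ∑ j ∈ s, castR n '' ↑(faceSet A ν w j) := by
    intro w
    ext x
    rw [Set.mem_finsetSum]
    constructor
    · rintro ⟨f, hf, rfl⟩
      exact ⟨fun j => castR n (f j), fun {j} hj => ⟨f j, (hmin w f).1 hf j hj, rfl⟩, rfl⟩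
    · rintro ⟨g, hg, rfl⟩
      have hex : ∀ j, ∃ a : A j, j ∈ s → (a : Fin n → ℤ) ∈ faceSet A ν w j ∧ castR n a = g j := by
        intro j
        by_cases hj : j ∈ s
        · obtain ⟨a, ha, hag⟩ := hg hj
          exact ⟨⟨a, (mem_faceSet.1 ha).1⟩, fun _ => ⟨ha, hag⟩⟩
        · exact ⟨Classical.arbitrary _, fun h => absurd h hj⟩
      choose f hf using hex
      exact ⟨f, (hmin w f).2 fun j hj => (hf j hj).1, Finset.sum_congr rfl fun j hj => (hf j hj).2⟩
  rw [← convexHull_sum, ← hrange, volume_convexHull_range_eq_sum b μ W]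
  · refine Finset.sum_congr rfl fun w _ => ?_
    rw [hcell, convexHull_sum]
  · intro w hw
    rw [hW] at hw
    push Not at hw
    obtain ⟨v, hv, hv0⟩ := hw
    refine ⟨v, hv0, fun f hf g hg => ?_⟩
    simp only [b]
    rw [← Finset.sum_sub_distrib, sum_dotProduct]
    exact Finset.sum_eq_zero fun j hj => hv j _ ((hmin w f).1 hf j hj) _ ((hmin w g).1 hg j hj)

lemma mixedVolume_eq_sum_faceSet (hn : n ≠ 0) {A : Fin n → Finset (Fin n → ℤ)}
    (hA : ∀ j, (A j).Nonempty)
    (ν : Fin n → (Fin n → ℤ) → ℝ) {W : Finset (Fin n → ℝ)} (hW : ∀ w, w ∈ W ↔ ∀ v : Fin n → ℝ,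
      (∀ j, ∀ a ∈ faceSet A ν w j, ∀ b ∈ faceSet A ν w j,
        (castR n a - castR n b) ⬝ᵥ v = 0) → v = 0) :
    mixedVolume n (fun j => convexHull ℝ (castR n '' ↑(A j))) =
      ∑ w ∈ W, mixedVolume n (fun j => convexHull ℝ (castR n '' ↑(faceSet A ν w j))) := by
  simp only [mixedVolume, if_neg hn]
  rw [Finset.sum_comm]
  refine Finset.sum_congr rfl fun s _ => ?_
  split_ifs with hs
  · rw [volume_sum_convexHull_eq_sum hA ν hW s, ENNReal.toReal_sum, Finset.mul_sum]
    intro w _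
    rw [← convexHull_sum]
    refine ((Set.Finite.isCompact_convexHull (𝕜 := ℝ) ?_).measure_lt_top).ne
    exact Finset.sum_induction _ Set.Finite (fun _ _ h h' => h.add h') (Set.finite_singleton 0)
      fun j _ => (Finset.finite_toSet _).image _
  · simp

/-- The mixed volume as a count of mixed cells of a generic regular subdivision. -/
theorem exists_mixedCells {A : Fin n → Finset (Fin n → ℤ)} (hA : ∀ j, (A j).Nonempty)
    {ν : Fin n → (Fin n → ℤ) → ℝ}
    (hν : LinearIndependent ℚ (fun p : Fin n × (Fin n → ℤ) => ν p.1 p.2)) :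
    ∃ (W : Finset (Fin n → ℝ)) (a b : (Fin n → ℝ) → Fin n → Fin n → ℤ),
      (∀ w, w ∈ W ↔ ∀ j, 2 ≤ (faceSet A ν w j).card) ∧
      (∀ w ∈ W, ∀ j, a w j ≠ b w j ∧ faceSet A ν w j = {a w j, b w j}) ∧
      (∀ w ∈ W, (edgeMatrix (a w) (b w)).det ≠ 0) ∧
      ((∑ w ∈ W, (edgeMatrix (a w) (b w)).det.natAbs : ℕ) : ℝ) =
        mixedVolume n (fun j => convexHull ℝ (castR n '' ↑(A j))) := by
  classical
  obtain ⟨W', hW'⟩ := exists_finset_spanning_weights A ν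
  have hab : ∀ w, ∃ a b : Fin n → Fin n → ℤ, (∀ j, 2 ≤ (faceSet A ν w j).card) →
      (∀ j, a j ≠ b j ∧ faceSet A ν w j = {a j, b j}) ∧ (edgeMatrix a b).det ≠ 0 := by
    intro w
    by_cases h2 : ∀ j, 2 ≤ (faceSet A ν w j).card
    · choose a ha using fun j => faceSet_nonempty hA ν w j
      have hli := linearIndependent_faceSet hν A w ha
      have hcard := card_eq_two_of_linearIndependent ha h2 hli
      have hb : ∀ j, ∃ b, a j ≠ b ∧ faceSet A ν w j = {a j, b} := by
        intro j
        have h1 : ((faceSet A ν w j).erase (a j)).card = 1 := by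
          rw [Finset.card_erase_of_mem (ha j), hcard j]
        obtain ⟨b, hb⟩ := Finset.card_eq_one.1 h1
        refine ⟨b, ?_, ?_⟩
        · intro h
          have : b ∈ (faceSet A ν w j).erase (a j) := by rw [hb]; simp
          exact (Finset.mem_erase.1 this).1 h.symm
        · rw [← hb, Finset.insert_erase (ha j)]
      choose b hb using hb
      refine ⟨a, b, fun _ => ⟨hb, ?_⟩⟩
      refine det_edgeMatrix_ne_zero (fun j => ?_) (fun j => (hb j).1) hli
      rw [(hb j).2]; simp
    · exact ⟨0, 0, fun h => absurd h h2⟩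
  choose a b hab using hab
  have hsub : ∀ w, (∀ j, 2 ≤ (faceSet A ν w j).card) → w ∈ W' := by
    intro w hw
    rw [hW']
    intro v hv
    obtain ⟨h1, h2⟩ := hab w hw
    have hE : (((edgeMatrix (a w) (b w)).map (Int.castRingHom ℝ))).det ≠ 0 := by
      rw [show ((edgeMatrix (a w) (b w)).map (Int.castRingHom ℝ)).det =
        ((edgeMatrix (a w) (b w)).det : ℝ) from
        (RingHom.map_det (Int.castRingHom ℝ) (edgeMatrix (a w) (b w))).symm]
      exact_mod_cast h2
    refine Matrix.eq_zero_of_mulVec_eq_zero hE ?_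
    ext j
    have := hv j (b w j) (by rw [(h1 j).2]; simp) (a w j) (by rw [(h1 j).2]; simp)
    simpa [Matrix.mulVec, edgeMatrix, castR, dotProduct] using this
  refine ⟨W'.filter fun w => ∀ j, 2 ≤ (faceSet A ν w j).card, a, b, ?_, ?_, ?_, ?_⟩
  · intro w
    rw [Finset.mem_filter]
    exact ⟨fun h => h.2, fun h => ⟨hsub w h, h⟩⟩
  · exact fun w hw => (hab w (Finset.mem_filter.1 hw).2).1
  · exact fun w hw => (hab w (Finset.mem_filter.1 hw).2).2
  · rcases eq_or_ne n 0 with hn | hn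
    · subst hn
      have huniv : W' = Finset.univ :=
        Finset.eq_univ_iff_forall.2 fun w => hsub w fun j => j.elim0
      have hdet : ∀ w : Fin 0 → ℝ, (edgeMatrix (a w) (b w)).det.natAbs = 1 := fun w => by
        simp
      simp only [hdet, huniv]
      rw [Finset.filter_true_of_mem fun w _ => fun j => j.elim0]
      simp [mixedVolume]
    · rw [mixedVolume_eq_sum_faceSet hn hA ν hW', Finset.sum_filter, Nat.cast_sum]
      refine Finset.sum_congr rfl fun w _ => ?_
      split_ifs with h2
      · rw [← mixedVolume_segment hn (hab w h2).2]
        congr 1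
        ext1 j
        rw [((hab w h2).1 j).2]
        simp [Set.image_insert_eq, convexHull_pair]
      · push Not at h2
        obtain ⟨k, hk⟩ := h2
        have h1 : (faceSet A ν w k).card = 1 := by
          have := (faceSet_nonempty hA ν w k).card_pos
          omega
        obtain ⟨p, hp⟩ := Finset.card_eq_one.1 h1
        rw [mixedVolume_eq_zero_of_singleton hn _ k (castR n p)]
        · simp
        · rw [hp]; simp

theorem mixedVolume_comp_equiv (k : ℕ) {ι κ : Type*} [Fintype ι] [Fintype κ] (e : ι ≃ κ)
    (Q : κ → Set (Fin k → ℝ)) : mixedVolume k (fun i => Q (e i)) = mixedVolume k Q := by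
  unfold mixedVolume
  split_ifs with hk
  · rfl
  · refine Finset.sum_equiv e.finsetCongr (by simp) fun s _ => ?_
    simp only [Equiv.finsetCongr_apply, Finset.map_nonempty, Finset.card_map, Finset.sum_map,
      Fintype.card_congr e, Equiv.coe_toEmbedding]

theorem mixedVolume_subtype_ne (i : Fin (n + 1)) (Q : Fin (n + 1) → Set (Fin n → ℝ)) :
    mixedVolume n (fun j : {j : Fin (n + 1) // j ≠ i} => Q j.1) =
      mixedVolume n (fun j : Fin n => Q (i.succAbove j)) :=
  (mixedVolume_comp_equiv n (finSuccAboveEquiv i)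
    (fun j : {j : Fin (n + 1) // j ≠ i} => Q j.1)).symm

/-- The homomorphism `(ℂˣ)^n → (ℂˣ)^n` whose components are the characters given by the rows
of an integer matrix. -/
def monomialHom (E : Matrix (Fin n) (Fin n) ℤ) : (Fin n → ℂˣ) →* (Fin n → ℂˣ) where
  toFun η j := ∏ k, η k ^ E j k
  map_one' := by ext; simp
  map_mul' x y := by
    ext j
    simp [mul_zpow, Finset.prod_mul_distrib]

lemma monomialHom_apply (E : Matrix (Fin n) (Fin n) ℤ) (η : Fin n → ℂˣ) (j : Fin n) :
    monomialHom E η j = ∏ k, η k ^ E j k := rfl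

lemma monomialHom_comp (E F : Matrix (Fin n) (Fin n) ℤ) (η : Fin n → ℂˣ) :
    monomialHom E (monomialHom F η) = monomialHom (E * F) η := by
  funext j
  simp only [monomialHom_apply, Matrix.mul_apply, ← Finset.prod_zpow]
  rw [Finset.prod_comm]
  refine Finset.prod_congr rfl fun k _ => ?_
  have : ∀ (s : Finset (Fin n)) (g : Fin n → ℤ), η k ^ (∑ i ∈ s, g i) = ∏ i ∈ s, η k ^ g i := by
    intro s g
    classical
    induction s using Finset.induction_on with
    | empty => simp
    | insert a s ha ih => rw [Finset.sum_insert ha, Finset.prod_insert ha, zpow_add, ih]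
  rw [this]
  refine Finset.prod_congr rfl fun i _ => ?_
  rw [← zpow_mul, mul_comm]

lemma monomialHom_surjective {E : Matrix (Fin n) (Fin n) ℤ} (hE : E.det ≠ 0) :
    Function.Surjective (monomialHom E) := by
  intro y
  have h1 : ∀ j, ∃ x : ℂˣ, x ^ E.det = y j := by
    intro j
    refine ⟨Units.mk0 (Complex.exp (Complex.log (y j) / E.det)) (Complex.exp_ne_zero _), ?_⟩
    ext
    have : (E.det : ℂ) ≠ 0 := by exact_mod_cast hE
    rw [Units.val_zpow_eq_zpow_val, Units.val_mk0, ← Complex.exp_int_mul, mul_div_cancel₀ _ this,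
      Complex.exp_log (y j).ne_zero]
  choose x hx using h1
  refine ⟨monomialHom E.adjugate x, ?_⟩
  rw [monomialHom_comp, Matrix.mul_adjugate]
  funext j
  rw [monomialHom_apply, Finset.prod_eq_single j, ← hx j]
  · simp
  · intro k _ hk
    simp [Matrix.one_apply_ne hk.symm]
  · simp

lemma range_index {E : Matrix (Fin n) (Fin n) ℤ} (hE : E.det ≠ 0) :
    Nat.card ((Fin n → ℤ) ⧸ E.vecMulLinear.range) = E.det.natAbs := by
  have hinj : Function.Injective E.vecMulLinear := by
    intro x y hxy
    have h : Matrix.vecMul (x - y) E = 0 := by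
      rw [Matrix.sub_vecMul, sub_eq_zero]; exact hxy
    exact sub_eq_zero.1 (Matrix.eq_zero_of_vecMul_eq_zero hE h)
  rw [← Submodule.natAbs_det_equiv _ (LinearEquiv.ofInjective E.vecMulLinear hinj)]
  have : (E.vecMulLinear.range.subtype ∘ₗ AddMonoidHom.toIntLinearMap
      ((LinearEquiv.ofInjective E.vecMulLinear hinj : (Fin n → ℤ) ≃ₗ[ℤ] _) :
        (Fin n → ℤ) →+ E.vecMulLinear.range)) = Matrix.toLin' E.transpose := by
    ext i j
    simp
  rw [this, LinearMap.det_toLin', Matrix.det_transpose]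

lemma card_ker_monomialHom {E : Matrix (Fin n) (Fin n) ℤ} (hE : E.det ≠ 0) :
    Nat.card (monomialHom E).ker = E.det.natAbs := by
  classical
  rw [← range_index hE]
  set N := E.vecMulLinear.range with hN
  have hfin : Finite ((Fin n → ℤ) ⧸ N) := by
    refine Nat.finite_of_card_ne_zero ?_
    rw [range_index hE]
    simpa using hE
  rw [show Nat.card ((Fin n → ℤ) ⧸ N) = Nat.card (Multiplicative ((Fin n → ℤ) ⧸ N)) from
    (Nat.card_congr Multiplicative.toAdd).symm]
  have : NeZero (Monoid.exponent (Multiplicative ((Fin n → ℤ) ⧸ N))) :=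
    ⟨Monoid.exponent_ne_zero_of_finite⟩
  rw [← CommGroup.card_monoidHom_of_hasEnoughRootsOfUnity
    (Multiplicative ((Fin n → ℤ) ⧸ N)) ℂ]
  symm
  have key : ∀ (χ : (Fin n → ℤ) →+ Additive ℂˣ) (v : Fin n → ℤ),
      (χ v).toMul = ∏ k, (χ (Pi.single k 1)).toMul ^ v k := by
    intro χ v
    have : v = ∑ k, v k • (Pi.single k 1 : Fin n → ℤ) := by
      ext i; simp [Finset.sum_apply, Pi.single_apply]
    conv_lhs => rw [this]
    simp only [map_sum, map_zsmul, toMul_sum, toMul_zsmul]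
  let ev : (Multiplicative ((Fin n → ℤ) ⧸ N) →* ℂˣ) → ((Fin n → ℤ) →+ Additive ℂˣ) := fun χ =>
    (AddMonoidHom.toMultiplicativeLeft.symm χ).comp N.mkQ.toAddMonoidHom
  have hev : ∀ χ v, (ev χ v).toMul = χ (Multiplicative.ofAdd (N.mkQ v)) := fun _ _ => rfl
  refine Nat.card_congr (Equiv.ofBijective
    (fun χ => ⟨fun k => (ev χ (Pi.single k 1)).toMul, ?_⟩) ⟨?_, ?_⟩)
  · rw [MonoidHom.mem_ker]
    funext j
    rw [monomialHom_apply, ← key, hev]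
    have : N.mkQ (E j) = 0 := by
      rw [Submodule.mkQ_apply, Submodule.Quotient.mk_eq_zero]
      exact ⟨Pi.single j 1, by simp [Matrix.row]⟩
    rw [this]; simp
  · intro χ ψ h
    refine MonoidHom.ext fun q => ?_
    obtain ⟨v, hv⟩ := N.mkQ_surjective q.toAdd
    have h1 : q = Multiplicative.ofAdd (N.mkQ v) := by rw [hv]; rfl
    rw [h1, ← hev, ← hev, key, key (ev ψ)]
    have h2 := congrArg Subtype.val h
    dsimp only at h2
    simp only [fun k => congrFun h2 k]
  · rintro ⟨η, hη⟩
    let f : (Fin n → ℤ) →+ Additive ℂˣ :=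
      { toFun := fun v => Additive.ofMul (∏ k, η k ^ v k)
        map_zero' := by simp
        map_add' := fun v w => by simp [zpow_add, Finset.prod_mul_distrib] }
    have hf : N ≤ LinearMap.ker f.toIntLinearMap := by
      rintro _ ⟨v, rfl⟩
      rw [LinearMap.mem_ker]
      have h1 : E.vecMulLinear v = ∑ j, v j • E j := by
        ext k; simp [Matrix.vecMul, dotProduct, Finset.sum_apply]
      rw [h1, map_sum]
      refine Finset.sum_eq_zero fun j _ => ?_
      rw [map_zsmul]
      have : f.toIntLinearMap (E j) = 0 := congrFun hη j
      rw [this, smul_zero]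
    refine ⟨AddMonoidHom.toMultiplicativeLeft (N.liftQ f.toIntLinearMap hf).toAddMonoidHom, ?_⟩
    ext k
    simp only [hev]
    show ((N.liftQ f.toIntLinearMap hf (N.mkQ (Pi.single k 1))).toMul : ℂ) = _
    rw [Submodule.mkQ_apply, Submodule.liftQ_apply]
    show ((∏ i, η i ^ (Pi.single k (1:ℤ) : Fin n → ℤ) i : ℂˣ) : ℂ) = _
    rw [Finset.prod_eq_single k]
    · simp
    · intro i _ hi
      simp [hi]
    · simp

lemma card_monomialHom_fiber {E : Matrix (Fin n) (Fin n) ℤ} (hE : E.det ≠ 0) (y : Fin n → ℂˣ) :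
    Nat.card {η // monomialHom E η = y} = E.det.natAbs := by
  rw [← card_ker_monomialHom hE]
  exact Nat.card_congr ((monomialHom E).fiberEquivKerOfSurjective (monomialHom_surjective hE) y)

lemma exists_linearIndependent_rat_real (ι : Type) [Countable ι] :
    ∃ ν : ι → ℝ, LinearIndependent ℚ ν := by
  let B := Module.Basis.ofVectorSpace ℚ ℝ
  have h : Cardinal.mk ι ≤ Cardinal.mk (Module.Basis.ofVectorSpaceIndex ℚ ℝ) := by
    rw [B.mk_eq_rank'', Real.rank_rat_real]
    exact Cardinal.mk_le_aleph0.trans Cardinal.aleph0_le_continuum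
  obtain ⟨f⟩ := Cardinal.le_def _ _ |>.1 h
  exact ⟨B ∘ f, B.linearIndependent.comp f f.injective⟩

lemma linearIndependent_weight_injective {ι : Type*} {ν : ι → ℝ} (hν : LinearIndependent ℚ ν) :
    Function.Injective (fun m : ι →₀ ℕ => m.sum fun p k => (k : ℝ) * ν p) := by
  intro m m' h
  have key : ∀ m : ι →₀ ℕ, Finsupp.linearCombination ℚ ν (m.mapRange (Nat.cast : ℕ → ℚ) (by simp)) =
      m.sum fun p k => (k : ℝ) * ν p := by
    intro m
    rw [Finsupp.linearCombination_apply, Finsupp.sum_mapRange_index (by simp)]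
    refine Finsupp.sum_congr fun p _ => ?_
    rw [Rat.smul_def]; simp
  dsimp only at h
  rw [← key, ← key] at h
  have := hν h
  ext p
  have h2 := DFunLike.congr_fun this p
  simpa using h2

/-- A nonzero integer polynomial does not vanish along a generic exponential curve. -/
lemma eventually_aeval_exp_ne_zero {ι : Type*} {ν : ι → ℝ} (hν : LinearIndependent ℚ ν)
    {D : MvPolynomial ι ℤ} (hD : D ≠ 0) :
    ∀ᶠ τ : ℝ in Filter.atTop,
      MvPolynomial.aeval (fun p => (Complex.exp ((-τ * ν p : ℝ)) : ℂ)) D ≠ 0 := by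
  classical
  set L : (ι →₀ ℕ) → ℝ := fun m => m.sum fun p k => (k : ℝ) * ν p with hL
  obtain ⟨m0, hm0, hmin⟩ := Finset.exists_min_image D.support L
    (MvPolynomial.support_nonempty.2 hD)
  have hval : ∀ τ : ℝ, MvPolynomial.aeval (fun p => (Complex.exp ((-τ * ν p : ℝ)) : ℂ)) D =
      ∑ m ∈ D.support, ((D.coeff m : ℤ) : ℂ) * Complex.exp ((-τ * L m : ℝ)) := by
    intro τ
    rw [MvPolynomial.aeval_def, MvPolynomial.eval₂_eq]
    refine Finset.sum_congr rfl fun m _ => ?_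
    congr 1
    rw [hL]
    simp only [Finsupp.sum, Finset.mul_sum, Complex.ofReal_sum, Complex.exp_sum]
    refine Finset.prod_congr rfl fun p _ => ?_
    rw [← Complex.exp_nat_mul]
    congr 1
    push_cast
    ring
  have hlim : Filter.Tendsto (fun τ : ℝ => ∑ m ∈ D.support,
      ((D.coeff m : ℤ) : ℂ) * Complex.exp ((-τ * (L m - L m0) : ℝ))) Filter.atTop
      (nhds (∑ m ∈ D.support, if m = m0 then ((D.coeff m : ℤ) : ℂ) else 0)) := by
    refine tendsto_finsetSum _ fun m hm => ?_
    split_ifs with h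
    · subst h; simp
    · have hlt : 0 < L m - L m0 := sub_pos.2 <| lt_of_le_of_ne (hmin m hm) fun h' =>
        h (linearIndependent_weight_injective hν h'.symm)
      rw [← mul_zero ((D.coeff m : ℤ) : ℂ)]
      refine Filter.Tendsto.const_mul _ ?_
      have h1 : Filter.Tendsto (fun τ : ℝ => Real.exp (-τ * (L m - L m0))) Filter.atTop (nhds 0) := by
        refine Real.tendsto_exp_atBot.comp ?_
        simp only [neg_mul]
        exact Filter.tendsto_neg_atTop_atBot.comp (Filter.tendsto_id.atTop_mul_const hlt)
      have h2 := (Complex.continuous_ofReal.tendsto 0).comp h1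
      simpa [Function.comp_def] using h2
  rw [Finset.sum_ite_eq' D.support m0, if_pos hm0] at hlim
  have hne : ((D.coeff m0 : ℤ) : ℂ) ≠ 0 := by exact_mod_cast MvPolynomial.mem_support_iff.1 hm0
  filter_upwards [hlim.eventually_ne hne] with τ hτ h0
  apply hτ
  rw [hval] at h0
  have : ∑ m ∈ D.support, ((D.coeff m : ℤ) : ℂ) * Complex.exp ((-τ * (L m - L m0) : ℝ)) =
      Complex.exp ((τ * L m0 : ℝ)) *
        ∑ m ∈ D.support, ((D.coeff m : ℤ) : ℂ) * Complex.exp ((-τ * L m : ℝ)) := by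
    rw [Finset.mul_sum]
    refine Finset.sum_congr rfl fun m _ => ?_
    rw [mul_left_comm, ← Complex.exp_add]
    congr 2
    push_cast; ring
  rw [this, h0, mul_zero]

lemma chEval_mul (ξ η : Fin n → ℂˣ) (a : Fin n → ℤ) :
    chEval (ξ * η) a = chEval ξ a * chEval η a := by
  simp [chEval, mul_zpow, Finset.prod_mul_distrib]

lemma chEval_ne_zero (ξ : Fin n → ℂˣ) (a : Fin n → ℤ) : chEval ξ a ≠ 0 :=
  Finset.prod_ne_zero_iff.2 fun _ _ => Units.ne_zero _

/-- The coordinatewise exponential `ℂ^n → (ℂˣ)^n`. -/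
def expUnits (z : Fin n → ℂ) : Fin n → ℂˣ := fun k => Units.mk0 (Complex.exp (z k)) (Complex.exp_ne_zero _)

lemma chEval_expUnits (z : Fin n → ℂ) (a : Fin n → ℤ) :
    chEval (expUnits z) a = Complex.exp (∑ k, (a k : ℂ) * z k) := by
  simp [chEval, expUnits, Complex.exp_sum, ← Complex.exp_int_mul]

/-- The Laurent system with coefficients `v.1` in logarithmic coordinates centred at `η₀`. -/
def logSystem (A : Fin n → Finset (Fin n → ℤ)) (η₀ : Fin n → ℂˣ)
    (v : ((Σ j, {x // x ∈ A j}) → ℂ) × (Fin n → ℂ)) : Fin n → ℂ :=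
  fun j => ∑ x : {x // x ∈ A j}, v.1 ⟨j, x⟩ * (chEval η₀ x.1 * Complex.exp (∑ k, (x.1 k : ℂ) * v.2 k))

/-- The indicator coefficients of a family of binomial systems. -/
def edgeIndicator (A : Fin n → Finset (Fin n → ℤ)) (a b : Fin n → Fin n → ℤ) :
    (Σ j, {x // x ∈ A j}) → ℂ :=
  fun p => by classical exact if p.2.1 ∈ ({a p.1, b p.1} : Finset (Fin n → ℤ)) then 1 else 0

lemma logSystem_edgeIndicator {A : Fin n → Finset (Fin n → ℤ)} {a b : Fin n → Fin n → ℤ}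
    (ha : ∀ j, a j ∈ A j) (hb : ∀ j, b j ∈ A j) (hab : ∀ j, a j ≠ b j) (η₀ : Fin n → ℂˣ)
    (z : Fin n → ℂ) (j : Fin n) :
    logSystem A η₀ (edgeIndicator A a b, z) j =
      chEval η₀ (a j) * Complex.exp (∑ k, (a j k : ℂ) * z k) +
      chEval η₀ (b j) * Complex.exp (∑ k, (b j k : ℂ) * z k) := by
  classical
  simp only [logSystem, edgeIndicator]
  rw [Finset.sum_coe_sort (A j) (fun x => (if x ∈ ({a j, b j} : Finset (Fin n → ℤ)) then (1:ℂ) else 0) *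
    (chEval η₀ x * Complex.exp (∑ k, (x k : ℂ) * z k)))]
  simp only [ite_mul, one_mul, zero_mul]
  rw [← Finset.sum_filter, Finset.filter_mem_eq_inter, Finset.inter_eq_right.2, Finset.sum_pair (hab j)]
  intro x hx
  rcases Finset.mem_insert.1 hx with rfl | hx
  · exact ha j
  · rw [Finset.mem_singleton.1 hx]; exact hb j

lemma exists_implicit_root {A : Fin n → Finset (Fin n → ℤ)} {a b : Fin n → Fin n → ℤ}
    (ha : ∀ j, a j ∈ A j) (hb : ∀ j, b j ∈ A j) (hab : ∀ j, a j ≠ b j)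
    (hdet : (edgeMatrix a b).det ≠ 0) {η₀ : Fin n → ℂˣ}
    (h0 : ∀ j, chEval η₀ (a j) + chEval η₀ (b j) = 0) :
    ∃ ψ : ((Σ j, {x // x ∈ A j}) → ℂ) → (Fin n → ℂ),
      Filter.Tendsto ψ (nhds (edgeIndicator A a b)) (nhds 0) ∧
      ∀ᶠ v in nhds (edgeIndicator A a b, (0 : Fin n → ℂ)), logSystem A η₀ v = 0 ↔ ψ v.1 = v.2 := by
  set u : ((Σ j, {x // x ∈ A j}) → ℂ) × (Fin n → ℂ) := (edgeIndicator A a b, 0) with hu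
  have hcd : ContDiff ℂ 1 (logSystem A η₀) := by
    unfold logSystem
    fun_prop
  have hs : HasStrictFDerivAt (logSystem A η₀) (fderiv ℂ (logSystem A η₀) u) u :=
    hcd.contDiffAt.hasStrictFDerivAt one_ne_zero
  have hz : logSystem A η₀ u = 0 := by
    funext j
    rw [hu, logSystem_edgeIndicator ha hb hab]
    simpa using h0 j
  have hder : ∀ h : Fin n → ℂ, ∀ j, fderiv ℂ (logSystem A η₀) u (0, h) j =
      chEval η₀ (b j) * ∑ k, ((edgeMatrix a b j k : ℤ) : ℂ) * h k := by
    intro h j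
    have h1 : HasDerivAt (fun t : ℂ => u + t • ((0 : (Σ j, {x // x ∈ A j}) → ℂ), h)) (0, h) 0 := by
      simpa using ((hasDerivAt_id (0:ℂ)).smul_const ((0 : (Σ j, {x // x ∈ A j}) → ℂ), h)).const_add u
    have h2 := HasFDerivAt.comp_hasDerivAt_of_eq (0:ℂ) hs.hasFDerivAt h1 (by simp)
    have h3 := (hasDerivAt_pi.1 h2) j
    have h4 : ∀ c : Fin n → ℤ, HasDerivAt (fun t : ℂ => chEval η₀ c *
        Complex.exp (∑ k, (c k : ℂ) * (t * h k))) (chEval η₀ c * ∑ k, (c k : ℂ) * h k) 0 := by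
      intro c
      have h5 : HasDerivAt (fun t : ℂ => ∑ k, (c k : ℂ) * (t * h k)) (∑ k, (c k : ℂ) * h k) 0 := by
        have := HasDerivAt.fun_sum (u := Finset.univ) (x := (0:ℂ))
          (A := fun k t => (c k : ℂ) * (t * h k)) (A' := fun k => (c k : ℂ) * h k) (fun k _ => by
            simpa using ((hasDerivAt_id (0:ℂ)).mul_const (h k)).const_mul (c k : ℂ))
        exact this
      simpa using h5.cexp.const_mul (chEval η₀ c)
    have h6 := h3.unique (((h4 (a j)).add (h4 (b j))).congr_of_eventuallyEq
      (Filter.Eventually.of_forall fun t => by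
        show logSystem A η₀ (u + t • ((0 : (Σ j, {x // x ∈ A j}) → ℂ), h)) j = _
        rw [hu, Prod.smul_mk, Prod.mk_add_mk, smul_zero, add_zero, zero_add,
          logSystem_edgeIndicator ha hb hab]
        simp))
    rw [h6, eq_neg_of_add_eq_zero_left (h0 j)]
    simp only [edgeMatrix, Matrix.of_apply, Int.cast_sub, sub_mul, Finset.sum_sub_distrib]
    ring
  have hinj : Function.Injective (fderiv ℂ (logSystem A η₀) u ∘L .inr ℂ _ _) := by
    rw [injective_iff_map_eq_zero]
    intro h hh
    have hM : ((edgeMatrix a b).map (Int.castRingHom ℂ)).det ≠ 0 := by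
      rw [← RingHom.mapMatrix_apply, ← RingHom.map_det]
      simpa using hdet
    refine Matrix.eq_zero_of_mulVec_eq_zero hM ?_
    funext j
    have := congrFun hh j
    rw [ContinuousLinearMap.comp_apply, ContinuousLinearMap.inr_apply, hder h j] at this
    simpa [Matrix.mulVec, dotProduct] using (mul_eq_zero.1 this).resolve_left (chEval_ne_zero _ _)
  have hinv : (fderiv ℂ (logSystem A η₀) u ∘L .inr ℂ _ _).IsInvertible :=
    ⟨(LinearEquiv.ofInjectiveEndo _ hinj).toContinuousLinearEquiv, by ext; rfl⟩
  refine ⟨hs.implicitFunctionOfProdDomain hinv, hs.tendsto_implicitFunctionOfProdDomain hinv, ?_⟩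
  have := hs.eventually_apply_eq_iff_implicitFunctionOfProdDomain hinv
  rwa [hz] at this

open Asymptotics Filter in
lemma nonneg_of_eventually_nonneg_add_isBigO {F : Filter ℝ} [F.NeBot] (hF : F ≤ atTop) {β : ℝ}
    {f : ℝ → ℝ} (hf : f =O[F] fun _ => (1 : ℝ)) (h : ∀ᶠ τ in F, 0 ≤ τ * β + f τ) : 0 ≤ β := by
  by_contra hβ
  push Not at hβ
  obtain ⟨C, hC⟩ := hf.bound
  obtain ⟨τ, h1, h2, h3⟩ := (h.and (hC.and (hF (eventually_gt_atTop (C / (-β)))))).exists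
  rw [div_lt_iff₀ (by linarith)] at h3
  simp only [norm_one, mul_one, Real.norm_eq_abs] at h2
  nlinarith [le_abs_self (f τ)]

open Asymptotics Filter in
lemma eq_zero_of_mul_isBigO_one {F : Filter ℝ} [F.NeBot] (hF : F ≤ atTop) {β : ℝ}
    (hf : (fun τ => τ * β) =O[F] fun _ => (1 : ℝ)) : β = 0 := by
  refine le_antisymm ?_ ?_
  · have := nonneg_of_eventually_nonneg_add_isBigO (β := -β) hF hf (.of_forall fun τ => by simp)
    linarith
  · exact nonneg_of_eventually_nonneg_add_isBigO (f := fun τ => -(τ * β)) hF hf.neg_left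
      (.of_forall fun τ => by simp)

/-- The common roots in the torus of a square Laurent system with coefficients `c`. -/
def sysRoots (A : Fin n → Finset (Fin n → ℤ)) (c : Fin n → (Fin n → ℤ) → ℂ) :
    Set (Fin n → ℂˣ) :=
  {ξ | ∀ j, ∑ a ∈ A j, c j a * chEval ξ a = 0}

/-- The coefficients `exp (-τ ν)`. -/
def expCoeff (ν : Fin n → (Fin n → ℤ) → ℝ) (τ : ℝ) : Fin n → (Fin n → ℤ) → ℂ :=
  fun j a => Complex.exp ((-τ * ν j a : ℝ))

/-- The vector of logarithms of absolute values. -/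
def logAbs (ξ : Fin n → ℂˣ) : Fin n → ℝ := fun k => Real.log ‖(ξ k : ℂ)‖

lemma norm_chEval (ξ : Fin n → ℂˣ) (a : Fin n → ℤ) :
    ‖chEval ξ a‖ = Real.exp (castR n a ⬝ᵥ logAbs ξ) := by
  simp only [chEval, dotProduct, Real.exp_sum, norm_prod, castR, logAbs]
  refine Finset.prod_congr rfl fun k _ => ?_
  rw [Units.val_zpow_eq_zpow_val, norm_zpow, mul_comm,
    ← Real.rpow_def_of_pos (norm_pos_iff.2 (ξ k).ne_zero), Real.rpow_intCast]

lemma norm_expCoeff_mul_chEval (ν : Fin n → (Fin n → ℤ) → ℝ) (τ : ℝ) (ξ : Fin n → ℂˣ) (j : Fin n)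
    (a : Fin n → ℤ) : ‖expCoeff ν τ j a * chEval ξ a‖ =
      Real.exp (-τ * ν j a + castR n a ⬝ᵥ logAbs ξ) := by
  rw [norm_mul, norm_chEval, expCoeff, Complex.norm_exp, Complex.ofReal_re, ← Real.exp_add]

open Asymptotics Filter in
lemma exists_weight_isBigO {A : Fin n → Finset (Fin n → ℤ)} (hA : ∀ j, (A j).Nonempty)
    {ν : Fin n → (Fin n → ℤ) → ℝ}
    (hν : LinearIndependent ℚ (fun p : Fin n × (Fin n → ℤ) => ν p.1 p.2))
    {F : Ultrafilter ℝ} (hF : (F : Filter ℝ) ≤ atTop) {ξ : ℝ → Fin n → ℂˣ}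
    (hξ : ∀ᶠ τ in (F : Filter ℝ), ξ τ ∈ sysRoots A (expCoeff ν τ)) :
    ∃ w : Fin n → ℝ, (∀ j, 2 ≤ (faceSet A ν w j).card) ∧
      ∀ k, (fun τ => logAbs (ξ τ) k + τ * w k) =O[(F : Filter ℝ)] fun _ => (1 : ℝ) := by
  classical
  set T : ℝ → Fin n → (Fin n → ℤ) → ℝ := fun τ j a => -τ * ν j a + castR n a ⬝ᵥ logAbs (ξ τ) with hT
  have hmax : ∀ j, ∃ a ∈ A j, ∀ᶠ τ in (F : Filter ℝ), ∀ b ∈ A j, T τ j b ≤ T τ j a := by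
    intro j
    have : ∀ᶠ τ in (F : Filter ℝ), ∃ a ∈ A j, ∀ b ∈ A j, T τ j b ≤ T τ j a :=
      .of_forall fun τ => Finset.exists_max_image (A j) (T τ j) (hA j)
    have h2 : (⋃ a ∈ (A j : Set (Fin n → ℤ)), {τ | ∀ b ∈ A j, T τ j b ≤ T τ j a}) ∈ F := by
      filter_upwards [this] with τ hτ
      simpa using hτ
    obtain ⟨a, ha, h3⟩ := (Ultrafilter.finite_biUnion_mem_iff (A j).finite_toSet).1 h2
    exact ⟨a, ha, h3⟩
  choose a ha hmax using hmax
  set S : Fin n → Finset (Fin n → ℤ) := fun j => (A j).filter fun b =>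
    ∃ C, ∀ᶠ τ in (F : Filter ℝ), T τ j (a j) - T τ j b ≤ C with hS
  have haS : ∀ j, a j ∈ S j := fun j => Finset.mem_filter.2 ⟨ha j, 0, .of_forall fun τ => by simp⟩
  have hSO : ∀ j, ∀ b ∈ S j, (fun τ => T τ j b - T τ j (a j)) =O[(F : Filter ℝ)] fun _ => (1 : ℝ) := by
    intro j b hb
    obtain ⟨hbA, C, hC⟩ := Finset.mem_filter.1 hb
    refine IsBigO.of_bound C ?_
    filter_upwards [hC, hmax j] with τ h1 h2
    rw [norm_one, mul_one, Real.norm_eq_abs, abs_sub_comm, abs_of_nonneg (sub_nonneg.2 (h2 b hbA))]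
    exact h1
  have hcard : ∀ j, 2 ≤ (S j).card := by
    intro j
    by_contra hlt
    have h1 : ∀ b ∈ (A j).erase (a j), ∀ᶠ τ in (F : Filter ℝ),
        Real.log ((A j).card + 1) ≤ T τ j (a j) - T τ j b := by
      intro b hb
      have hbS : b ∉ S j := fun hbS => hlt <| by
        rw [← Finset.card_pair (Finset.ne_of_mem_erase hb)]
        exact Finset.card_le_card (by
          intro x hx
          rcases Finset.mem_insert.1 hx with rfl | hx
          · exact hbS
          · rw [Finset.mem_singleton.1 hx]; exact haS j)
      have h2 : ¬ ∀ᶠ τ in (F : Filter ℝ), T τ j (a j) - T τ j b ≤ Real.log ((A j).card + 1) :=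
        fun h => hbS (Finset.mem_filter.2 ⟨Finset.mem_of_mem_erase hb, _, h⟩)
      filter_upwards [Ultrafilter.eventually_not.2 h2] with τ hτ
      exact (not_le.1 hτ).le
    have h2 := (eventually_all_finset _).2 h1
    obtain ⟨τ, hτ1, hτ2⟩ := (h2.and hξ).exists
    have h3 := hτ2 j
    rw [← Finset.add_sum_erase _ _ (ha j)] at h3
    have h4 : ‖expCoeff ν τ j (a j) * chEval (ξ τ) (a j)‖ ≤
        ∑ b ∈ (A j).erase (a j), Real.exp (T τ j (a j)) / ((A j).card + 1) := by
      rw [eq_neg_of_add_eq_zero_left h3, norm_neg]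
      refine (norm_sum_le _ _).trans (Finset.sum_le_sum fun b hb => ?_)
      rw [norm_expCoeff_mul_chEval, le_div_iff₀ (by positivity)]
      have h5 := hτ1 b hb
      have h6 : ((A j).card + 1 : ℝ) = Real.exp (Real.log ((A j).card + 1)) :=
        (Real.exp_log (by positivity)).symm
      rw [h6, ← Real.exp_add]
      exact Real.exp_le_exp.2 (by rw [← le_sub_iff_add_le']; exact h5)
    rw [norm_expCoeff_mul_chEval, Finset.sum_const, nsmul_eq_mul, mul_div_assoc',
      le_div_iff₀ (by positivity), mul_comm] at h4
    have h5 := le_of_mul_le_mul_right h4 (Real.exp_pos _)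
    have h6 : (((A j).erase (a j)).card : ℝ) ≤ (A j).card := by
      exact_mod_cast Finset.card_le_card (Finset.erase_subset _ _)
    linarith
  have hli : LinearIndependent ℚ (fun p : (Σ j, {x // x ∈ (S j).erase (a j)}) =>
      castQ p.2.1 - castQ (a p.1)) := by
    refine linearIndependent_sub_of_relations hν S a fun c hc => ?_
    refine eq_zero_of_mul_isBigO_one hF ?_
    have h1 : (fun τ => ∑ p : (Σ j, {x // x ∈ (S j).erase (a j)}),
        (c p : ℝ) * (T τ p.1 p.2.1 - T τ p.1 (a p.1))) =O[(F : Filter ℝ)] fun _ => (1 : ℝ) :=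
      IsBigO.fun_sum fun p _ => (hSO p.1 p.2.1 (Finset.mem_of_mem_erase p.2.2)).const_mul_left _
    refine h1.neg_left.congr_left fun τ => ?_
    have h2 := sum_cast_mul_dotProduct hc (logAbs (ξ τ))
    have h3 : ∀ p : (Σ j, {x // x ∈ (S j).erase (a j)}),
        (c p : ℝ) * (T τ p.1 p.2.1 - T τ p.1 (a p.1)) =
        -(τ * ((c p : ℝ) * (ν p.1 p.2.1 - ν p.1 (a p.1)))) +
          (c p : ℝ) * ((castR n p.2.1 - castR n (a p.1)) ⬝ᵥ logAbs (ξ τ)) := by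
      intro p; simp only [hT, sub_dotProduct]; ring
    rw [Finset.sum_congr rfl fun p _ => h3 p, Finset.sum_add_distrib, h2, add_zero,
      Finset.sum_neg_distrib, neg_neg, Finset.mul_sum]
  have hb : ∀ j, ∃ b ∈ S j, a j ≠ b := by
    intro j
    obtain ⟨b, hb, hne⟩ := Finset.exists_mem_ne (Nat.lt_of_succ_le (hcard j)) (a j)
    exact ⟨b, hb, hne.symm⟩
  choose b hb hab using hb
  have hdet := det_edgeMatrix_ne_zero hb hab hli
  set E : Matrix (Fin n) (Fin n) ℝ := (edgeMatrix a b).map (Int.castRingHom ℝ) with hE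
  have hEdet : IsUnit E.det := by
    rw [hE, ← RingHom.mapMatrix_apply, ← RingHom.map_det]
    simpa using hdet
  have hEapp : ∀ j (v : Fin n → ℝ), E.mulVec v j = (castR n (b j) - castR n (a j)) ⬝ᵥ v := by
    intro j v
    simp [hE, Matrix.mulVec, dotProduct, edgeMatrix, castR]
  set w : Fin n → ℝ := E⁻¹.mulVec fun j => -(ν j (b j) - ν j (a j)) with hw
  have hEw : ∀ j, (castR n (b j) - castR n (a j)) ⬝ᵥ w = -(ν j (b j) - ν j (a j)) := by
    intro j
    rw [← hEapp, hw, Matrix.mulVec_mulVec, Matrix.mul_nonsing_inv _ hEdet, Matrix.one_mulVec]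
  have hbd : ∀ k, (fun τ => logAbs (ξ τ) k + τ * w k) =O[(F : Filter ℝ)] fun _ => (1 : ℝ) := by
    intro k
    have h1 : (fun τ => ∑ j, E⁻¹ k j * (T τ j (b j) - T τ j (a j))) =O[(F : Filter ℝ)]
        fun _ => (1 : ℝ) := IsBigO.fun_sum fun j _ => (hSO j _ (hb j)).const_mul_left _
    refine h1.congr_left fun τ => ?_
    have h2 : ∀ j, T τ j (b j) - T τ j (a j) = E.mulVec (logAbs (ξ τ) + τ • w) j := by
      intro j
      rw [hEapp, dotProduct_add, dotProduct_smul, hEw j]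
      simp only [hT, sub_dotProduct, smul_eq_mul]; ring
    have h3 : ∑ j, E⁻¹ k j * (T τ j (b j) - T τ j (a j)) =
        E⁻¹.mulVec (E.mulVec (logAbs (ξ τ) + τ • w)) k := by
      simp [Matrix.mulVec, dotProduct, h2]
    rw [h3, Matrix.mulVec_mulVec, Matrix.nonsing_inv_mul _ hEdet, Matrix.one_mulVec]
    rfl
  have hdecomp : ∀ τ j x, T τ j (a j) - T τ j x =
      τ * ((ν j x + castR n x ⬝ᵥ w) - (ν j (a j) + castR n (a j) ⬝ᵥ w)) +
      (castR n (a j) - castR n x) ⬝ᵥ (logAbs (ξ τ) + τ • w) := by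
    intro τ j x
    simp only [hT, dotProduct_add, dotProduct_smul, sub_dotProduct, smul_eq_mul]; ring
  have hdO : ∀ v : Fin n → ℝ, (fun τ => v ⬝ᵥ (logAbs (ξ τ) + τ • w)) =O[(F : Filter ℝ)]
      fun _ => (1 : ℝ) := fun v => IsBigO.fun_sum fun k _ => (hbd k).const_mul_left _
  have hge : ∀ j, ∀ x ∈ A j, 0 ≤ (ν j x + castR n x ⬝ᵥ w) - (ν j (a j) + castR n (a j) ⬝ᵥ w) := by
    intro j x hx
    refine nonneg_of_eventually_nonneg_add_isBigO hF (hdO (castR n (a j) - castR n x)) ?_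
    filter_upwards [hmax j] with τ hτ
    rw [← hdecomp]
    exact sub_nonneg.2 (hτ x hx)
  refine ⟨w, fun j => (hcard j).trans (Finset.card_le_card fun x hx => ?_), hbd⟩
  have hxA := (Finset.mem_filter.1 hx).1
  have h0 : (ν j x + castR n x ⬝ᵥ w) - (ν j (a j) + castR n (a j) ⬝ᵥ w) = 0 := by
    refine eq_zero_of_mul_isBigO_one hF ?_
    refine ((hSO j x hx).neg_left.sub (hdO (castR n (a j) - castR n x))).congr_left fun τ => ?_
    rw [neg_sub, hdecomp]; ring
  refine mem_faceSet.2 ⟨hxA, fun y hy => ?_⟩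
  linarith [hge j y hy]

/-- The one-parameter subgroup `τ ↦ exp (-τ w)` of the torus. -/
def torusCurve (w : Fin n → ℝ) (τ : ℝ) : Fin n → ℂˣ := expUnits fun k => ((-τ * w k : ℝ) : ℂ)

lemma logAbs_mul (ξ η : Fin n → ℂˣ) : logAbs (ξ * η) = logAbs ξ + logAbs η := by
  ext k
  simp [logAbs, Real.log_mul]

lemma logAbs_inv (ξ : Fin n → ℂˣ) : logAbs ξ⁻¹ = -logAbs ξ := by
  ext k
  simp [logAbs]

lemma logAbs_torusCurve (w : Fin n → ℝ) (τ : ℝ) (k : Fin n) :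
    logAbs (torusCurve w τ) k = -(τ * w k) := by
  simp [logAbs, torusCurve, expUnits, Complex.norm_exp]

lemma chEval_torusCurve (w : Fin n → ℝ) (τ : ℝ) (a : Fin n → ℤ) :
    chEval (torusCurve w τ) a = Complex.exp ((-τ * (castR n a ⬝ᵥ w) : ℝ)) := by
  rw [torusCurve, chEval_expUnits]
  congr 1
  simp only [castR, dotProduct, Finset.mul_sum, Complex.ofReal_sum]
  refine Finset.sum_congr rfl fun k _ => ?_
  push_cast; ring

/-- The coefficients of the family `exp (-τ ν)` after rescaling by a torus curve. -/
def rescaledCoeff (A : Fin n → Finset (Fin n → ℤ)) (ν : Fin n → (Fin n → ℤ) → ℝ) (w : Fin n → ℝ)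
    (a : Fin n → Fin n → ℤ) (τ : ℝ) : (Σ j, {x // x ∈ A j}) → ℂ := fun p =>
  Complex.exp ((-τ * ((ν p.1 p.2.1 + castR n p.2.1 ⬝ᵥ w) -
    (ν p.1 (a p.1) + castR n (a p.1) ⬝ᵥ w)) : ℝ))

lemma torusCurve_mul_mem_sysRoots_iff (A : Fin n → Finset (Fin n → ℤ))
    (ν : Fin n → (Fin n → ℤ) → ℝ) (w : Fin n → ℝ) (a : Fin n → Fin n → ℤ) (τ : ℝ)
    (η₀ : Fin n → ℂˣ) (z : Fin n → ℂ) :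
    torusCurve w τ * η₀ * expUnits z ∈ sysRoots A (expCoeff ν τ) ↔
      logSystem A η₀ (rescaledCoeff A ν w a τ, z) = 0 := by
  rw [funext_iff]
  refine forall_congr' fun j => ?_
  rw [← Finset.sum_coe_sort]
  have : ∑ x : {x // x ∈ A j}, expCoeff ν τ j x.1 *
      chEval (torusCurve w τ * η₀ * expUnits z) x.1 =
      Complex.exp ((-τ * (ν j (a j) + castR n (a j) ⬝ᵥ w) : ℝ)) *
      logSystem A η₀ (rescaledCoeff A ν w a τ, z) j := by
    rw [logSystem, Finset.mul_sum]
    refine Finset.sum_congr rfl fun x _ => ?_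
    rw [chEval_mul, chEval_mul, chEval_torusCurve, chEval_expUnits]
    simp only [expCoeff, rescaledCoeff]
    rw [← mul_assoc, ← mul_assoc, ← mul_assoc, ← mul_assoc, ← Complex.exp_add, ← Complex.exp_add]
    congr 3
    push_cast; ring
  rw [this]
  simp [Complex.exp_ne_zero]

open Filter in
lemma tendsto_rescaledCoeff {A : Fin n → Finset (Fin n → ℤ)} {ν : Fin n → (Fin n → ℤ) → ℝ}
    {w : Fin n → ℝ} {a b : Fin n → Fin n → ℤ} (h : ∀ j, faceSet A ν w j = {a j, b j}) :
    Tendsto (rescaledCoeff A ν w a) atTop (nhds (edgeIndicator A a b)) := by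
  classical
  rw [tendsto_pi_nhds]
  rintro ⟨j, x, hx⟩
  have haf : a j ∈ faceSet A ν w j := by rw [h j]; simp
  simp only [edgeIndicator, rescaledCoeff]
  rw [mem_faceSet] at haf
  split_ifs with hxm
  · rw [← h j, mem_faceSet] at hxm
    have : (ν j x + castR n x ⬝ᵥ w) - (ν j (a j) + castR n (a j) ⬝ᵥ w) = 0 := by
      linarith [hxm.2 _ haf.1, haf.2 _ hx]
    simp [this]
  · have hlt : 0 < (ν j x + castR n x ⬝ᵥ w) - (ν j (a j) + castR n (a j) ⬝ᵥ w) := by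
      refine sub_pos.2 (lt_of_le_of_ne (haf.2 _ hx) fun h' => hxm ?_)
      rw [← h j, mem_faceSet]
      exact ⟨hx, fun y hy => h' ▸ haf.2 y hy⟩
    have h1 : Tendsto (fun τ : ℝ => Real.exp (-τ * ((ν j x + castR n x ⬝ᵥ w) -
        (ν j (a j) + castR n (a j) ⬝ᵥ w)))) atTop (nhds 0) := by
      refine Real.tendsto_exp_atBot.comp ?_
      simp only [neg_mul]
      exact tendsto_neg_atTop_atBot.comp (tendsto_id.atTop_mul_const hlt)
    simpa [Function.comp_def] using (Complex.continuous_ofReal.tendsto 0).comp h1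

lemma chEval_add_chEval_eq_zero_iff (a b : Fin n → Fin n → ℤ) (η : Fin n → ℂˣ) :
    (∀ j, chEval η (a j) + chEval η (b j) = 0) ↔ monomialHom (edgeMatrix a b) η = fun _ => -1 := by
  rw [funext_iff]
  refine forall_congr' fun j => ?_
  rw [Units.ext_iff, monomialHom_apply]
  have : ((∏ k, η k ^ edgeMatrix a b j k : ℂˣ) : ℂ) = chEval η (b j) / chEval η (a j) := by
    simp [chEval, edgeMatrix, zpow_sub, div_eq_mul_inv,
      Finset.prod_mul_distrib]
  rw [this, div_eq_iff (chEval_ne_zero _ _)]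
  simp only [Units.val_neg, Units.val_one, neg_one_mul]
  rw [add_comm, add_eq_zero_iff_eq_neg]

open Filter in
lemma exists_root_branch {A : Fin n → Finset (Fin n → ℤ)} {ν : Fin n → (Fin n → ℤ) → ℝ}
    {w : Fin n → ℝ} {a b : Fin n → Fin n → ℤ} (hab : ∀ j, a j ≠ b j ∧ faceSet A ν w j = {a j, b j})
    (hdet : (edgeMatrix a b).det ≠ 0) {η₀ : Fin n → ℂˣ}
    (h0 : ∀ j, chEval η₀ (a j) + chEval η₀ (b j) = 0) :
    ∃ r : ℝ → Fin n → ℂˣ, (∀ᶠ τ in atTop, r τ ∈ sysRoots A (expCoeff ν τ)) ∧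
      (∀ k, Tendsto (fun τ => (((torusCurve w τ)⁻¹ * r τ) k : ℂ)) atTop (nhds (η₀ k))) ∧
      ∀ (F : Filter ℝ) (ξ : ℝ → Fin n → ℂˣ) (z : ℝ → Fin n → ℂ), F ≤ atTop →
        Tendsto z F (nhds 0) → (∀ τ, ξ τ = torusCurve w τ * η₀ * expUnits (z τ)) →
        (∀ᶠ τ in F, ξ τ ∈ sysRoots A (expCoeff ν τ)) → ∀ᶠ τ in F, ξ τ = r τ := by
  have hmem : ∀ j, a j ∈ A j ∧ b j ∈ A j := fun j =>
    ⟨(mem_faceSet.1 (by rw [(hab j).2]; simp : a j ∈ faceSet A ν w j)).1,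
      (mem_faceSet.1 (by rw [(hab j).2]; simp : b j ∈ faceSet A ν w j)).1⟩
  obtain ⟨ψ, hψ, hev⟩ := exists_implicit_root (fun j => (hmem j).1) (fun j => (hmem j).2)
    (fun j => (hab j).1) hdet h0
  have hδ := tendsto_rescaledCoeff fun j => (hab j).2
  have hψδ := hψ.comp hδ
  refine ⟨fun τ => torusCurve w τ * η₀ * expUnits (ψ (rescaledCoeff A ν w a τ)), ?_, ?_, ?_⟩
  · have := (hδ.prodMk_nhds hψδ).eventually hev
    filter_upwards [this] with τ hτ
    rw [torusCurve_mul_mem_sysRoots_iff A ν w a]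
    exact hτ.2 rfl
  · intro k
    have h1 : Tendsto (fun τ => (η₀ k : ℂ) * Complex.exp (ψ (rescaledCoeff A ν w a τ) k)) atTop
        (nhds ((η₀ k : ℂ) * Complex.exp ((0 : Fin n → ℂ) k))) :=
      Tendsto.const_mul _ ((Complex.continuous_exp.tendsto _).comp (tendsto_pi_nhds.1 hψδ k))
    simp only [Pi.zero_apply, Complex.exp_zero, mul_one] at h1
    refine h1.congr fun τ => ?_
    beta_reduce
    rw [mul_assoc, inv_mul_cancel_left]
    rfl
  · intro F ξ z hF hz hξz hξ
    have := ((hδ.mono_left hF).prodMk_nhds hz).eventually hev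
    filter_upwards [this, hξ] with τ hτ h1
    rw [hξz τ, torusCurve_mul_mem_sysRoots_iff A ν w a] at h1
    have h2 := hτ.1 h1
    rw [hξz τ, h2]

open Filter Asymptotics in
lemma eq_of_frequently_eq_of_tendsto {w w' : Fin n → ℝ} {η η' : Fin n → ℂˣ}
    {r r' : ℝ → Fin n → ℂˣ}
    (h : ∀ k, Tendsto (fun τ => (((torusCurve w τ)⁻¹ * r τ) k : ℂ)) atTop (nhds (η k)))
    (h' : ∀ k, Tendsto (fun τ => (((torusCurve w' τ)⁻¹ * r' τ) k : ℂ)) atTop (nhds (η' k)))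
    (hr : ∃ᶠ τ in atTop, r τ = r' τ) : w = w' ∧ η = η' := by
  set F := (atTop : Filter ℝ) ⊓ 𝓟 {τ | r τ = r' τ}
  have hF : F ≤ atTop := inf_le_left
  have : F.NeBot := frequently_iff_neBot.1 hr
  have hFr : ∀ᶠ τ in F, r τ = r' τ := mem_inf_of_right (mem_principal_self _)
  have hlog : ∀ {w : Fin n → ℝ} {η : Fin n → ℂˣ} {r : ℝ → Fin n → ℂˣ} (k),
      Tendsto (fun τ => (((torusCurve w τ)⁻¹ * r τ) k : ℂ)) atTop (nhds (η k)) →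
      (fun τ => τ * w k + logAbs (r τ) k) =O[F] fun _ => (1 : ℝ) := by
    intro w η r k h
    have h1 : Tendsto (fun τ => logAbs ((torusCurve w τ)⁻¹ * r τ) k) atTop
        (nhds (logAbs η k)) :=
      (h.norm).log (norm_ne_zero_iff.2 (η k).ne_zero)
    refine ((h1.mono_left hF).isBigO_one ℝ).congr_left fun τ => ?_
    rw [logAbs_mul, logAbs_inv, Pi.add_apply, Pi.neg_apply, logAbs_torusCurve, neg_neg]
  have hw : w = w' := by
    funext k
    refine sub_eq_zero.1 (eq_zero_of_mul_isBigO_one hF ?_)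
    refine ((hlog k (h k)).sub (hlog k (h' k))).congr' ?_ .rfl
    filter_upwards [hFr] with τ hτ
    rw [hτ]; ring
  refine ⟨hw, ?_⟩
  funext k
  refine Units.ext (tendsto_nhds_unique ((h k).mono_left hF)
    (((h' k).mono_left hF).congr' ?_))
  filter_upwards [hFr] with τ hτ
  rw [hτ, hw]

open Filter Asymptotics in
lemma exists_tendsto_of_isBigO {F : Ultrafilter ℝ} {w : Fin n → ℝ} {ξ : ℝ → Fin n → ℂˣ}
    (h : ∀ k, (fun τ => logAbs (ξ τ) k + τ * w k) =O[(F : Filter ℝ)] fun _ => (1 : ℝ)) :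
    ∃ (η₀ : Fin n → ℂˣ) (z : ℝ → Fin n → ℂ), Tendsto z F (nhds 0) ∧
      ∀ τ, ξ τ = torusCurve w τ * η₀ * expUnits (z τ) := by
  set η : ℝ → Fin n → ℂˣ := fun τ => (torusCurve w τ)⁻¹ * ξ τ with hη
  have hlim : ∀ k, ∃ x : ℂˣ, Tendsto (fun τ => (η τ k : ℂ)) F (nhds x) := by
    intro k
    obtain ⟨C, hC⟩ := (h k).bound
    have hlog : ∀ τ, Real.log ‖(η τ k : ℂ)‖ = logAbs (ξ τ) k + τ * w k := by
      intro τ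
      have : Real.log ‖(η τ k : ℂ)‖ = logAbs (η τ) k := rfl
      rw [this, hη, logAbs_mul, logAbs_inv, Pi.add_apply, Pi.neg_apply, logAbs_torusCurve]
      ring
    set K : Set ℂ := Metric.closedBall 0 (Real.exp C) ∩ {x | Real.exp (-C) ≤ ‖x‖}
    have hK : IsCompact K := (isCompact_closedBall _ _).inter_right
      (isClosed_le continuous_const continuous_norm)
    have hmem : ∀ᶠ τ in (F : Filter ℝ), (η τ k : ℂ) ∈ K := by
      filter_upwards [hC] with τ hτ
      rw [norm_one, mul_one, Real.norm_eq_abs, ← hlog, abs_le] at hτ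
      have hpos : 0 < ‖(η τ k : ℂ)‖ := norm_pos_iff.2 (η τ k).ne_zero
      exact ⟨by rw [mem_closedBall_zero_iff]; exact (Real.log_le_iff_le_exp hpos).1 hτ.2,
        (Real.le_log_iff_exp_le hpos).1 hτ.1⟩
    obtain ⟨x, hx, hFx⟩ := hK.ultrafilter_le_nhds (F.map fun τ => (η τ k : ℂ))
      (le_principal_iff.2 hmem)
    have hx0 : x ≠ 0 := norm_pos_iff.1 ((Real.exp_pos _).trans_le hx.2)
    exact ⟨Units.mk0 x hx0, hFx⟩
  choose η₀ hη₀ using hlim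
  refine ⟨η₀, fun τ k => Complex.log (η τ k / η₀ k), ?_, ?_⟩
  · rw [tendsto_pi_nhds]
    intro k
    have h1 : Tendsto (fun τ => (η τ k : ℂ) / η₀ k) F (nhds 1) := by
      have := (hη₀ k).div_const (η₀ k : ℂ)
      rwa [div_self (η₀ k).ne_zero] at this
    have h2 := h1.clog (by simp)
    simpa using h2
  · intro τ
    have : expUnits (fun k => Complex.log (η τ k / η₀ k)) = η₀⁻¹ * η τ := by
      ext k
      simp only [expUnits, Units.val_mk0]
      rw [Complex.exp_log (div_ne_zero (η τ k).ne_zero (η₀ k).ne_zero)]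
      simp [div_eq_inv_mul]
    rw [this, hη]
    simp


open Filter in
/-- Along a generic exponential curve the number of roots is eventually the mixed volume. -/
theorem exists_eventually_ncard_sysRoots {A : Fin n → Finset (Fin n → ℤ)}
    (hA : ∀ j, (A j).Nonempty) {ν : Fin n → (Fin n → ℤ) → ℝ}
    (hν : LinearIndependent ℚ (fun p : Fin n × (Fin n → ℤ) => ν p.1 p.2)) :
    ∃ M : ℕ, (M : ℝ) = mixedVolume n (fun j => convexHull ℝ (castR n '' ↑(A j))) ∧
      ∀ᶠ τ in atTop, (sysRoots A (expCoeff ν τ)).Finite ∧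
        (sysRoots A (expCoeff ν τ)).ncard = M := by
  classical
  obtain ⟨W, a, b, hW, hab, hdet, hM⟩ := exists_mixedCells hA hν
  refine ⟨_, hM, ?_⟩
  let I := Σ w : {w // w ∈ W},
    {η : Fin n → ℂˣ // ∀ j, chEval η (a w.1 j) + chEval η (b w.1 j) = 0}
  have hcardS : ∀ w : {w // w ∈ W},
      Nat.card {η : Fin n → ℂˣ // ∀ j, chEval η (a w.1 j) + chEval η (b w.1 j) = 0} =
        (edgeMatrix (a w.1) (b w.1)).det.natAbs := by
    intro w
    rw [← card_monomialHom_fiber (hdet w.1 w.2) (fun _ => -1)]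
    exact Nat.card_congr (Equiv.subtypeEquivRight fun η => chEval_add_chEval_eq_zero_iff _ _ _)
  have hfinS : ∀ w : {w // w ∈ W},
      Finite {η : Fin n → ℂˣ // ∀ j, chEval η (a w.1 j) + chEval η (b w.1 j) = 0} := fun w =>
    Nat.finite_of_card_ne_zero (by rw [hcardS]; exact Int.natAbs_ne_zero.2 (hdet w.1 w.2))
  have hfinI : Finite I := inferInstance
  have hcardI : Nat.card I = ∑ w ∈ W, (edgeMatrix (a w) (b w)).det.natAbs := by
    rw [Nat.card_sigma, Finset.sum_congr rfl fun w _ => hcardS w]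
    exact Finset.sum_coe_sort W fun w => (edgeMatrix (a w) (b w)).det.natAbs
  choose r hr1 hr2 hr3 using fun i : I => exists_root_branch (hab i.1.1 i.1.2)
    (hdet i.1.1 i.1.2) i.2.2
  have hinj : ∀ᶠ τ in atTop, ∀ i i' : I, i ≠ i' → r i τ ≠ r i' τ := by
    rw [eventually_all]; intro i
    rw [eventually_all]; intro i'
    rw [eventually_imp_distrib_left]
    intro hne
    by_contra hcon
    have hfr : ∃ᶠ τ in atTop, r i τ = r i' τ := by
      simpa [Filter.Frequently] using hcon
    obtain ⟨h1, h2⟩ := eq_of_frequently_eq_of_tendsto (hr2 i) (hr2 i') hfr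
    apply hne
    obtain ⟨⟨w, hw⟩, η, hη⟩ := i
    obtain ⟨⟨w', hw'⟩, η', hη'⟩ := i'
    dsimp only at h1 h2
    subst h1 h2
    rfl
  have hmem : ∀ᶠ τ in atTop, ∀ i : I, r i τ ∈ sysRoots A (expCoeff ν τ) :=
    eventually_all.2 hr1
  have hsub : ∀ᶠ τ in atTop, sysRoots A (expCoeff ν τ) ⊆ Set.range fun i : I => r i τ := by
    by_contra hcon
    have hfr : ∃ᶠ τ in atTop, ∃ ξ ∈ sysRoots A (expCoeff ν τ), ∀ i : I, r i τ ≠ ξ := by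
      refine (not_eventually.1 hcon).mono fun τ hτ => ?_
      obtain ⟨ξ, h1, h2⟩ := Set.not_subset.1 hτ
      exact ⟨ξ, h1, fun i hi => h2 ⟨i, hi⟩⟩
    have : ((atTop : Filter ℝ) ⊓ 𝓟 {τ | ∃ ξ ∈ sysRoots A (expCoeff ν τ),
      ∀ i : I, r i τ ≠ ξ}).NeBot := frequently_iff_neBot.1 hfr
    set F := Ultrafilter.of ((atTop : Filter ℝ) ⊓ 𝓟 {τ | ∃ ξ ∈ sysRoots A (expCoeff ν τ),
      ∀ i : I, r i τ ≠ ξ}) with hFdef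
    have hF0 := Ultrafilter.of_le ((atTop : Filter ℝ) ⊓ 𝓟 {τ | ∃ ξ ∈ sysRoots A (expCoeff ν τ),
      ∀ i : I, r i τ ≠ ξ})
    have hF : (F : Filter ℝ) ≤ atTop := hF0.trans inf_le_left
    have hFe : ∀ᶠ τ in (F : Filter ℝ), ∃ ξ ∈ sysRoots A (expCoeff ν τ), ∀ i : I, r i τ ≠ ξ :=
      le_principal_iff.1 (hF0.trans inf_le_right)
    obtain ⟨ξ, hξ⟩ : ∃ ξ : ℝ → Fin n → ℂˣ, ∀ᶠ τ in (F : Filter ℝ),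
        ξ τ ∈ sysRoots A (expCoeff ν τ) ∧ ∀ i : I, r i τ ≠ ξ τ :=
      hFe.choice
    have hroot := hξ.mono fun τ h => h.1
    obtain ⟨w, hw2, hwO⟩ := exists_weight_isBigO hA hν hF hroot
    have hwW := (hW w).2 hw2
    obtain ⟨η₀, z, hz, hξz⟩ := exists_tendsto_of_isBigO hwO
    have hmemA : ∀ j, a w j ∈ A j ∧ b w j ∈ A j := fun j =>
      ⟨(mem_faceSet.1 (by rw [(hab w hwW j).2]; simp : a w j ∈ faceSet A ν w j)).1,
        (mem_faceSet.1 (by rw [(hab w hwW j).2]; simp : b w j ∈ faceSet A ν w j)).1⟩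
    have hη : ∀ j, chEval η₀ (a w j) + chEval η₀ (b w j) = 0 := by
      have hcont : Continuous (logSystem A η₀) := by
        unfold logSystem
        fun_prop
      have h1 := (hcont.tendsto (edgeIndicator A (a w) (b w), 0)).comp
        (((tendsto_rescaledCoeff fun j => (hab w hwW j).2).mono_left hF).prodMk_nhds hz)
      have h2 : logSystem A η₀ (edgeIndicator A (a w) (b w), 0) = 0 := by
        refine tendsto_nhds_unique_of_eventuallyEq h1 tendsto_const_nhds ?_
        filter_upwards [hroot] with τ hτ
        rw [hξz τ, torusCurve_mul_mem_sysRoots_iff A ν w (a w)] at hτ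
        exact hτ
      intro j
      have h3 := congrFun h2 j
      rw [logSystem_edgeIndicator (fun j => (hmemA j).1) (fun j => (hmemA j).2)
        (fun j => (hab w hwW j).1)] at h3
      simpa using h3
    have h4 := hr3 ⟨⟨w, hwW⟩, η₀, hη⟩ F ξ z hF hz hξz hroot
    obtain ⟨τ, h5, h6⟩ := (h4.and hξ).exists
    exact h6.2 _ h5.symm
  filter_upwards [hinj, hmem, hsub] with τ h1 h2 h3
  have h4 : sysRoots A (expCoeff ν τ) = Set.range fun i : I => r i τ :=
    h3.antisymm (by rintro _ ⟨i, rfl⟩; exact h2 i)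
  have h5 : Function.Injective fun i : I => r i τ := fun i i' h => by
    by_contra hne
    exact h1 i i' hne h
  rw [h4]
  refine ⟨Set.finite_range _, ?_⟩
  rw [← hcardI, ← Nat.card_coe_set_eq, Nat.card_range_of_injective h5]

/-- There are coefficients avoiding a given hypersurface for which the subsystem omitting the
`i`-th equation has exactly mixed-volume many roots. -/
theorem exists_coeff_ncard_sysRoots {A : Fin (n + 1) → Finset (Fin n → ℤ)}
    (hA : ∀ j, (A j).Nonempty) (i : Fin (n + 1)) :
    ∃ M : ℕ, (M : ℝ) = mixedVolume n (fun j : {j : Fin (n + 1) // j ≠ i} =>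
        convexHull ℝ (castR n '' ↑(A j.1))) ∧
      ∀ D : MvPolynomial (Fin (n + 1) × (Fin n → ℤ)) ℤ, D ≠ 0 →
        ∃ c : Fin (n + 1) → (Fin n → ℤ) → ℂ, evalCoeff D c ≠ 0 ∧
          (sysRoots (fun j => A (i.succAbove j)) (fun j => c (i.succAbove j))).Finite ∧
          (sysRoots (fun j => A (i.succAbove j)) (fun j => c (i.succAbove j))).ncard = M := by
  obtain ⟨ν, hν⟩ := exists_linearIndependent_rat_real (Fin (n + 1) × (Fin n → ℤ))
  have hν' : LinearIndependent ℚ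
      (fun p : Fin n × (Fin n → ℤ) => (fun j a => ν (i.succAbove j, a)) p.1 p.2) := by
    refine hν.comp (fun p : Fin n × (Fin n → ℤ) => (i.succAbove p.1, p.2)) ?_
    rintro ⟨j, a⟩ ⟨j', a'⟩ h
    simp only [Prod.mk.injEq, Fin.succAbove_right_inj] at h
    exact Prod.ext h.1 h.2
  obtain ⟨M, hM, hev⟩ := exists_eventually_ncard_sysRoots
    (A := fun j => A (i.succAbove j)) (fun j => hA (i.succAbove j))
    (ν := fun j a => ν (i.succAbove j, a)) hν'
  refine ⟨M, ?_, fun D hD => ?_⟩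
  · rw [hM, mixedVolume_subtype_ne i fun j => convexHull ℝ (castR n '' ↑(A j))]
  · obtain ⟨τ, h1, h2⟩ := (hev.and (eventually_aeval_exp_ne_zero hν hD)).exists
    exact ⟨fun j a => Complex.exp ((-τ * ν (j, a) : ℝ)), h2, h1⟩

open Polynomial in
lemma exists_away_lifts {P K : Type*} [CommRing P] [IsDomain P] [Field K] [Algebra P K]
    [IsFractionRing P K] (S : Finset K[X]) :
    ∃ G : P, G ≠ 0 ∧ ∃ ι : Localization.Away G →+* K, Function.Injective ι ∧
      ι.comp (algebraMap P _) = algebraMap P K ∧ ∀ p ∈ S, p ∈ lifts ι := by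
  classical
  obtain ⟨G, hG⟩ := IsLocalization.exist_integer_multiples_of_finset (nonZeroDivisors P)
    (S.biUnion fun p => p.coeffs)
  have hG0 : (G : P) ≠ 0 := nonZeroDivisors.coe_ne_zero G
  have hu : IsUnit (algebraMap P K G) :=
    IsUnit.mk0 _ ((map_ne_zero_iff _ (IsFractionRing.injective P K)).2 hG0)
  have hι : (IsLocalization.Away.lift (S := Localization.Away (G : P)) (G : P) hu).comp
      (algebraMap P _) = algebraMap P K := IsLocalization.Away.lift_comp _ _
  refine ⟨G, hG0, IsLocalization.Away.lift (G : P) hu, ?_, hι, fun p hp => ?_⟩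
  · refine (IsLocalization.lift_injective_iff _).2 fun x y => ?_
    rw [(IsFractionRing.injective P K).eq_iff,
      (IsLocalization.injective (Localization.Away (G : P))
        (powers_le_nonZeroDivisors_of_noZeroDivisors hG0)).eq_iff]
  · rw [lifts_iff_coeff_lifts]
    intro k
    by_cases hk : p.coeff k = 0
    · exact ⟨0, by rw [hk, map_zero]⟩
    obtain ⟨x, hx⟩ := hG _ (Finset.mem_biUnion.2 ⟨p, hp, coeff_mem_coeffs hk⟩)
    refine ⟨algebraMap P _ x * IsLocalization.Away.invSelf (G : P), ?_⟩
    have h1 : IsLocalization.Away.lift (S := Localization.Away (G : P)) (G : P) hu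
        (IsLocalization.Away.invSelf (G : P)) * algebraMap P K G = 1 := by
      rw [← RingHom.congr_fun hι G, RingHom.comp_apply, ← map_mul, mul_comm,
        IsLocalization.Away.mul_invSelf, map_one]
    rw [map_mul, ← RingHom.comp_apply, hι, hx, Algebra.smul_def]
    linear_combination p.coeff k * h1

open Polynomial IntermediateField in
lemma exists_primitive_element_algebraMap {P B K L : Type*} [CommRing P] [IsDomain P] [CommRing B]
    [IsDomain B] [Field K] [Field L] [CharZero K] [Algebra P B] [Algebra P K] [IsFractionRing P K]
    [Algebra B L] [IsFractionRing B L] [Algebra K L] [Algebra P L] [IsScalarTower P B L]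
    [IsScalarTower P K L] [FaithfulSMul P B] (S : Finset B)
    (hS : ∀ s ∈ S, IsAlgebraic P s) (hadj : Algebra.adjoin P (S : Set B) = ⊤) :
    ∃ θ : B, K⟮algebraMap B L θ⟯ = ⊤ := by
  classical
  have hPB : Algebra.IsAlgebraic P B := by
    have h := Algebra.isAlgebraic_adjoin_iff (R := P) (s := (S : Set B)) |>.2 hS
    rw [hadj] at h
    exact ⟨fun x => h x trivial⟩
  have hK : ∀ b : B, IsAlgebraic K (algebraMap B L b) := fun b =>
    (IsFractionRing.isAlgebraic_iff P K L).1 ((hPB.isAlgebraic b).algebraMap)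
  have hKL : Algebra.IsAlgebraic K L := by
    refine ⟨fun x => ?_⟩
    obtain ⟨b, c, hc, rfl⟩ := IsFractionRing.div_surjective (A := B) x
    rw [div_eq_mul_inv]
    exact (hK b).mul (hK c).inv
  have hS' : adjoin K (algebraMap B L '' (S : Set B)) = ⊤ := by
    refine top_le_iff.1 fun x _ => ?_
    have hB : ∀ b : B, algebraMap B L b ∈ adjoin K (algebraMap B L '' (S : Set B)) := by
      intro b
      have hb : b ∈ Algebra.adjoin P (S : Set B) := hadj ▸ trivial
      induction hb using Algebra.adjoin_induction with
      | mem s hs => exact subset_adjoin _ _ ⟨s, hs, rfl⟩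
      | algebraMap p =>
        rw [← IsScalarTower.algebraMap_apply, IsScalarTower.algebraMap_apply P K L]
        exact IntermediateField.algebraMap_mem _ _
      | add x y _ _ hx hy => rw [map_add]; exact add_mem hx hy
      | mul x y _ _ hx hy => rw [map_mul]; exact mul_mem hx hy
    obtain ⟨b, c, hc, rfl⟩ := IsFractionRing.div_surjective (A := B) x
    exact div_mem (hB b) (hB c)
  have : FiniteDimensional K L := by
    have := finiteDimensional_adjoin (K := K) (S := algebraMap B L '' (S : Set B))
      (fun x _ => (hKL.isAlgebraic x).isIntegral)
    rw [hS'] at this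
    exact Module.Finite.equiv (topEquiv (F := K) (E := L)).toLinearEquiv
  obtain ⟨α, hα⟩ := Field.exists_primitive_element K L
  obtain ⟨b, c, hc, rfl⟩ := IsFractionRing.div_surjective (A := B) α
  have hc0 := nonZeroDivisors.ne_zero hc
  obtain ⟨b', p, hp, h⟩ := Algebra.IsAlgebraic.exists_smul_eq_mul P b hc0
  refine ⟨b', top_le_iff.1 (hα ▸ ?_)⟩
  rw [adjoin_simple_le_iff]
  have hp' : algebraMap P L p ≠ 0 := by
    rw [IsScalarTower.algebraMap_apply P B L]
    exact (map_ne_zero_iff _ (IsFractionRing.injective B L)).2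
      ((map_ne_zero_iff _ (FaithfulSMul.algebraMap_injective P B)).2 hp)
  have hc' : algebraMap B L c ≠ 0 := (map_ne_zero_iff _ (IsFractionRing.injective B L)).2 hc0
  have h2 : algebraMap B L b / algebraMap B L c = algebraMap B L b' / algebraMap P L p := by
    rw [div_eq_div_iff hc' hp', IsScalarTower.algebraMap_apply P B L, ← map_mul, ← map_mul,
      mul_comm b, ← Algebra.smul_def, h, mul_comm]
  rw [h2, IsScalarTower.algebraMap_apply P K L]
  exact div_mem (mem_adjoin_simple_self _ _) (IntermediateField.algebraMap_mem _ _)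

lemma RingHom.exists_comp_eq_of_range_le {R B L : Type*} [CommRing R] [CommRing B] [CommRing L]
    {f : R →+* L} (hf : Function.Injective f) {k : B →+* L} (h : ∀ b, k b ∈ f.range) :
    ∃ e : B →+* R, ∀ b, f (e b) = k b := by
  choose e he using h
  refine ⟨⟨⟨⟨e, hf ?_⟩, fun x y => hf ?_⟩, hf ?_, fun x y => hf ?_⟩, he⟩ <;> simp [he]

open Polynomial IntermediateField in
theorem exists_card_fiber_eq_of_injective {P B : Type*} [CommRing P] [IsDomain P] [CommRing B]
    [IsDomain B] [CharZero B] [Algebra P B] [FaithfulSMul P B] (S : Finset B)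
    (hS : ∀ s ∈ S, IsAlgebraic P s) (hadj : Algebra.adjoin P (S : Set B) = ⊤) :
    ∃ G : P, G ≠ 0 ∧ ∃ d, 1 ≤ d ∧ ∀ g : P →+* ℂ, g G ≠ 0 →
      Nat.card {h : B →+* ℂ // h.comp (algebraMap P B) = g} = d := by
  classical
  let K := FractionRing P
  let L := FractionRing B
  let _ : Algebra K L := FractionRing.liftAlgebra P L
  have : IsScalarTower P K L := FractionRing.isScalarTower_liftAlgebra P L
  have hPB := FaithfulSMul.algebraMap_injective P B
  have hBL := IsFractionRing.injective B L
  have hPK := IsFractionRing.injective P K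
  have : CharZero P := by
    refine ⟨fun a b hab => ?_⟩
    have := congrArg (algebraMap P B) hab
    rw [map_natCast, map_natCast] at this
    exact Nat.cast_injective this
  have : CharZero K := charZero_of_injective_algebraMap hPK
  obtain ⟨θ, hθ⟩ := exists_primitive_element_algebraMap (K := K) (L := L) S hS hadj
  have hθi : IsIntegral K (algebraMap B L θ) := by
    have h := Algebra.isAlgebraic_adjoin_iff (R := P) (s := (S : Set B)) |>.2 hS
    rw [hadj] at h
    exact ((IsFractionRing.isAlgebraic_iff P K L).1 ((h θ trivial).algebraMap)).isIntegral
  set μ := minpoly K (algebraMap B L θ) with hμ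
  have hrep : ∀ x : L, ∃ q : K[X], aeval (algebraMap B L θ) q = x := by
    intro x
    have hx : x ∈ K⟮algebraMap B L θ⟯ := hθ ▸ trivial
    rw [← mem_toSubalgebra, adjoin_simple_toSubalgebra_of_isAlgebraic hθi.isAlgebraic,
      Algebra.adjoin_singleton_eq_range_aeval] at hx
    exact hx
  choose q hq using hrep
  obtain ⟨u, v, huv⟩ := (minpoly.irreducible hθi).separable
  obtain ⟨G, hG, ι, hι, hιP, hlift⟩ := exists_away_lifts (P := P) (K := K)
    (insert μ (insert u (insert v (S.image fun s => q (algebraMap B L s)))))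
  obtain ⟨m, hm, -, hmm⟩ := lifts_and_natDegree_eq_and_monic (hlift μ (by simp)) (minpoly.monic hθi)
  obtain ⟨u', hu'⟩ := (mem_lifts _).1 (hlift u (by simp))
  obtain ⟨v', hv'⟩ := (mem_lifts _).1 (hlift v (by simp))
  have hsep : m.Separable := by
    refine ⟨u', v', map_injective ι hι ?_⟩
    rw [Polynomial.map_add, Polynomial.map_mul, Polynomial.map_mul, hu', hv', hm,
      ← derivative_map, hm, Polynomial.map_one, huv]
  have hΨ0 : m.eval₂ ((algebraMap K L).comp ι) (algebraMap B L θ) = 0 := by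
    rw [← eval₂_map, hm]
    exact minpoly.aeval K (algebraMap B L θ)
  set Ψ := AdjoinRoot.lift ((algebraMap K L).comp ι) (algebraMap B L θ) hΨ0 with hΨdef
  have hιp : ∀ p, ι (algebraMap P _ p) = algebraMap P K p := RingHom.congr_fun hιP
  have hΨP : ∀ p : P, Ψ (AdjoinRoot.of m (algebraMap P _ p)) = algebraMap B L (algebraMap P B p) := by
    intro p
    rw [hΨdef, AdjoinRoot.lift_of, RingHom.comp_apply, hιp, ← IsScalarTower.algebraMap_apply,
      ← IsScalarTower.algebraMap_apply]
  have hΨ : Function.Injective Ψ := by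
    refine (injective_iff_map_eq_zero _).2 fun x => ?_
    induction x using AdjoinRoot.induction_on with
    | ih f =>
      intro h
      rw [hΨdef, AdjoinRoot.lift_mk, ← eval₂_map] at h
      rw [AdjoinRoot.mk_eq_zero, ← Polynomial.map_dvd_map ι hι hmm, hm]
      exact minpoly.dvd K _ h
  obtain ⟨e, he⟩ := RingHom.exists_comp_eq_of_range_le (k := algebraMap B L) hΨ (by
    intro b
    have hb : b ∈ Algebra.adjoin P (S : Set B) := hadj ▸ trivial
    induction hb using Algebra.adjoin_induction with
    | mem s hs =>
      obtain ⟨f, hf⟩ := (mem_lifts _).1 (hlift (q (algebraMap B L s)) (by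
        simp only [Finset.mem_insert, Finset.mem_image]
        exact .inr (.inr (.inr ⟨s, hs, rfl⟩))))
      refine ⟨AdjoinRoot.mk m f, ?_⟩
      rw [hΨdef, AdjoinRoot.lift_mk, ← eval₂_map, hf]
      exact hq _
    | algebraMap p => exact ⟨_, hΨP p⟩
    | add x y _ _ hx hy => rw [map_add]; exact add_mem hx hy
    | mul x y _ _ hx hy => rw [map_mul]; exact mul_mem hx hy)
  have heP : ∀ p : P, e (algebraMap P B p) = AdjoinRoot.of m (algebraMap P _ p) := fun p =>
    hΨ (by rw [he, hΨP])
  have heθ : e θ = AdjoinRoot.root m := hΨ (by rw [he, hΨdef, AdjoinRoot.lift_root])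
  refine ⟨G, hG, m.natDegree, ?_, fun g hg => ?_⟩
  · rw [Nat.one_le_iff_ne_zero, Ne, hmm.natDegree_eq_zero]
    rintro rfl
    exact minpoly.ne_one K _ (hm.symm.trans (Polynomial.map_one ι))
  · have hu : IsUnit (g G) := IsUnit.mk0 _ hg
    set g' : Localization.Away G →+* ℂ := IsLocalization.Away.lift G hu with hg'def
    have hg' : ∀ p, g' (algebraMap P _ p) = g p := fun p => IsLocalization.Away.lift_eq _ _ _
    have key : ∀ h : B →+* ℂ, h.comp (algebraMap P B) = g → ∃ ht : m.eval₂ g' (h θ) = 0,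
        (AdjoinRoot.lift g' (h θ) ht).comp e = h := by
      intro h hh
      set G' := algebraMap P B G
      have hG' : G' ≠ 0 := (map_ne_zero_iff _ hPB).2 hG
      have hu2 : IsUnit (h G') := by rw [← RingHom.comp_apply, hh]; exact hu
      set h' : Localization.Away G' →+* ℂ := IsLocalization.Away.lift G' hu2 with hh'def
      have hh' : ∀ b, h' (algebraMap B _ b) = h b := fun b => IsLocalization.Away.lift_eq _ _ _
      have hu3 : IsUnit (algebraMap B L G') := IsUnit.mk0 _ ((map_ne_zero_iff _ hBL).2 hG')
      set κ : Localization.Away G' →+* L := IsLocalization.Away.lift G' hu3 with hκdef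
      have hκ : ∀ b, κ (algebraMap B _ b) = algebraMap B L b :=
        fun b => IsLocalization.Away.lift_eq _ _ _
      have hκi : Function.Injective κ := by
        refine (IsLocalization.lift_injective_iff _).2 fun x y => ?_
        rw [hBL.eq_iff, (IsLocalization.injective (Localization.Away G')
          (powers_le_nonZeroDivisors_of_noZeroDivisors hG')).eq_iff]
      set j : Localization.Away G →+* Localization.Away G' :=
        IsLocalization.Away.lift G (g := (algebraMap B _).comp (algebraMap P B))
          (IsLocalization.Away.algebraMap_isUnit G') with hjdef
      have hj : ∀ p, j (algebraMap P _ p) = algebraMap B _ (algebraMap P B p) :=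
        fun p => IsLocalization.Away.lift_eq _ _ _
      have h1 : h'.comp j = g' := IsLocalization.ringHom_ext (Submonoid.powers G) (by
        ext p
        rw [RingHom.comp_apply, RingHom.comp_apply, RingHom.comp_apply, hj, hh', hg', ← hh,
          RingHom.comp_apply])
      have h2 : κ.comp j = (algebraMap K L).comp ι := IsLocalization.ringHom_ext (Submonoid.powers G)
        (by
          ext p
          rw [RingHom.comp_apply, RingHom.comp_apply, RingHom.comp_apply, RingHom.comp_apply, hj,
            hκ, hιp, ← IsScalarTower.algebraMap_apply, ← IsScalarTower.algebraMap_apply])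
      have h3 : ∀ f : (Localization.Away G)[X],
          f.eval₂ g' (h θ) = h' (f.eval₂ j (algebraMap B _ θ)) := by
        intro f
        rw [hom_eval₂, h1, hh']
      have h4 : ∀ f : (Localization.Away G)[X],
          κ (f.eval₂ j (algebraMap B _ θ)) = Ψ (AdjoinRoot.mk m f) := by
        intro f
        rw [hom_eval₂, h2, hκ, hΨdef, AdjoinRoot.lift_mk]
      have ht : m.eval₂ g' (h θ) = 0 := by
        
        have h5 : m.eval₂ j (algebraMap B _ θ) = 0 :=
          hκi (by rw [h4, AdjoinRoot.mk_self, map_zero, map_zero])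
        rw [h3, h5, map_zero]
      refine ⟨ht, RingHom.ext fun b => ?_⟩
      obtain ⟨f, hf⟩ := AdjoinRoot.mk_surjective (g := m) (e b)
      have h5 : f.eval₂ j (algebraMap B _ θ) = algebraMap B _ b := hκi (by rw [h4, hf, he, hκ])
      rw [RingHom.comp_apply, ← hf, AdjoinRoot.lift_mk, h3, h5, hh']
    let Φ : {h : B →+* ℂ // h.comp (algebraMap P B) = g} ≃ {t : ℂ // m.eval₂ g' t = 0} :=
      { toFun := fun h => ⟨h.1 θ, (key h.1 h.2).1⟩
        invFun := fun t => ⟨(AdjoinRoot.lift g' t.1 t.2).comp e, by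
          ext p
          rw [RingHom.comp_apply, RingHom.comp_apply, heP, AdjoinRoot.lift_of, hg']⟩
        left_inv := fun h => Subtype.ext (key h.1 h.2).2
        right_inv := fun t => Subtype.ext (by
          change AdjoinRoot.lift g' t.1 t.2 (e θ) = t.1
          rw [heθ, AdjoinRoot.lift_root]) }
    have hm0 : m.map g' ≠ 0 := (hmm.map g').ne_zero
    rw [Nat.card_congr Φ, ← hmm.natDegree_map g', ← IsAlgClosed.card_roots_eq_natDegree,
      ← Multiset.toFinset_card_of_nodup (nodup_roots (hsep.map (f := g'))),
      ← Fintype.card_coe, ← Nat.card_eq_fintype_card]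
    refine Nat.card_congr (Equiv.subtypeEquivRight fun t => ?_)
    rw [Multiset.mem_toFinset, mem_roots hm0, IsRoot.def, eval_map]

/-- Generic fibres of a generically finite morphism have constant cardinality. -/
theorem exists_card_fiber_eq {P B : Type*} [CommRing P] [CommRing B]
    [IsDomain B] [CharZero B] (φ : P →+* B) (S : Finset B)
    (hS : ∀ s ∈ S, IsAlgebraic φ.range s) (hadj : Algebra.adjoin φ.range (S : Set B) = ⊤) :
    ∃ G : P, φ G ≠ 0 ∧ ∃ d, 1 ≤ d ∧ ∀ g : P →+* ℂ, (∀ p, φ p = 0 → g p = 0) → g G ≠ 0 →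
      Nat.card {h : B →+* ℂ // h.comp φ = g} = d := by
  obtain ⟨⟨_, G, rfl⟩, hG0, d, hd, h⟩ := exists_card_fiber_eq_of_injective S hS hadj
  refine ⟨G, fun h => hG0 (Subtype.ext h), d, hd, fun g hg hgG => ?_⟩
  let g' : φ.range →+* ℂ := φ.rangeRestrict.liftOfSurjective φ.rangeRestrict_surjective ⟨g, by
    intro p hp
    exact hg p (congrArg Subtype.val hp)⟩
  have hg' : ∀ p, g' (φ.rangeRestrict p) = g p := fun p =>
    RingHom.liftOfRightInverse_comp_apply _ _ _ _ _
  rw [← h g' (by rw [← hg' G] at hgG; exact hgG)]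
  refine Nat.card_congr (Equiv.subtypeEquivRight fun k => ⟨fun hk => ?_, fun hk => ?_⟩)
  · ext ⟨_, p, rfl⟩
    exact (RingHom.congr_fun hk p).trans (hg' p).symm
  · ext p
    exact (RingHom.congr_fun hk (φ.rangeRestrict p)).trans (hg' p)

open MvPolynomial in
/-- The polynomial ring in the torus coordinates and the coefficients `u_{j,b}`, `b ≠ a j`. -/
abbrev IncPoly (a : Fin (n + 1) → Fin n → ℤ) : Type :=
  MvPolynomial (Fin n ⊕ {p : Fin (n + 1) × (Fin n → ℤ) // p.2 ≠ a p.1}) ℤ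

/-- The product of the torus coordinates. -/
def torusProd (a : Fin (n + 1) → Fin n → ℤ) : IncPoly a := ∏ k, MvPolynomial.X (.inl k)

/-- The coordinate ring of the incidence variety, where the coefficients `u_{j,a_j}` have been
eliminated. -/
abbrev IncRing (a : Fin (n + 1) → Fin n → ℤ) : Type := Localization.Away (torusProd a)

lemma torusProd_ne_zero (a : Fin (n + 1) → Fin n → ℤ) : torusProd a ≠ 0 :=
  Finset.prod_ne_zero_iff.2 fun _ _ => MvPolynomial.X_ne_zero _

instance (a : Fin (n + 1) → Fin n → ℤ) : IsDomain (IncRing a) :=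
  IsLocalization.isDomain_localization
    (powers_le_nonZeroDivisors_of_noZeroDivisors (torusProd_ne_zero a))

lemma algebraMap_incRing_injective (a : Fin (n + 1) → Fin n → ℤ) :
    Function.Injective (algebraMap (IncPoly a) (IncRing a)) :=
  IsLocalization.injective _ (powers_le_nonZeroDivisors_of_noZeroDivisors (torusProd_ne_zero a))

instance (a : Fin (n + 1) → Fin n → ℤ) : CharZero (IncRing a) :=
  charZero_of_injective_algebraMap (algebraMap_incRing_injective a)

lemma isUnit_algebraMap_X_inl (a : Fin (n + 1) → Fin n → ℤ) (k : Fin n) :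
    IsUnit (algebraMap (IncPoly a) (IncRing a) (MvPolynomial.X (.inl k))) := by
  refine isUnit_of_dvd_unit ?_ (IsLocalization.Away.algebraMap_isUnit (torusProd a))
  refine map_dvd (algebraMap (IncPoly a) (IncRing a)) ?_
  rw [torusProd]
  exact Finset.dvd_prod_of_mem _ (Finset.mem_univ k)

/-- The torus coordinates as units of the incidence ring. -/
def torusVar (a : Fin (n + 1) → Fin n → ℤ) (k : Fin n) : (IncRing a)ˣ :=
  (isUnit_algebraMap_X_inl a k).unit

lemma val_torusVar (a : Fin (n + 1) → Fin n → ℤ) (k : Fin n) :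
    (torusVar a k : IncRing a) = algebraMap (IncPoly a) _ (MvPolynomial.X (.inl k)) := rfl

/-- The character `χ^e` in the incidence ring. -/
def chVar (a : Fin (n + 1) → Fin n → ℤ) (e : Fin n → ℤ) : IncRing a :=
  ∏ k, ((torusVar a k ^ e k : (IncRing a)ˣ) : IncRing a)

open Classical in
/-- The free coefficients in the incidence ring. -/
def freeVar (a : Fin (n + 1) → Fin n → ℤ) (p : Fin (n + 1) × (Fin n → ℤ)) : IncRing a :=
  if h : p.2 ≠ a p.1 then algebraMap (IncPoly a) _ (MvPolynomial.X (.inr ⟨p, h⟩)) else 0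

open Classical in
/-- The coefficients in the incidence ring. -/
def incVar (A : Fin (n + 1) → Finset (Fin n → ℤ)) (a : Fin (n + 1) → Fin n → ℤ)
    (p : Fin (n + 1) × (Fin n → ℤ)) : IncRing a :=
  if p.2 ≠ a p.1 then freeVar a p
  else -∑ b ∈ (A p.1).erase (a p.1), freeVar a (p.1, b) * chVar a (b - a p.1)

/-- The map from the ring of coefficients to the incidence ring. -/
def incHom (A : Fin (n + 1) → Finset (Fin n → ℤ)) (a : Fin (n + 1) → Fin n → ℤ) :
    MvPolynomial (Fin (n + 1) × (Fin n → ℤ)) ℤ →+* IncRing a :=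
  (MvPolynomial.aeval (incVar A a)).toRingHom

lemma incHom_X (A : Fin (n + 1) → Finset (Fin n → ℤ)) (a : Fin (n + 1) → Fin n → ℤ)
    (p : Fin (n + 1) × (Fin n → ℤ)) : incHom A a (MvPolynomial.X p) = incVar A a p :=
  MvPolynomial.aeval_X _ _

/-- Evaluation at a family of coefficients, as a ring homomorphism. -/
def evalCoeffHom (c : Fin (n + 1) → (Fin n → ℤ) → ℂ) :
    MvPolynomial (Fin (n + 1) × (Fin n → ℤ)) ℤ →+* ℂ :=
  (MvPolynomial.aeval fun p => c p.1 p.2).toRingHom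

lemma evalCoeffHom_apply (c : Fin (n + 1) → (Fin n → ℤ) → ℂ)
    (D : MvPolynomial (Fin (n + 1) × (Fin n → ℤ)) ℤ) : evalCoeffHom c D = evalCoeff D c := rfl

lemma evalCoeffHom_X (c : Fin (n + 1) → (Fin n → ℤ) → ℂ) (p : Fin (n + 1) × (Fin n → ℤ)) :
    evalCoeffHom c (MvPolynomial.X p) = c p.1 p.2 := MvPolynomial.aeval_X _ _

/-- The torus point and the coefficients, as a point of affine space. -/
def incPoint (a : Fin (n + 1) → Fin n → ℤ) (ξ : Fin n → ℂˣ) (c : Fin (n + 1) → (Fin n → ℤ) → ℂ) :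
    Fin n ⊕ {p : Fin (n + 1) × (Fin n → ℤ) // p.2 ≠ a p.1} → ℂ :=
  Sum.elim (fun k => (ξ k : ℂ)) (fun p => c p.1.1 p.1.2)

/-- Evaluation of the incidence ring at a point. -/
def incEval (a : Fin (n + 1) → Fin n → ℤ) (ξ : Fin n → ℂˣ) (c : Fin (n + 1) → (Fin n → ℤ) → ℂ) :
    IncRing a →+* ℂ :=
  IsLocalization.Away.lift (g := (MvPolynomial.aeval (incPoint a ξ c)).toRingHom) (torusProd a)
    (by
      change IsUnit (MvPolynomial.aeval (incPoint a ξ c) (torusProd a))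
      rw [torusProd, map_prod]
      simp only [MvPolynomial.aeval_X, incPoint, Sum.elim_inl]
      exact IsUnit.mk0 _ (Finset.prod_ne_zero_iff.2 fun k _ => (ξ k).ne_zero))

lemma incEval_algebraMap (a : Fin (n + 1) → Fin n → ℤ) (ξ : Fin n → ℂˣ)
    (c : Fin (n + 1) → (Fin n → ℤ) → ℂ) (f : IncPoly a) :
    incEval a ξ c (algebraMap _ _ f) = MvPolynomial.aeval (incPoint a ξ c) f :=
  IsLocalization.Away.lift_eq _ _ _

lemma map_chVar {a : Fin (n + 1) → Fin n → ℤ} (h : IncRing a →+* ℂ) (e : Fin n → ℤ) :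
    h (chVar a e) = chEval (fun k => Units.map h.toMonoidHom (torusVar a k)) e := by
  rw [chVar, map_prod, chEval]
  refine Finset.prod_congr rfl fun k _ => ?_
  rw [← map_zpow]
  rfl

lemma incEval_torusVar (a : Fin (n + 1) → Fin n → ℤ) (ξ : Fin n → ℂˣ)
    (c : Fin (n + 1) → (Fin n → ℤ) → ℂ) (k : Fin n) :
    Units.map (incEval a ξ c).toMonoidHom (torusVar a k) = ξ k := by
  ext
  change incEval a ξ c (torusVar a k) = _
  rw [val_torusVar, incEval_algebraMap, MvPolynomial.aeval_X]
  rfl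

lemma incEval_freeVar {a : Fin (n + 1) → Fin n → ℤ} (ξ : Fin n → ℂˣ)
    (c : Fin (n + 1) → (Fin n → ℤ) → ℂ) {p : Fin (n + 1) × (Fin n → ℤ)} (hp : p.2 ≠ a p.1) :
    incEval a ξ c (freeVar a p) = c p.1 p.2 := by
  rw [freeVar, dif_pos hp, incEval_algebraMap, MvPolynomial.aeval_X]
  rfl

lemma chEval_sub (ξ : Fin n → ℂˣ) (e e' : Fin n → ℤ) :
    chEval ξ (e - e') = chEval ξ e / chEval ξ e' := by
  simp only [chEval, ← Finset.prod_div_distrib]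
  refine Finset.prod_congr rfl fun k _ => ?_
  rw [Pi.sub_apply, zpow_sub, ← div_eq_mul_inv, Units.val_div_eq_div_val]

lemma sum_eq_zero_iff_base {A : Finset (Fin n → ℤ)} {a : Fin n → ℤ} (ha : a ∈ A)
    (c : (Fin n → ℤ) → ℂ) (ξ : Fin n → ℂˣ) :
    ∑ b ∈ A, c b * chEval ξ b = 0 ↔ c a = -∑ b ∈ A.erase a, c b * chEval ξ (b - a) := by
  have h : ∑ b ∈ A, c b * chEval ξ b =
      chEval ξ a * (c a + ∑ b ∈ A.erase a, c b * chEval ξ (b - a)) := by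
    rw [← Finset.add_sum_erase _ _ ha, mul_add, Finset.mul_sum, mul_comm (c a)]
    congr 1
    refine Finset.sum_congr rfl fun b _ => ?_
    rw [chEval_sub]
    field_simp [chEval_ne_zero ξ a]
  rw [h, mul_eq_zero, or_iff_right (chEval_ne_zero ξ a), eq_neg_iff_add_eq_zero]

lemma map_incVar_base {A : Fin (n + 1) → Finset (Fin n → ℤ)} {a : Fin (n + 1) → Fin n → ℤ}
    (h : IncRing a →+* ℂ) (j : Fin (n + 1)) :
    h (incVar A a (j, a j)) = -∑ b ∈ (A j).erase (a j), h (freeVar a (j, b)) *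
      chEval (fun k => Units.map h.toMonoidHom (torusVar a k)) (b - a j) := by
  rw [incVar, if_neg (by simp), map_neg, map_sum]
  simp only [map_mul, map_chVar]

lemma incEval_comp_incHom {A : Fin (n + 1) → Finset (Fin n → ℤ)} {a : Fin (n + 1) → Fin n → ℤ}
    (ha : ∀ j, a j ∈ A j) {ξ : Fin n → ℂˣ} {c : Fin (n + 1) → (Fin n → ℤ) → ℂ}
    (h : IsRootOf A c ξ) : (incEval a ξ c).comp (incHom A a) = evalCoeffHom c := by
  refine MvPolynomial.ringHom_ext (fun r => by simp) fun p => ?_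
  rw [RingHom.comp_apply, incHom_X, evalCoeffHom_X]
  obtain ⟨j, e⟩ := p
  by_cases he : e = a j
  · subst he
    rw [map_incVar_base]
    simp only [incEval_torusVar]
    rw [(sum_eq_zero_iff_base (ha j) (c j) ξ).1 (h j)]
    congr 1
    refine Finset.sum_congr rfl fun b hb => ?_
    rw [incEval_freeVar _ _ (Finset.ne_of_mem_erase hb)]
  · rw [incVar, if_pos he, incEval_freeVar _ _ he]

lemma incRing_hom_ext {a : Fin (n + 1) → Fin n → ℤ} {h h' : IncRing a →+* ℂ}
    (h1 : ∀ k, h (torusVar a k) = h' (torusVar a k))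
    (h2 : ∀ p, p.2 ≠ a p.1 → h (freeVar a p) = h' (freeVar a p)) : h = h' := by
  refine IsLocalization.ringHom_ext (Submonoid.powers (torusProd a)) ?_
  refine MvPolynomial.ringHom_ext (fun r => by simp) ?_
  rintro (k | ⟨p, hp⟩)
  · exact h1 k
  · have := h2 p hp
    rwa [freeVar, dif_pos hp] at this

/-- The points of the incidence variety over `c` are the common roots. -/
def incFiberEquiv {A : Fin (n + 1) → Finset (Fin n → ℤ)} {a : Fin (n + 1) → Fin n → ℤ}
    (ha : ∀ j, a j ∈ A j) (c : Fin (n + 1) → (Fin n → ℤ) → ℂ) :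
    {h : IncRing a →+* ℂ // h.comp (incHom A a) = evalCoeffHom c} ≃ {ξ // IsRootOf A c ξ} where
  toFun h := ⟨fun k => Units.map h.1.toMonoidHom (torusVar a k), fun j => by
    have hp : ∀ p, h.1 (incVar A a p) = c p.1 p.2 := fun p => by
      rw [← incHom_X, ← RingHom.comp_apply, h.2, evalCoeffHom_X]
    rw [sum_eq_zero_iff_base (ha j), ← hp (j, a j), map_incVar_base]
    congr 1
    refine Finset.sum_congr rfl fun b hb => ?_
    rw [← hp (j, b), incVar, if_pos (Finset.ne_of_mem_erase hb)]⟩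
  invFun ξ := ⟨incEval a ξ.1 c, incEval_comp_incHom ha ξ.2⟩
  left_inv h := Subtype.ext <| incRing_hom_ext
    (fun k => congrArg Units.val (incEval_torusVar a _ c k)) fun p hp => by
      rw [incEval_freeVar _ _ hp, ← evalCoeffHom_X c p, ← RingHom.congr_fun h.2, RingHom.comp_apply,
        incHom_X, incVar,
        if_pos hp]
  right_inv ξ := Subtype.ext (funext fun k => incEval_torusVar a ξ.1 c k)

lemma map_aeval_int {σ R S : Type*} [CommRing R] [CommRing S] (h : R →+* S) (g : σ → R)
    (p : MvPolynomial σ ℤ) :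
    h (MvPolynomial.aeval g p) = MvPolynomial.aeval (fun i => h (g i)) p :=
  MvPolynomial.comp_aeval_apply g h.toIntAlgHom p

open Filter Topology Polynomial in
lemma eventually_aeval_line_ne_zero {σ : Type*} {D : MvPolynomial σ ℤ} (z₀ : σ → ℂ) {z₁ : σ → ℂ}
    (h : MvPolynomial.aeval z₁ D ≠ 0) :
    ∀ᶠ s in 𝓝[≠] (0 : ℂ), MvPolynomial.aeval (fun i => z₀ i + s * (z₁ i - z₀ i)) D ≠ 0 := by
  let p : ℂ[X] := MvPolynomial.aeval (fun i => C (z₀ i) + X * C (z₁ i - z₀ i)) D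
  have hp : ∀ s, p.eval s = MvPolynomial.aeval (fun i => z₀ i + s * (z₁ i - z₀ i)) D := by
    intro s
    have h1 := map_aeval_int (evalRingHom s) (fun i => C (z₀ i) + X * C (z₁ i - z₀ i)) D
    simp only [coe_evalRingHom, eval_add, eval_mul, eval_C, eval_X] at h1
    exact h1
  have hp0 : p ≠ 0 := by
    intro h0
    apply h
    have h1 := hp 1
    rw [h0, eval_zero] at h1
    simpa using h1.symm
  have h2 : ∀ᶠ s in 𝓝[≠] (0 : ℂ), s ∉ {s | p.IsRoot s} := by
    have hf : ({s | p.IsRoot s} \ {0}).Finite := (finite_setOfPred_isRoot hp0).subset Set.sdiff_subset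
    have h3 : ∀ᶠ s in 𝓝 (0 : ℂ), s ∉ ({s | p.IsRoot s} \ {0}) :=
      hf.isClosed.isOpen_compl.mem_nhds (by simp)
    rw [eventually_nhdsWithin_iff]
    filter_upwards [h3] with s hs hs0 hr using hs ⟨hr, hs0⟩
  filter_upwards [h2] with s hs h0
  exact hs ((hp s).trans h0)

open Classical in
/-- The coefficients at a point of the incidence variety. -/
def incCoeff (A : Fin (n + 1) → Finset (Fin n → ℤ)) (a : Fin (n + 1) → Fin n → ℤ)
    (z : Fin n ⊕ {p : Fin (n + 1) × (Fin n → ℤ) // p.2 ≠ a p.1} → ℂ) (j : Fin (n + 1))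
    (e : Fin n → ℤ) : ℂ :=
  if h : e ≠ a j then z (.inr ⟨(j, e), h⟩)
  else -∑ b ∈ (A j).erase (a j), (if h : b ≠ a j then z (.inr ⟨(j, b), h⟩) else 0) *
    ∏ k, z (.inl k) ^ ((b - a j) k)

lemma chEval_eq_prod_zpow (ξ : Fin n → ℂˣ) (e : Fin n → ℤ) :
    chEval ξ e = ∏ k, (ξ k : ℂ) ^ e k := by
  simp only [chEval, Units.val_zpow_eq_zpow_val]

lemma isRootOf_incCoeff {A : Fin (n + 1) → Finset (Fin n → ℤ)} {a : Fin (n + 1) → Fin n → ℤ}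
    (ha : ∀ j, a j ∈ A j)
    (z : Fin n ⊕ {p : Fin (n + 1) × (Fin n → ℤ) // p.2 ≠ a p.1} → ℂ) {ξ : Fin n → ℂˣ}
    (hξ : ∀ k, (ξ k : ℂ) = z (.inl k)) : IsRootOf A (incCoeff A a z) ξ := by
  intro j
  rw [sum_eq_zero_iff_base (ha j), incCoeff, dif_neg (by simp)]
  congr 1
  refine Finset.sum_congr rfl fun b hb => ?_
  rw [incCoeff, dif_pos (Finset.ne_of_mem_erase hb), dif_pos (Finset.ne_of_mem_erase hb),
    chEval_eq_prod_zpow]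
  simp only [hξ]

lemma incCoeff_incPoint {A : Fin (n + 1) → Finset (Fin n → ℤ)} {a : Fin (n + 1) → Fin n → ℤ}
    (ha : ∀ j, a j ∈ A j) {ξ : Fin n → ℂˣ} {c : Fin (n + 1) → (Fin n → ℤ) → ℂ}
    (h : IsRootOf A c ξ) : incCoeff A a (incPoint a ξ c) = c := by
  funext j e
  by_cases he : e = a j
  · subst he
    rw [(sum_eq_zero_iff_base (ha j) _ ξ).1 (h j),
      (sum_eq_zero_iff_base (ha j) _ ξ).1 (isRootOf_incCoeff ha (incPoint a ξ c) (fun _ => rfl) j)]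
    congr 1
    refine Finset.sum_congr rfl fun b hb => ?_
    rw [incCoeff, dif_pos (Finset.ne_of_mem_erase hb)]
    rfl
  · rw [incCoeff, dif_pos he]
    rfl

lemma incPoint_incCoeff {A : Fin (n + 1) → Finset (Fin n → ℤ)} {a : Fin (n + 1) → Fin n → ℤ}
    (z : Fin n ⊕ {p : Fin (n + 1) × (Fin n → ℤ) // p.2 ≠ a p.1} → ℂ) {ξ : Fin n → ℂˣ}
    (hξ : ∀ k, (ξ k : ℂ) = z (.inl k)) : incPoint a ξ (incCoeff A a z) = z := by
  funext q
  rcases q with k | ⟨p, hp⟩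
  · exact hξ k
  · change incCoeff A a z p.1 p.2 = _
    rw [incCoeff, dif_pos hp]

lemma continuousAt_incCoeff {A : Fin (n + 1) → Finset (Fin n → ℤ)} {a : Fin (n + 1) → Fin n → ℤ}
    {z : Fin n ⊕ {p : Fin (n + 1) × (Fin n → ℤ) // p.2 ≠ a p.1} → ℂ}
    (hz : ∀ k, z (.inl k) ≠ 0) : ContinuousAt (incCoeff A a) z := by
  refine continuousAt_pi.2 fun j => continuousAt_pi.2 fun e => ?_
  by_cases he : e ≠ a j
  · simp only [incCoeff, dif_pos he]
    exact (continuous_apply _).continuousAt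
  · simp only [incCoeff, dif_neg he]
    refine ContinuousAt.neg (tendsto_finsetSum _ fun b hb => ContinuousAt.mul ?_ ?_)
    · simp only [dif_pos (Finset.ne_of_mem_erase hb)]
      exact (continuous_apply _).continuousAt
    · exact tendsto_finsetProd _ fun k _ =>
        ((continuous_apply _).continuousAt).zpow₀ _ (.inl (hz k))

lemma evalCoeff_eq_zero_of_incHom {A : Fin (n + 1) → Finset (Fin n → ℤ)}
    {a : Fin (n + 1) → Fin n → ℤ} (ha : ∀ j, a j ∈ A j)
    {G : MvPolynomial (Fin (n + 1) × (Fin n → ℤ)) ℤ} (hG : incHom A a G = 0)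
    {c : Fin (n + 1) → (Fin n → ℤ) → ℂ} (hc : HasRoot A c) : evalCoeff G c = 0 := by
  obtain ⟨ξ, hξ⟩ := hc
  rw [← evalCoeffHom_apply, ← incEval_comp_incHom ha hξ, RingHom.comp_apply, hG, map_zero]

open Filter Topology in
/-- Points of the incidence variety outside a proper subvariety are dense. -/
theorem mem_closure_of_incHom_ne_zero {A : Fin (n + 1) → Finset (Fin n → ℤ)}
    {a : Fin (n + 1) → Fin n → ℤ} (ha : ∀ j, a j ∈ A j)
    {G : MvPolynomial (Fin (n + 1) × (Fin n → ℤ)) ℤ} (hG : incHom A a G ≠ 0)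
    {c : Fin (n + 1) → (Fin n → ℤ) → ℂ} (hc : HasRoot A c) :
    c ∈ closure {c | HasRoot A c ∧ evalCoeff G c ≠ 0} := by
  obtain ⟨ξ, hξ⟩ := hc
  obtain ⟨⟨f, s⟩, hf⟩ := IsLocalization.surj (Submonoid.powers (torusProd a)) (incHom A a G)
  have hs0 : algebraMap (IncPoly a) (IncRing a) s ≠ 0 := (IsLocalization.map_units _ s).ne_zero
  have hf0 : f ≠ 0 := by
    rintro rfl
    rw [map_zero] at hf
    exact (mul_ne_zero hG hs0) hf
  obtain ⟨z₁, hz₁⟩ : ∃ z₁ : _ → ℤ, MvPolynomial.eval z₁ (f * torusProd a) ≠ 0 := by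
    by_contra! h
    exact mul_ne_zero hf0 (torusProd_ne_zero a) (MvPolynomial.funext fun z => by rw [h, map_zero])
  have hz₁' : MvPolynomial.aeval (fun i => (z₁ i : ℂ)) (f * torusProd a) ≠ 0 := by
    have := MvPolynomial.aeval_algebraMap_apply ℂ z₁ (f * torusProd a)
    simp only [Function.comp_def, algebraMap_int_eq, eq_intCast] at this
    rw [this, MvPolynomial.aeval_eq_eval]
    exact_mod_cast hz₁
  have h1 := eventually_aeval_line_ne_zero (incPoint a ξ c) hz₁'
  set z : ℂ → _ → ℂ := fun s i => incPoint a ξ c i + s * (z₁ i - incPoint a ξ c i) with hz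
  have hz0 : z 0 = incPoint a ξ c := by simp [hz]
  have hcont : Tendsto (fun s => incCoeff A a (z s)) (𝓝[≠] 0) (𝓝 c) := by
    have h2 : ContinuousAt (fun s => incCoeff A a (z s)) 0 := by
      refine ContinuousAt.comp (f := z) (g := incCoeff A a) ?_ ?_
      · rw [hz0]
        exact continuousAt_incCoeff fun k => (ξ k).ne_zero
      · exact Continuous.continuousAt (by fun_prop)
    have h3 := h2.tendsto
    beta_reduce at h3
    rw [hz0, incCoeff_incPoint ha hξ] at h3
    exact h3.mono_left nhdsWithin_le_nhds
  refine mem_closure_of_tendsto hcont (h1.mono fun t ht => ?_)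
  change MvPolynomial.aeval (z t) (f * torusProd a) ≠ 0 at ht
  rw [map_mul, mul_ne_zero_iff, torusProd, map_prod, Finset.prod_ne_zero_iff] at ht
  simp only [MvPolynomial.aeval_X] at ht
  let η : Fin n → ℂˣ := fun k => Units.mk0 (z t (.inl k)) (ht.2 k (Finset.mem_univ k))
  have hη := isRootOf_incCoeff ha (z t) (ξ := η) fun k => rfl
  refine ⟨⟨η, hη⟩, fun h0 => ht.1 ?_⟩
  rw [← evalCoeffHom_apply, ← incEval_comp_incHom ha hη, RingHom.comp_apply] at h0
  have h4 := congrArg (incEval a η (incCoeff A a (z t))) hf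
  rw [map_mul, h0, zero_mul, incEval_algebraMap, incPoint_incCoeff _ fun k => rfl] at h4
  exact h4.symm

lemma hasRoot_zero (A : Fin (n + 1) → Finset (Fin n → ℤ)) : HasRoot A 0 :=
  ⟨1, fun i => by simp⟩

lemma incHom_eq_zero_iff {A : Fin (n + 1) → Finset (Fin n → ℤ)}
    {a : Fin (n + 1) → Fin n → ℤ} (ha : ∀ j, a j ∈ A j)
    {G : MvPolynomial (Fin (n + 1) × (Fin n → ℤ)) ℤ} :
    incHom A a G = 0 ↔ ∀ c, HasRoot A c → evalCoeff G c = 0 := by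
  refine ⟨fun h c hc => evalCoeff_eq_zero_of_incHom ha h hc, fun h => ?_⟩
  by_contra hG
  obtain ⟨c, hc, hc0⟩ := closure_nonempty_iff.1
    ⟨_, mem_closure_of_incHom_ne_zero ha hG (hasRoot_zero A)⟩
  exact hc0 (h c hc)

/-- An independent set covering a base up to a finite set of at most the right size is a base. -/
lemma Matroid.Indep.isBase_of_encard_diff_le {α : Type*} {M : Matroid α} {X Y : Set α}
    (hY : M.Indep Y) (hX : M.IsBase X) (hfin : (X \ Y).Finite)
    (h : (X \ Y).encard ≤ (Y \ X).encard) : M.IsBase Y := by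
  obtain ⟨Z, hZ, hYZ⟩ := hY.exists_isBase_superset
  have h1 : (Y \ X).encard ≤ (Z \ X).encard := Set.encard_le_encard (Set.sdiff_subset_sdiff_left hYZ)
  have h2 := hX.encard_sdiff_comm hZ
  have h3 : X \ Z ⊆ X \ Y := Set.sdiff_subset_sdiff_right hYZ
  have h4 : X \ Z = X \ Y := (hfin.subset h3).eq_of_subset_of_encard_le h3 (by
    rw [h2]; exact h.trans h1)
  have h5 : (Z \ X).Finite := by
    rw [← Set.encard_lt_top_iff, ← h2, h4, Set.encard_lt_top_iff]
    exact hfin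
  have h6 : Y \ X = Z \ X := (h5.subset (Set.sdiff_subset_sdiff_left hYZ)).eq_of_subset_of_encard_le
    (Set.sdiff_subset_sdiff_left hYZ) (by rw [← h2, h4]; exact h)
  have h7 : Y = Z := by
    refine hYZ.antisymm fun z hz => ?_
    by_cases hzX : z ∈ X
    · by_contra hzY
      have : z ∈ X \ Z := h4 ▸ ⟨hzX, hzY⟩
      exact this.2 hz
    · exact (h6 ▸ ⟨hz, hzX⟩ : z ∈ Y \ X).1
  exact h7 ▸ hZ

/-- The standard coordinates of the incidence ring. -/
def coordVar (a : Fin (n + 1) → Fin n → ℤ)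
    (q : Fin n ⊕ {p : Fin (n + 1) × (Fin n → ℤ) // p.2 ≠ a p.1}) : IncRing a :=
  algebraMap (IncPoly a) _ (MvPolynomial.X q)

lemma aeval_coordVar (a : Fin (n + 1) → Fin n → ℤ) (f : IncPoly a) :
    MvPolynomial.aeval (coordVar a) f = algebraMap (IncPoly a) (IncRing a) f := by
  have h : (MvPolynomial.aeval (coordVar a)).toRingHom = algebraMap (IncPoly a) (IncRing a) :=
    MvPolynomial.ringHom_ext (fun z => by simp) fun q => by simp [coordVar]
  exact RingHom.congr_fun h f

lemma algebraicIndependent_coordVar (a : Fin (n + 1) → Fin n → ℤ) :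
    AlgebraicIndependent ℤ (coordVar a) := by
  intro f g h
  exact algebraMap_incRing_injective a (by rwa [← aeval_coordVar, ← aeval_coordVar])

lemma isTranscendenceBasis_coordVar (a : Fin (n + 1) → Fin n → ℤ) :
    IsTranscendenceBasis ℤ (coordVar a) := by
  refine (algebraicIndependent_coordVar a).isTranscendenceBasis_iff_isAlgebraic.2 ⟨fun x => ?_⟩
  obtain ⟨⟨f, s⟩, hf⟩ := IsLocalization.surj (Submonoid.powers (torusProd a)) x
  have hmem : ∀ g : IncPoly a, algebraMap (IncPoly a) (IncRing a) g ∈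
      Algebra.adjoin ℤ (Set.range (coordVar a)) := by
    intro g
    rw [← aeval_coordVar, Algebra.adjoin_range_eq_range_aeval]
    exact ⟨g, rfl⟩
  refine ⟨Polynomial.C ⟨_, hmem s⟩ * Polynomial.X - Polynomial.C ⟨_, hmem f⟩, fun h0 => ?_, ?_⟩
  · have h1 := congrArg (fun p => Polynomial.coeff p 1) h0
    simp only [Polynomial.coeff_sub, Polynomial.coeff_C_mul, Polynomial.coeff_X_one, mul_one,
      Polynomial.coeff_C_succ, sub_zero, Polynomial.coeff_zero] at h1
    exact (IsLocalization.map_units (IncRing a) s).ne_zero (congrArg Subtype.val h1)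
  · rw [map_sub, map_mul, Polynomial.aeval_C, Polynomial.aeval_C, Polynomial.aeval_X, sub_eq_zero]
    exact (mul_comm _ _).trans hf

lemma freeVar_eq_coordVar {a : Fin (n + 1) → Fin n → ℤ} {p : Fin (n + 1) × (Fin n → ℤ)}
    (hp : p.2 ≠ a p.1) : freeVar a p = coordVar a (.inr ⟨p, hp⟩) := by
  rw [freeVar, dif_pos hp]; rfl

lemma incVar_eq_coordVar {A : Fin (n + 1) → Finset (Fin n → ℤ)} {a : Fin (n + 1) → Fin n → ℤ}
    {p : Fin (n + 1) × (Fin n → ℤ)}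
    (hp : p.2 ≠ a p.1) : incVar A a p = coordVar a (.inr ⟨p, hp⟩) := by
  rw [incVar, if_pos hp, freeVar_eq_coordVar hp]

lemma incVar_base_notMem_range_coordVar (A : Fin (n + 1) → Finset (Fin n → ℤ))
    (a : Fin (n + 1) → Fin n → ℤ) (j : Fin (n + 1)) :
    incVar A a (j, a j) ∉ Set.range (coordVar a) := by
  rintro ⟨q, hq⟩
  have h := congrArg (incEval a 1 1) hq
  have h1 : incEval a 1 1 (coordVar a q) = 1 := by
    rw [coordVar, incEval_algebraMap, MvPolynomial.aeval_X]
    rcases q with k | p <;> rfl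
  have h2 : ∀ e, chEval (1 : Fin n → ℂˣ) e = 1 := fun e => by simp [chEval]
  rw [h1, map_incVar_base] at h
  simp only [incEval_torusVar] at h
  have h3 : ∑ b ∈ (A j).erase (a j), incEval a 1 1 (freeVar a (j, b)) * chEval 1 (b - a j) =
      (((A j).erase (a j)).card : ℂ) := by
    rw [Finset.sum_congr rfl (g := fun _ => 1), Finset.sum_const, nsmul_one]
    intro b hb
    rw [incEval_freeVar _ _ (Finset.ne_of_mem_erase hb), h2]
    simp
  change (1 : ℂ) = -∑ b ∈ (A j).erase (a j), incEval a 1 1 (freeVar a (j, b)) *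
    chEval (fun k => (1 : Fin n → ℂˣ) k) (b - a j) at h
  have h4 : (1 : ℂ) = -(((A j).erase (a j)).card : ℂ) := h.trans (by rw [← h3])
  have h5 : ((1 + ((A j).erase (a j)).card : ℕ) : ℂ) = 0 := by push_cast; linear_combination h4
  rw [Nat.cast_eq_zero] at h5
  omega

/-- If all coefficients but one are algebraically independent on the incidence variety, then the
incidence ring is algebraic over the ring of coefficients. -/
theorem isAlgebraic_incRing_of_algebraicIndependent {A : Fin (n + 1) → Finset (Fin n → ℤ)}
    {a : Fin (n + 1) → Fin n → ℤ} {T : Fin (n + 1) × (Fin n → ℤ)}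
    (h : AlgebraicIndependent ℤ fun p : {p // p ≠ T} => incVar A a p.1) :
    Algebra.IsAlgebraic (Algebra.adjoin ℤ (Set.range fun p : {p // p ≠ T} => incVar A a p.1))
      (IncRing a) := by
  classical
  set Y := Set.range fun p : {p // p ≠ T} => incVar A a p.1 with hYdef
  set X := Set.range (coordVar a) with hXdef
  have hY : (AlgebraicIndependent.matroid ℤ (IncRing a)).Indep Y :=
    AlgebraicIndependent.matroid_indep_iff.2 h.to_subtype_range
  have hX : (AlgebraicIndependent.matroid ℤ (IncRing a)).IsBase X :=
    AlgebraicIndependent.matroid_isBase_iff.2 (isTranscendenceBasis_coordVar a).to_subtype_range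
  have hXY : X \ Y ⊆ ((Finset.univ.image fun k => coordVar a (.inl k)) ∪
      (if h : T.2 ≠ a T.1 then {coordVar a (.inr ⟨T, h⟩)} else ∅) : Finset (IncRing a)) := by
    rintro _ ⟨⟨k | ⟨p, hp⟩, rfl⟩, hq⟩
    · simp
    · have hpT : p = T := by
        by_contra hpT
        exact hq ⟨⟨p, hpT⟩, incVar_eq_coordVar hp⟩
      subst hpT
      simp [hp]
  have hYX : ((((Finset.univ : Finset (Fin (n + 1))).filter fun j => (j, a j) ≠ T).image
      fun j => incVar A a (j, a j) : Finset (IncRing a)) : Set (IncRing a)) ⊆ Y \ X := by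
    intro y hy
    simp only [Finset.coe_image, Finset.coe_filter, Finset.mem_univ, true_and, Set.mem_image] at hy
    obtain ⟨j, hj, rfl⟩ := hy
    exact ⟨⟨⟨_, hj⟩, rfl⟩, incVar_base_notMem_range_coordVar A a j⟩
  have hcard : (((Finset.univ : Finset (Fin (n + 1))).filter fun j => (j, a j) ≠ T).image
      fun j => incVar A a (j, a j)).card =
      ((Finset.univ : Finset (Fin (n + 1))).filter fun j => (j, a j) ≠ T).card := by
    refine Finset.card_image_of_injOn fun j hj j' hj' hjj => ?_
    simp only [Finset.coe_filter, Finset.mem_univ, true_and] at hj hj'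
    have := h.injective (a₁ := ⟨(j, a j), hj⟩) (a₂ := ⟨(j', a j'), hj'⟩) hjj
    exact congrArg (fun x => x.1.1) this
  have hle : ((Finset.univ.image fun k => coordVar a (.inl k)) ∪
      (if h : T.2 ≠ a T.1 then {coordVar a (.inr ⟨T, h⟩)} else ∅) : Finset (IncRing a)).card ≤
      ((Finset.univ : Finset (Fin (n + 1))).filter fun j => (j, a j) ≠ T).card := by
    have h1 : (Finset.univ.image fun k : Fin n => coordVar a (.inl k)).card ≤ n :=
      Finset.card_image_le.trans (by simp)
    refine (Finset.card_union_le _ _).trans ?_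
    by_cases hT : T.2 ≠ a T.1
    · rw [dif_pos hT, Finset.card_singleton, Finset.filter_true_of_mem, Finset.card_univ,
        Fintype.card_fin]
      · omega
      · rintro j - rfl
        exact hT rfl
    · rw [dif_neg hT, Finset.card_empty]
      push Not at hT
      have : ((Finset.univ : Finset (Fin (n + 1))).filter fun j => (j, a j) ≠ T) =
          Finset.univ.erase T.1 := by
        ext j
        simp only [Finset.mem_filter, Finset.mem_univ, true_and, Finset.mem_erase, and_true, Ne,
          Prod.ext_iff, not_and]
        exact ⟨fun hj hjT => hj hjT (by rw [hjT, hT]), fun hj hjT => absurd hjT hj⟩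
      rw [this, Finset.card_erase_of_mem (Finset.mem_univ _), Finset.card_univ, Fintype.card_fin]
      omega
  have hbase := hY.isBase_of_encard_diff_le hX ((Finset.finite_toSet _).subset hXY) (by
    refine (Set.encard_le_encard hXY).trans (le_trans ?_ (Set.encard_le_encard hYX))
    rw [Set.encard_coe_eq_coe_finsetCard, Set.encard_coe_eq_coe_finsetCard, hcard]
    exact_mod_cast hle)
  have := (AlgebraicIndependent.matroid_isBase_iff.1 hbase).isAlgebraic
  rwa [Subtype.range_coe] at this

lemma adjoin_range_incHom_torusVar (A : Fin (n + 1) → Finset (Fin n → ℤ))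
    (a : Fin (n + 1) → Fin n → ℤ) :
    Algebra.adjoin (incHom A a).range
      (Set.range (fun k => (torusVar a k : IncRing a)) ∪
        Set.range (fun k => ((torusVar a k)⁻¹ : (IncRing a)ˣ).val)) = ⊤ := by
  set C := Algebra.adjoin (incHom A a).range
      (Set.range (fun k => (torusVar a k : IncRing a)) ∪
        Set.range (fun k => ((torusVar a k)⁻¹ : (IncRing a)ˣ).val)) with hC
  have hx : ∀ k, (torusVar a k : IncRing a) ∈ C := fun k =>
    Algebra.subset_adjoin (.inl ⟨k, rfl⟩)
  have hy : ∀ k, ((torusVar a k)⁻¹ : (IncRing a)ˣ).val ∈ C := fun k =>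
    Algebra.subset_adjoin (.inr ⟨k, rfl⟩)
  have hpoly : ∀ f : IncPoly a, algebraMap (IncPoly a) (IncRing a) f ∈ C := by
    intro f
    induction f using MvPolynomial.induction_on with
    | C z => simp
    | add f g hf hg => rw [map_add]; exact add_mem hf hg
    | mul_X f q hf =>
      rw [map_mul]
      refine mul_mem hf ?_
      rcases q with k | ⟨p, hp⟩
      · exact hx k
      · have h : algebraMap (IncPoly a) (IncRing a) (MvPolynomial.X (.inr ⟨p, hp⟩)) =
            incHom A a (MvPolynomial.X p) := by
          rw [incHom_X, incVar_eq_coordVar hp]; rfl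
        rw [h]
        exact C.algebraMap_mem ⟨_, MvPolynomial.X p, rfl⟩
  refine eq_top_iff.2 fun b _ => ?_
  obtain ⟨⟨f, s⟩, hf⟩ := IsLocalization.surj (Submonoid.powers (torusProd a)) b
  obtain ⟨m, hm⟩ := s.2
  change torusProd a ^ m = s at hm
  have h1 : algebraMap (IncPoly a) (IncRing a) s *
      (∏ k, ((torusVar a k)⁻¹ : (IncRing a)ˣ).val) ^ m = 1 := by
    have h2 : algebraMap (IncPoly a) (IncRing a) (torusProd a) =
        ∏ k, (torusVar a k : IncRing a) := map_prod (algebraMap (IncPoly a) (IncRing a)) _ _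
    rw [← hm, map_pow, ← mul_pow, h2, ← Finset.prod_mul_distrib]
    simp only [Units.mul_inv, Finset.prod_const_one, one_pow]
  have h2 : b = algebraMap (IncPoly a) (IncRing a) f *
      (∏ k, ((torusVar a k)⁻¹ : (IncRing a)ˣ).val) ^ m := by
    rw [← hf, mul_assoc]
    exact (by rw [h1, mul_one])
  rw [h2]
  exact mul_mem (hpoly f) (pow_mem (prod_mem fun k _ => hy k) m)

/-- If all coefficients but one are algebraically independent on the incidence variety, then the
number of common roots is constant and positive on a dense open subset of the closure of its
image. -/
theorem exists_card_root_eq {A : Fin (n + 1) → Finset (Fin n → ℤ)}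
    {a : Fin (n + 1) → Fin n → ℤ} (ha : ∀ j, a j ∈ A j) {T : Fin (n + 1) × (Fin n → ℤ)}
    (h : AlgebraicIndependent ℤ fun p : {p // p ≠ T} => incVar A a p.1) :
    ∃ G, incHom A a G ≠ 0 ∧ ∃ d, 1 ≤ d ∧ ∀ c, (∀ D, incHom A a D = 0 → evalCoeff D c = 0) →
      evalCoeff G c ≠ 0 → Nat.card {ξ // IsRootOf A c ξ} = d := by
  classical
  have halg := isAlgebraic_incRing_of_algebraicIndependent h
  have hle : (Algebra.adjoin ℤ (Set.range fun p : {p // p ≠ T} => incVar A a p.1)).toSubring ≤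
      (incHom A a).range := by
    have : Algebra.adjoin ℤ (Set.range fun p : {p // p ≠ T} => incVar A a p.1) ≤
        (MvPolynomial.aeval (incVar A a)).range := by
      refine Algebra.adjoin_le ?_
      rintro _ ⟨p, rfl⟩
      exact ⟨MvPolynomial.X p.1, MvPolynomial.aeval_X _ _⟩
    exact fun x hx => this hx
  have hS : ∀ s : IncRing a, IsAlgebraic (incHom A a).range s := by
    intro s
    obtain ⟨p, hp0, hp⟩ := halg.isAlgebraic s
    refine ⟨p.map (Subring.inclusion hle), ?_, ?_⟩
    · exact (Polynomial.map_ne_zero_iff (Subring.inclusion_injective hle)).2 hp0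
    · rw [Polynomial.aeval_def, Polynomial.eval₂_map]
      rw [Polynomial.aeval_def] at hp
      exact hp
  obtain ⟨G, hG, d, hd, hGd⟩ := exists_card_fiber_eq (incHom A a)
    (Finset.univ.image (fun k => (torusVar a k : IncRing a)) ∪
      Finset.univ.image (fun k => ((torusVar a k)⁻¹ : (IncRing a)ˣ).val)) (fun s _ => hS s) (by
      simpa using adjoin_range_incHom_torusVar A a)
  exact ⟨G, hG, d, hd, fun c hc hGc =>
    (Nat.card_congr (incFiberEquiv ha c)).symm.trans (hGd (evalCoeffHom c) hc hGc)⟩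

/-- Coprimality with a prime polynomial over a unique factorization domain. -/
lemma Polynomial.exists_mul_add_mul_eq_C_of_prime {R : Type*} [CommRing R] [IsDomain R]
    [UniqueFactorizationMonoid R] {f g : Polynomial R} (hf : Prime f) (hdeg : f.natDegree ≠ 0)
    (hfg : ¬ f ∣ g) : ∃ p q : Polynomial R, ∃ r : R, r ≠ 0 ∧ p * f + q * g = C r := by
  classical
  let _ : NormalizationMonoid R := Classical.choice inferInstance
  let _ : NormalizedGCDMonoid R := UniqueFactorizationMonoid.toNormalizedGCDMonoid R
  let K := FractionRing R
  have hprim : f.IsPrimitive := hf.irreducible.isPrimitive hdeg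
  have hirr : Irreducible (f.map (algebraMap R K)) :=
    (hprim.irreducible_iff_irreducible_map_fraction_map (K := K)).1 hf.irreducible
  have hnd : ¬ f.map (algebraMap R K) ∣ g.map (algebraMap R K) := by
    rwa [← IsPrimitive.dvd_iff_fraction_map_dvd_fraction_map K hprim]
  obtain ⟨p, q, hpq⟩ := (hirr.coprime_iff_not_dvd).2 hnd
  obtain ⟨b, hb, hp⟩ := IsLocalization.integerNormalization_spec (nonZeroDivisors R) p
  obtain ⟨b', hb', hq⟩ := IsLocalization.integerNormalization_spec (nonZeroDivisors R) q
  refine ⟨C b' * IsLocalization.integerNormalization (nonZeroDivisors R) p,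
    C b * IsLocalization.integerNormalization (nonZeroDivisors R) q, b * b',
    mul_ne_zero (nonZeroDivisors.ne_zero hb) (nonZeroDivisors.ne_zero hb'), ?_⟩
  refine map_injective (algebraMap R K) (IsFractionRing.injective R K) ?_
  simp only [Polynomial.map_add, Polynomial.map_mul, map_C, hp, hq, map_mul,
    ← algebraMap_smul K b, ← algebraMap_smul K b', smul_eq_C_mul]
  linear_combination C (algebraMap R K b) * C (algebraMap R K b') * hpq

section Shift

variable {σ : Type*}

/-- The substitution `y ↦ y + s v`, with values in polynomials in `s`. -/
def shiftHom (v : σ → ℤ) : MvPolynomial σ ℤ →+* Polynomial (MvPolynomial σ ℤ) :=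
  (MvPolynomial.aeval fun p => Polynomial.C (MvPolynomial.X p) +
    Polynomial.C (MvPolynomial.C (v p)) * Polynomial.X).toRingHom

lemma shiftHom_X (v : σ → ℤ) (p : σ) : shiftHom v (MvPolynomial.X p) =
    Polynomial.C (MvPolynomial.X p) + Polynomial.C (MvPolynomial.C (v p)) * Polynomial.X :=
  MvPolynomial.aeval_X _ _

lemma eval_zero_shiftHom (v : σ → ℤ) (D : MvPolynomial σ ℤ) : (shiftHom v D).eval 0 = D := by
  have h : (Polynomial.evalRingHom 0).comp (shiftHom v) = RingHom.id _ :=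
    MvPolynomial.ringHom_ext (fun z => by simp) fun p => by simp [shiftHom_X]
  exact RingHom.congr_fun h D

lemma shiftHom_dvd_iff (v : σ → ℤ) {D E : MvPolynomial σ ℤ} : shiftHom v D ∣ shiftHom v E ↔ D ∣ E := by
  refine ⟨fun h => ?_, map_dvd (shiftHom v)⟩
  have := map_dvd (Polynomial.evalRingHom 0) h
  simpa [eval_zero_shiftHom] using this

lemma shiftHom_ne_zero (v : σ → ℤ) {D : MvPolynomial σ ℤ} (h : D ≠ 0) : shiftHom v D ≠ 0 := by
  intro h0
  apply h
  rw [← eval_zero_shiftHom v D, h0, Polynomial.eval_zero]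

lemma shiftAut_comp (v : σ → ℤ) (x : Polynomial (MvPolynomial σ ℤ)) :
    Polynomial.eval₂RingHom (shiftHom (-v)) Polynomial.X
      (Polynomial.eval₂RingHom (shiftHom v) Polynomial.X x) = x := by
  have h : (Polynomial.eval₂RingHom (shiftHom (-v)) Polynomial.X).comp
      (Polynomial.eval₂RingHom (shiftHom v) Polynomial.X) = RingHom.id _ := by
    refine Polynomial.ringHom_ext' (MvPolynomial.ringHom_ext (fun z => by simp) fun p => ?_) (by simp)
    have h1 : Polynomial.eval₂ (shiftHom (-v)) Polynomial.X
        ((v p : ℤ) : Polynomial (MvPolynomial σ ℤ)) = (v p : Polynomial (MvPolynomial σ ℤ)) :=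
      map_intCast (Polynomial.eval₂RingHom (shiftHom (-v)) Polynomial.X) (v p)
    simp only [RingHom.comp_apply, Polynomial.coe_eval₂RingHom, Polynomial.eval₂_C, shiftHom_X,
      Polynomial.eval₂_add, Polynomial.eval₂_mul, Polynomial.eval₂_X, eq_intCast, h1, Pi.neg_apply,
      map_intCast, map_neg, RingHom.id_apply]
    ring
  exact RingHom.congr_fun h x

lemma prime_shiftHom (v : σ → ℤ) {D : MvPolynomial σ ℤ} (h : Prime D) : Prime (shiftHom v D) := by
  let e : Polynomial (MvPolynomial σ ℤ) ≃+* Polynomial (MvPolynomial σ ℤ) :=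
    { Polynomial.eval₂RingHom (shiftHom v) Polynomial.X with
      invFun := Polynomial.eval₂RingHom (shiftHom (-v)) Polynomial.X
      left_inv := shiftAut_comp v
      right_inv := fun x => by simpa using shiftAut_comp (-v) x }
  have h1 : e (Polynomial.C D) = shiftHom v D :=
    Polynomial.eval₂_C (shiftHom v) Polynomial.X
  rw [← h1]
  exact (MulEquiv.prime_iff e.toMulEquiv).2 (Polynomial.prime_C_iff.2 h)

/-- The polynomial `s ↦ D (y + s v)`. -/
def linePoly (v : σ → ℤ) (y : σ → ℂ) (D : MvPolynomial σ ℤ) : Polynomial ℂ :=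
  (shiftHom v D).map (MvPolynomial.aeval y).toRingHom

lemma eval_linePoly (v : σ → ℤ) (y : σ → ℂ) (D : MvPolynomial σ ℤ) (s : ℂ) :
    (linePoly v y D).eval s = MvPolynomial.aeval (fun p => y p + s * v p) D := by
  have h : ((Polynomial.evalRingHom s).comp
      (Polynomial.mapRingHom (MvPolynomial.aeval y).toRingHom)).comp (shiftHom v) =
      (MvPolynomial.aeval fun p => y p + s * v p).toRingHom :=
    MvPolynomial.ringHom_ext (fun z => by simp) fun p => by simp [shiftHom_X, mul_comm]
  exact RingHom.congr_fun h D

lemma natDegree_linePoly {v : σ → ℤ} {y : σ → ℂ} {D : MvPolynomial σ ℤ}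
    (h : MvPolynomial.aeval y (shiftHom v D).leadingCoeff ≠ 0) :
    (linePoly v y D).natDegree = (shiftHom v D).natDegree :=
  Polynomial.natDegree_map_of_leadingCoeff_ne_zero _ h

lemma aeval_eq_of_natDegree_shiftHom_eq_zero {v : σ → ℤ} {D : MvPolynomial σ ℤ}
    (h : (shiftHom v D).natDegree = 0) (y : σ → ℂ) (s : ℂ) :
    MvPolynomial.aeval (fun p => y p + s * v p) D = MvPolynomial.aeval y D := by
  have h1 := Polynomial.eq_C_of_natDegree_eq_zero h
  rw [Polynomial.coeff_zero_eq_eval_zero, eval_zero_shiftHom] at h1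
  rw [← eval_linePoly, linePoly, h1, Polynomial.map_C, Polynomial.eval_C]
  rfl

/-- Outside a hypersurface of base points, a line meets the zero set of a prime polynomial and
the zero set of a polynomial that is not a multiple in disjoint sets. -/
theorem exists_ne_zero_of_not_dvd {E D : MvPolynomial σ ℤ} (hE : Prime E) (hD : ¬ E ∣ D)
    (v : σ → ℤ) : ∃ r : MvPolynomial σ ℤ, r ≠ 0 ∧ ∀ (y : σ → ℂ) (s : ℂ),
      MvPolynomial.aeval (fun p => y p + s * v p) E = 0 →
      MvPolynomial.aeval (fun p => y p + s * v p) D = 0 → MvPolynomial.aeval y r = 0 := by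
  by_cases hdeg : (shiftHom v E).natDegree = 0
  · exact ⟨E, hE.ne_zero, fun y s h _ => (aeval_eq_of_natDegree_shiftHom_eq_zero hdeg y s) ▸ h⟩
  · obtain ⟨p, q, r, hr, h⟩ := Polynomial.exists_mul_add_mul_eq_C_of_prime (prime_shiftHom v hE) hdeg
      (mt (shiftHom_dvd_iff v).1 hD)
    refine ⟨r, hr, fun y s h1 h2 => ?_⟩
    have h3 := congrArg (fun x => (x.map (MvPolynomial.aeval y).toRingHom).eval s) h
    rw [← eval_linePoly, linePoly] at h1 h2
    simp only [Polynomial.map_add, Polynomial.map_mul, Polynomial.eval_add, Polynomial.eval_mul,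
      h1, h2, mul_zero, add_zero, Polynomial.map_C, Polynomial.eval_C] at h3
    exact h3.symm

/-- For a generic base point, the line in a fixed direction meets the zero set of a prime
polynomial in as many points as the degree. -/
theorem exists_ne_zero_card_line {E : MvPolynomial σ ℤ} (hE : Prime E) (v : σ → ℤ) :
    ∃ r : MvPolynomial σ ℤ, r ≠ 0 ∧ ∀ y : σ → ℂ, MvPolynomial.aeval y r ≠ 0 →
      ∃ S : Finset ℂ, S.card = (shiftHom v E).natDegree ∧
        ∀ s, s ∈ S ↔ MvPolynomial.aeval (fun p => y p + s * v p) E = 0 := by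
  classical
  by_cases hdeg : (shiftHom v E).natDegree = 0
  · refine ⟨E, hE.ne_zero, fun y hy => ⟨∅, by simp [hdeg], fun s => ?_⟩⟩
    rw [aeval_eq_of_natDegree_shiftHom_eq_zero hdeg]
    simpa using hy
  · have hnd : ¬ shiftHom v E ∣ (shiftHom v E).derivative := by
      intro h
      have h0 : (shiftHom v E).derivative ≠ 0 := fun h0 =>
        hdeg (Polynomial.derivative_eq_zero.1 h0)
      exact absurd (Polynomial.natDegree_le_of_dvd h h0)
        (not_le.2 (Polynomial.natDegree_derivative_lt hdeg))
    obtain ⟨p, q, r, hr, h⟩ := Polynomial.exists_mul_add_mul_eq_C_of_prime (prime_shiftHom v hE) hdeg hnd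
    refine ⟨r * (shiftHom v E).leadingCoeff, mul_ne_zero hr
      (Polynomial.leadingCoeff_ne_zero.2 (shiftHom_ne_zero v hE.ne_zero)), fun y hy => ?_⟩
    rw [map_mul, mul_ne_zero_iff] at hy
    have hlp0 : linePoly v y E ≠ 0 := by
      intro h0
      have := natDegree_linePoly hy.2
      rw [h0, Polynomial.natDegree_zero] at this
      exact hdeg this.symm
    have hsep : (linePoly v y E).Separable := by
      refine ⟨Polynomial.C (MvPolynomial.aeval y r)⁻¹ * p.map (MvPolynomial.aeval y).toRingHom,
        Polynomial.C (MvPolynomial.aeval y r)⁻¹ * q.map (MvPolynomial.aeval y).toRingHom, ?_⟩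
      have h3 := congrArg (fun x => x.map (MvPolynomial.aeval y).toRingHom) h
      simp only [Polynomial.map_add, Polynomial.map_mul, Polynomial.map_C] at h3
      rw [linePoly, Polynomial.derivative_map, mul_assoc, mul_assoc, ← mul_add, h3,
        ← Polynomial.C_mul]
      exact (congrArg Polynomial.C (inv_mul_cancel₀ hy.1)).trans Polynomial.C_1
    refine ⟨(linePoly v y E).roots.toFinset, ?_, fun s => ?_⟩
    · rw [Multiset.toFinset_card_of_nodup (Polynomial.nodup_roots hsep),
        (IsAlgClosed.splits _).natDegree_eq_card_roots.symm, natDegree_linePoly hy.2]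
    · rw [Multiset.mem_toFinset, Polynomial.mem_roots hlp0, Polynomial.IsRoot.def, eval_linePoly]

end Shift

lemma Polynomial.natDegree_prod_le_and_coeff {R ι : Type*} [CommRing R] (s : Finset ι)
    (f : ι → Polynomial R) (d : ι → ℕ) (h : ∀ i ∈ s, (f i).natDegree ≤ d i) :
    (∏ i ∈ s, f i).natDegree ≤ ∑ i ∈ s, d i ∧
      (∏ i ∈ s, f i).coeff (∑ i ∈ s, d i) = ∏ i ∈ s, (f i).coeff (d i) := by
  classical
  induction s using Finset.induction_on with
  | empty => simp
  | insert j s hj ih =>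
    obtain ⟨ih1, ih2⟩ := ih fun i hi => h i (Finset.mem_insert_of_mem hi)
    have hj' := h j (Finset.mem_insert_self j s)
    rw [Finset.prod_insert hj, Finset.sum_insert hj, Finset.prod_insert hj, ← ih2]
    exact ⟨natDegree_mul_le_of_le hj' ih1, coeff_mul_add_eq_of_natDegree_le hj' ih1⟩

section PartDeg

variable {σ : Type*} (q : σ → Prop) [DecidablePred q]

/-- The partial degree of a polynomial in a group of variables. -/
def partDeg (D : MvPolynomial σ ℤ) : ℕ :=
  D.support.sup fun m => ∑ p ∈ m.support.filter q, m p

/-- The part of a polynomial of maximal degree in a group of variables. -/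
def topPart (D : MvPolynomial σ ℤ) : MvPolynomial σ ℤ :=
  ∑ m ∈ D.support.filter (fun m => ∑ p ∈ m.support.filter q, m p = partDeg q D),
    MvPolynomial.monomial m (D.coeff m)

lemma topPart_ne_zero {D : MvPolynomial σ ℤ} (hD : D ≠ 0) : topPart q D ≠ 0 := by
  classical
  obtain ⟨m, hm, hm'⟩ := Finset.exists_mem_eq_sup D.support (MvPolynomial.support_nonempty.2 hD)
    fun m => ∑ p ∈ m.support.filter q, m p
  intro h
  have h1 := congrArg (MvPolynomial.coeff m) h
  simp only [topPart, MvPolynomial.coeff_sum, MvPolynomial.coeff_monomial, Finset.sum_ite_eq',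
    MvPolynomial.coeff_zero] at h1
  rw [if_pos (Finset.mem_filter.2 ⟨hm, hm'.symm⟩)] at h1
  exact MvPolynomial.mem_support_iff.1 hm h1

/-- Substitution of integers for a group of variables. -/
def substHom (v : σ → ℤ) : MvPolynomial σ ℤ →+* MvPolynomial σ ℤ :=
  (MvPolynomial.aeval fun p => if q p then MvPolynomial.C (v p) else MvPolynomial.X p).toRingHom

variable {q}

lemma natDegree_shiftHom_monomial {v : σ → ℤ} (hv : ∀ p, ¬ q p → v p = 0) (m : σ →₀ ℕ) (c : ℤ) :
    (shiftHom v (MvPolynomial.monomial m c)).natDegree ≤ ∑ p ∈ m.support.filter q, m p ∧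
    (shiftHom v (MvPolynomial.monomial m c)).coeff (∑ p ∈ m.support.filter q, m p) =
      substHom q v (MvPolynomial.monomial m c) := by
  have h1 : shiftHom v (MvPolynomial.monomial m c) = Polynomial.C (MvPolynomial.C c) *
      ∏ p ∈ m.support, (Polynomial.C (MvPolynomial.X p) +
        Polynomial.C (MvPolynomial.C (v p)) * Polynomial.X) ^ m p := by
    refine (MvPolynomial.aeval_monomial _ m c).trans ?_
    congr 1
  have h2 : substHom q v (MvPolynomial.monomial m c) = MvPolynomial.C c *
      ∏ p ∈ m.support, (if q p then MvPolynomial.C (v p) else MvPolynomial.X p) ^ m p := by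
    refine (MvPolynomial.aeval_monomial _ m c).trans ?_
    rfl
  have h3 : ∑ p ∈ m.support.filter q, m p = ∑ p ∈ m.support, if q p then m p else 0 := by
    rw [Finset.sum_filter]
  obtain ⟨h4, h5⟩ := Polynomial.natDegree_prod_le_and_coeff m.support
    (fun p => (Polynomial.C (MvPolynomial.X p : MvPolynomial σ ℤ) +
        Polynomial.C (MvPolynomial.C (v p)) * Polynomial.X) ^ m p)
    (fun p => if q p then m p else 0) (by
      intro p _
      split_ifs with hp
      · refine Polynomial.natDegree_pow_le_of_le (m := 1) (m p) ?_ |>.trans (by simp)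
        compute_degree
      · simp [hv p hp])
  rw [h1, h2, h3]
  refine ⟨(Polynomial.natDegree_C_mul_le _ _).trans h4, ?_⟩
  rw [Polynomial.coeff_C_mul, h5]
  congr 1
  refine Finset.prod_congr rfl fun p _ => ?_
  split_ifs with hp
  · have h6 := Polynomial.coeff_pow_of_natDegree_le (m := m p) (n := 1)
      (p := Polynomial.C (MvPolynomial.X p : MvPolynomial σ ℤ) +
        Polynomial.C (MvPolynomial.C (v p)) * Polynomial.X) (by compute_degree)
    rw [mul_one] at h6
    rw [h6]
    simp
  · simp [hv p hp, Polynomial.coeff_zero_eq_eval_zero]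

/-- The top coefficient of a polynomial along a line in a group of variables. -/
lemma natDegree_shiftHom_le {v : σ → ℤ} (hv : ∀ p, ¬ q p → v p = 0) (D : MvPolynomial σ ℤ) :
    (shiftHom v D).natDegree ≤ partDeg q D ∧
    (shiftHom v D).coeff (partDeg q D) = substHom q v (topPart q D) := by
  have h1 : shiftHom v D = ∑ m ∈ D.support, shiftHom v (MvPolynomial.monomial m (D.coeff m)) := by
    rw [← map_sum, MvPolynomial.support_sum_monomial_coeff]
  have h2 : ∀ m ∈ D.support, ∑ p ∈ m.support.filter q, m p ≤ partDeg q D := fun m hm =>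
    Finset.le_sup (f := fun m => ∑ p ∈ m.support.filter q, m p) hm
  constructor
  · rw [h1]
    exact Polynomial.natDegree_sum_le_of_forall_le _ _ fun m hm =>
      (natDegree_shiftHom_monomial hv m _).1.trans (h2 m hm)
  · rw [h1, Polynomial.finsetSum_coeff, topPart, map_sum, Finset.sum_filter]
    refine Finset.sum_congr rfl fun m hm => ?_
    split_ifs with hd
    · rw [← hd]
      exact (natDegree_shiftHom_monomial hv m _).2
    · exact Polynomial.coeff_eq_zero_of_natDegree_lt
        ((natDegree_shiftHom_monomial hv m _).1.trans_lt (lt_of_le_of_ne (h2 m hm) hd))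

lemma aeval_substHom (v : σ → ℤ) (y : σ → ℂ) (D : MvPolynomial σ ℤ) :
    MvPolynomial.aeval y (substHom q v D) =
      MvPolynomial.aeval (fun p => if q p then (v p : ℂ) else y p) D := by
  have h : (MvPolynomial.aeval y).toRingHom.comp (substHom q v) =
      (MvPolynomial.aeval fun p => if q p then (v p : ℂ) else y p).toRingHom := by
    refine MvPolynomial.ringHom_ext (fun z => by simp) fun p => ?_
    simp only [substHom, AlgHom.toRingHom_eq_coe, RingHom.coe_comp, RingHom.coe_coe,
      Function.comp_apply, MvPolynomial.aeval_X]
    split_ifs <;> simp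
  exact RingHom.congr_fun h D

lemma exists_int_aeval_ne_zero {D : MvPolynomial σ ℤ} (hD : D ≠ 0) :
    ∃ z : σ → ℤ, MvPolynomial.aeval (fun i => (z i : ℂ)) D ≠ 0 := by
  obtain ⟨z, hz⟩ : ∃ z : σ → ℤ, MvPolynomial.eval z D ≠ 0 := by
    by_contra! h
    exact hD (MvPolynomial.funext fun z => by rw [h, map_zero])
  refine ⟨z, ?_⟩
  have := MvPolynomial.aeval_algebraMap_apply ℂ z D
  simp only [Function.comp_def, algebraMap_int_eq, eq_intCast] at this
  rw [this, MvPolynomial.aeval_eq_eval]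
  exact_mod_cast hz

lemma substHom_ne_zero {z : σ → ℤ} {D : MvPolynomial σ ℤ}
    (h : MvPolynomial.aeval (fun i => (z i : ℂ)) D ≠ 0) :
    substHom q (fun p => if q p then z p else 0) D ≠ 0 := by
  intro h0
  have h1 := aeval_substHom (q := q) (fun p => if q p then z p else 0) (fun i => (z i : ℂ)) D
  rw [h0, map_zero] at h1
  refine h (Eq.trans ?_ h1.symm)
  congr 2
  funext p
  split_ifs <;> rfl

/-- For a generic direction in a group of variables, the degree along the line is the partial
degree. -/
lemma natDegree_shiftHom_eq {z : σ → ℤ} {D : MvPolynomial σ ℤ}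
    (h : MvPolynomial.aeval (fun i => (z i : ℂ)) (topPart q D) ≠ 0) :
    (shiftHom (fun p => if q p then z p else 0) D).natDegree = partDeg q D ∧
    (shiftHom (fun p => if q p then z p else 0) D).leadingCoeff =
      substHom q (fun p => if q p then z p else 0) (topPart q D) := by
  obtain ⟨h1, h2⟩ := natDegree_shiftHom_le (q := q) (v := fun p => if q p then z p else 0)
    (fun p hp => if_neg hp) D
  have h3 := h1.antisymm (Polynomial.le_natDegree_of_ne_zero (h2 ▸ substHom_ne_zero h))
  exact ⟨h3, by rw [Polynomial.leadingCoeff, h3, h2]⟩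

lemma partDeg_pow_or_neg {D R : MvPolynomial σ ℤ} {d : ℕ} (hD : D ≠ 0) (hR : R = D ^ d ∨ R = -D ^ d) :
    partDeg q R = d * partDeg q D := by
  have hR0 : R ≠ 0 := by
    rcases hR with rfl | rfl
    · exact pow_ne_zero _ hD
    · exact neg_ne_zero.2 (pow_ne_zero _ hD)
  obtain ⟨z, hz⟩ := exists_int_aeval_ne_zero
    (mul_ne_zero (topPart_ne_zero q hD) (topPart_ne_zero q hR0))
  rw [map_mul, mul_ne_zero_iff] at hz
  rw [← (natDegree_shiftHom_eq hz.1).1, ← (natDegree_shiftHom_eq hz.2).1]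
  rcases hR with rfl | rfl
  · rw [map_pow, Polynomial.natDegree_pow]
  · rw [map_neg, map_pow, Polynomial.natDegree_neg, Polynomial.natDegree_pow]

/-- A nonconstant polynomial depends on some variable. -/
lemma exists_natDegree_shiftHom_single_ne_zero [DecidableEq σ] {E : MvPolynomial σ ℤ} (hE : E ≠ 0)
    (h0 : MvPolynomial.aeval (0 : σ → ℂ) E = 0) :
    ∃ T, (shiftHom (Pi.single T 1) E).natDegree ≠ 0 := by
  by_contra! h
  obtain ⟨y, hy⟩ := exists_int_aeval_ne_zero hE
  have h1 : ∀ s : Finset σ, MvPolynomial.aeval (fun p => if p ∈ s then (0 : ℂ) else y p) E =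
      MvPolynomial.aeval (fun i => (y i : ℂ)) E := by
    intro s
    induction s using Finset.induction_on with
    | empty => simp
    | insert T s hT ih =>
      rw [← ih, ← aeval_eq_of_natDegree_shiftHom_eq_zero (h T) _ (y T : ℂ)]
      congr 2
      funext p
      by_cases hp : p = T
      · subst hp; simp [hT]
      · simp [hp]
  refine hy ((h1 E.vars).symm.trans (Eq.trans ?_ h0))
  exact MvPolynomial.eval₂Hom_congr' rfl (fun p hp _ => by simp [hp]) rfl

end PartDeg

lemma groupDeg_eq_partDeg (i : Fin (n + 1)) (R : MvPolynomial (Fin (n + 1) × (Fin n → ℤ)) ℤ) :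
    groupDeg i R = partDeg (fun p => p.1 = i) R := rfl

lemma evalCoeff_eq_zero_of_mem_closure {A : Fin (n + 1) → Finset (Fin n → ℤ)}
    {D : MvPolynomial (Fin (n + 1) × (Fin n → ℤ)) ℤ} (hD : ∀ c, HasRoot A c → evalCoeff D c = 0)
    {c : Fin (n + 1) → (Fin n → ℤ) → ℂ} (hc : c ∈ closure {c | HasRoot A c}) :
    evalCoeff D c = 0 := by
  have hcont : Continuous fun c : Fin (n + 1) → (Fin n → ℤ) → ℂ => evalCoeff D c := by
    simp only [evalCoeff, MvPolynomial.aeval_def, MvPolynomial.eval₂_eq]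
    fun_prop
  have hcl : IsClosed {c | evalCoeff D c = 0} := isClosed_eq hcont continuous_const
  exact closure_minimal (fun c hc => hD c hc) hcl hc

/-- The coefficients along a line. -/
def lineCoeff (v : Fin (n + 1) × (Fin n → ℤ) → ℤ) (c : Fin (n + 1) → (Fin n → ℤ) → ℂ) (s : ℂ)
    (j : Fin (n + 1)) (e : Fin n → ℤ) : ℂ := c j e + s * v (j, e)

lemma evalCoeff_lineCoeff (v : Fin (n + 1) × (Fin n → ℤ) → ℤ)
    (c : Fin (n + 1) → (Fin n → ℤ) → ℂ) (s : ℂ) (D : MvPolynomial (Fin (n + 1) × (Fin n → ℤ)) ℤ) :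
    evalCoeff D (lineCoeff v c s) =
      MvPolynomial.aeval (fun p : Fin (n + 1) × (Fin n → ℤ) => c p.1 p.2 + s * v p) D := rfl

lemma isRootOf_lineCoeff_iff {A : Fin (n + 1) → Finset (Fin n → ℤ)} {i : Fin (n + 1)}
    {v : Fin (n + 1) × (Fin n → ℤ) → ℤ} (hv : ∀ p, p.1 ≠ i → v p = 0)
    {c : Fin (n + 1) → (Fin n → ℤ) → ℂ} {s : ℂ} {ξ : Fin n → ℂˣ} :
    IsRootOf A (lineCoeff v c s) ξ ↔
      ξ ∈ sysRoots (fun j => A (i.succAbove j)) (fun j => c (i.succAbove j)) ∧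
      ∑ b ∈ A i, c i b * chEval ξ b + s * ∑ b ∈ A i, v (i, b) * chEval ξ b = 0 := by
  have h1 : ∀ j, j ≠ i → ∑ b ∈ A j, lineCoeff v c s j b * chEval ξ b =
      ∑ b ∈ A j, c j b * chEval ξ b := by
    intro j hj
    refine Finset.sum_congr rfl fun b _ => ?_
    rw [lineCoeff, hv (j, b) hj]
    simp
  have h2 : ∑ b ∈ A i, lineCoeff v c s i b * chEval ξ b =
      ∑ b ∈ A i, c i b * chEval ξ b + s * ∑ b ∈ A i, v (i, b) * chEval ξ b := by
    rw [Finset.mul_sum, ← Finset.sum_add_distrib]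
    refine Finset.sum_congr rfl fun b _ => ?_
    rw [lineCoeff]
    ring
  rw [← h2]
  constructor
  · exact fun h => ⟨fun j => (h1 _ (Fin.succAbove_ne i j)).symm.trans (h _), h i⟩
  · rintro ⟨h, hi⟩ j
    rcases eq_or_ne j i with rfl | hj
    · exact hi
    · obtain ⟨k, rfl⟩ := Fin.exists_succAbove_eq hj
      exact (h1 _ hj).trans (h k)

/-- If a prime polynomial depends on a variable, and every polynomial vanishing on the resultant
variety is a multiple of it, then the other coefficients are algebraically independent. -/
lemma algebraicIndependent_incVar_of_dvd {A : Fin (n + 1) → Finset (Fin n → ℤ)}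
    {a : Fin (n + 1) → Fin n → ℤ} {T : Fin (n + 1) × (Fin n → ℤ)}
    (h : ∀ D : MvPolynomial (Fin (n + 1) × (Fin n → ℤ)) ℤ, D ≠ 0 →
      (shiftHom (Pi.single T 1) D).natDegree = 0 → incHom A a D ≠ 0) :
    AlgebraicIndependent ℤ fun p : {p // p ≠ T} => incVar A a p.1 := by
  refine algebraicIndependent_iff.2 fun D hD => ?_
  by_contra hD0
  refine h (MvPolynomial.rename Subtype.val D) ?_ ?_ ?_
  · exact fun h0 => hD0 (MvPolynomial.rename_injective _ Subtype.val_injective (by rw [h0, map_zero]))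
  · have h1 : (shiftHom (Pi.single T 1)).comp
        (MvPolynomial.rename (Subtype.val : {p // p ≠ T} → _)).toRingHom =
        Polynomial.C.comp (MvPolynomial.rename (Subtype.val : {p // p ≠ T} → _)).toRingHom := by
      refine MvPolynomial.ringHom_ext (fun z => by simp) fun p => ?_
      simp [shiftHom_X, Pi.single_eq_of_ne p.2]
    have h2 := RingHom.congr_fun h1 D
    change shiftHom (Pi.single T 1) (MvPolynomial.rename Subtype.val D) = _ at h2
    rw [h2]
    exact Polynomial.natDegree_C _
  · exact (MvPolynomial.aeval_rename _ _ _).trans hD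

/-- Counting the roots of a square system by the intersection of the resultant variety with a line
in the space of coefficients of the remaining polynomial. -/
theorem mul_eq_of_card_root_eq {A : Fin (n + 1) → Finset (Fin n → ℤ)} {i : Fin (n + 1)} {M : ℕ}
    (hM : ∀ D : MvPolynomial (Fin (n + 1) × (Fin n → ℤ)) ℤ, D ≠ 0 →
        ∃ c : Fin (n + 1) → (Fin n → ℤ) → ℂ, evalCoeff D c ≠ 0 ∧
          (sysRoots (fun j => A (i.succAbove j)) (fun j => c (i.succAbove j))).Finite ∧
          (sysRoots (fun j => A (i.succAbove j)) (fun j => c (i.succAbove j))).ncard = M)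
    {E : MvPolynomial (Fin (n + 1) × (Fin n → ℤ)) ℤ} (hE : Prime E)
    (hEH : ∀ c, HasRoot A c → evalCoeff E c = 0)
    {G : MvPolynomial (Fin (n + 1) × (Fin n → ℤ)) ℤ} (hG : ¬ E ∣ G) {d : ℕ}
    (hd : ∀ c, evalCoeff E c = 0 → evalCoeff G c ≠ 0 → Nat.card {ξ // IsRootOf A c ξ} = d) :
    groupDeg i E * d = M := by
  classical
  obtain ⟨z, hz⟩ := exists_int_aeval_ne_zero
    (mul_ne_zero (topPart_ne_zero (fun p : Fin (n + 1) × (Fin n → ℤ) => p.1 = i) hE.ne_zero)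
      hE.ne_zero)
  rw [map_mul, mul_ne_zero_iff] at hz
  set v : Fin (n + 1) × (Fin n → ℤ) → ℤ := fun p => if p.1 = i then z p else 0 with hvdef
  have hv : ∀ p, p.1 ≠ i → v p = 0 := fun p hp => if_neg hp
  have hdeg : (shiftHom v E).natDegree = groupDeg i E := (natDegree_shiftHom_eq hz.1).1
  have hEv : substHom (fun p : Fin (n + 1) × (Fin n → ℤ) => p.1 = i) v E ≠ 0 :=
    substHom_ne_zero hz.2
  obtain ⟨r₁, hr₁, hr₁'⟩ := exists_ne_zero_of_not_dvd hE hG v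
  obtain ⟨r₂, hr₂, hr₂'⟩ := exists_ne_zero_card_line hE v
  obtain ⟨c, hc, hfin, hcard⟩ := hM (_ * r₁ * r₂) (mul_ne_zero (mul_ne_zero hEv hr₁) hr₂)
  have hc' := hc
  rw [evalCoeff, map_mul, map_mul, mul_ne_zero_iff, mul_ne_zero_iff, aeval_substHom] at hc'
  obtain ⟨⟨hc0, hc1⟩, hc2⟩ := hc'
  obtain ⟨S, hS, hS'⟩ := hr₂' _ hc2
  set X := sysRoots (fun j => A (i.succAbove j)) (fun j => c (i.succAbove j)) with hX
  set F : (Fin n → ℂˣ) → ℂ := fun ξ => ∑ b ∈ A i, v (i, b) * chEval ξ b with hF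
  have hF0 : ∀ ξ ∈ X, F ξ ≠ 0 := by
    intro ξ hξ h0
    refine hc0 (hEH (fun j e => if j = i then (v (j, e) : ℂ) else c j e) ⟨ξ, fun j => ?_⟩)
    rcases eq_or_ne j i with rfl | hj
    · simpa using h0
    · obtain ⟨k, rfl⟩ := Fin.exists_succAbove_eq hj
      simpa using hξ k
  have hroot : ∀ s ξ, IsRootOf A (lineCoeff v c s) ξ ↔
      ξ ∈ X ∧ -(∑ b ∈ A i, c i b * chEval ξ b) / F ξ = s := by
    intro s ξ
    rw [isRootOf_lineCoeff_iff hv]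
    refine and_congr_right fun hξ => ?_
    rw [div_eq_iff (hF0 ξ hξ), neg_eq_iff_add_eq_zero]
  have hmaps : ∀ ξ ∈ hfin.toFinset, -(∑ b ∈ A i, c i b * chEval ξ b) / F ξ ∈ S := by
    intro ξ hξ
    rw [hS', ← evalCoeff_lineCoeff]
    exact hEH _ ⟨ξ, (hroot _ ξ).2 ⟨hfin.mem_toFinset.1 hξ, rfl⟩⟩
  have hsum := Finset.card_eq_sum_card_fiberwise (s := hfin.toFinset) (t := S)
    (f := fun ξ => -(∑ b ∈ A i, c i b * chEval ξ b) / F ξ) (fun ξ hξ => hmaps ξ hξ)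
  rw [← Set.ncard_eq_toFinset_card X hfin, hcard] at hsum
  rw [hsum, ← hdeg, ← hS, Finset.sum_const_nat]
  intro s hs
  have hs0 := (hS' s).1 hs
  rw [← hd (lineCoeff v c s) hs0 fun h0 => hc1 (hr₁' _ s hs0 h0), ← Nat.card_eq_finsetCard]
  exact Nat.card_congr (Equiv.subtypeEquivRight fun ξ => by
    rw [hroot, Finset.mem_filter, hfin.mem_toFinset])

/-- Every polynomial vanishing on the resultant variety is a multiple of the eliminant. -/
lemma eliminant_dvd {A : Fin (n + 1) → Finset (Fin n → ℤ)}
    {E : MvPolynomial (Fin (n + 1) × (Fin n → ℤ)) ℤ} (hE : Prime E)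
    (hV : {c | evalCoeff E c = 0} = closure {c | HasRoot A c})
    {v : Fin (n + 1) × (Fin n → ℤ) → ℤ} (hT : (shiftHom v E).natDegree ≠ 0)
    {D : MvPolynomial (Fin (n + 1) × (Fin n → ℤ)) ℤ} (hD : ∀ c, HasRoot A c → evalCoeff D c = 0) :
    E ∣ D := by
  by_contra hED
  obtain ⟨r, hr, hr'⟩ := exists_ne_zero_of_not_dvd hE hED v
  obtain ⟨y, hy⟩ := exists_int_aeval_ne_zero (mul_ne_zero hr
    (Polynomial.leadingCoeff_ne_zero.2 (shiftHom_ne_zero v hE.ne_zero)))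
  rw [map_mul, mul_ne_zero_iff] at hy
  obtain ⟨s, hs⟩ := IsAlgClosed.exists_root (linePoly v (fun p => (y p : ℂ)) E) (by
    intro h
    exact hT ((natDegree_linePoly hy.2).symm.trans (Polynomial.natDegree_eq_of_degree_eq_some h)))
  rw [Polynomial.IsRoot.def, eval_linePoly] at hs
  have hmem : lineCoeff v (fun j e => (y (j, e) : ℂ)) s ∈
      closure {c | HasRoot A c} := by
    rw [← hV]
    exact (evalCoeff_lineCoeff _ _ _ _).trans hs
  have h0 := evalCoeff_eq_zero_of_mem_closure hD hmem
  rw [evalCoeff_lineCoeff] at h0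
  exact hy.1 (hr' _ s hs h0)

/-- The degree formula for a nonconstant eliminant. -/
theorem groupDeg_eq_of_irreducible {A : Fin (n + 1) → Finset (Fin n → ℤ)}
    (hA : ∀ j, (A j).Nonempty) {i : Fin (n + 1)} {M : ℕ}
    (hM : ∀ D : MvPolynomial (Fin (n + 1) × (Fin n → ℤ)) ℤ, D ≠ 0 →
        ∃ c : Fin (n + 1) → (Fin n → ℤ) → ℂ, evalCoeff D c ≠ 0 ∧
          (sysRoots (fun j => A (i.succAbove j)) (fun j => c (i.succAbove j))).Finite ∧
          (sysRoots (fun j => A (i.succAbove j)) (fun j => c (i.succAbove j))).ncard = M)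
    {E R : MvPolynomial (Fin (n + 1) × (Fin n → ℤ)) ℤ} (hE : Irreducible E)
    (hV : {c | evalCoeff E c = 0} = closure {c | HasRoot A c}) {d : ℕ}
    (hR : R = E ^ d ∨ R = -E ^ d) {U : Set (Fin (n + 1) → (Fin n → ℤ) → ℂ)} (hU : IsOpen U)
    (hUH : closure (U ∩ {c | HasRoot A c}) = closure {c | HasRoot A c})
    (hd : ∀ c ∈ U ∩ {c | HasRoot A c}, Nat.card {ξ // IsRootOf A c ξ} = d) :
    groupDeg i R = M := by
  classical
  choose a ha using hA
  have hEp : Prime E := hE.prime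
  have hEH : ∀ c, HasRoot A c → evalCoeff E c = 0 := fun c hc => by
    have : c ∈ closure {c | HasRoot A c} := subset_closure hc
    rwa [← hV] at this
  obtain ⟨T, hT⟩ := exists_natDegree_shiftHom_single_ne_zero hEp.ne_zero (hEH 0 (hasRoot_zero A))
  have hdvd : ∀ D, incHom A a D = 0 → E ∣ D := fun D hD =>
    eliminant_dvd hEp hV hT ((incHom_eq_zero_iff ha).1 hD)
  obtain ⟨G, hG, d', -, hGd⟩ := exists_card_root_eq ha (T := T)
    (algebraicIndependent_incVar_of_dvd fun D hD hDT h0 => by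
      have h1 := Polynomial.natDegree_le_of_dvd (map_dvd (shiftHom (Pi.single T 1)) (hdvd D h0))
        (shiftHom_ne_zero _ hD)
      omega)
  have hEG : ¬ E ∣ G := by
    rintro ⟨D, rfl⟩
    rw [map_mul, (incHom_eq_zero_iff ha).2 hEH, zero_mul] at hG
    exact hG rfl
  have hcard : ∀ c, evalCoeff E c = 0 → evalCoeff G c ≠ 0 → Nat.card {ξ // IsRootOf A c ξ} = d' := by
    intro c hc hGc
    refine hGd c (fun D hD => ?_) hGc
    obtain ⟨D', rfl⟩ := hdvd D hD
    rw [evalCoeff, map_mul]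
    exact mul_eq_zero_of_left hc _
  have hdd' : d = d' := by
    obtain ⟨c₀, hc₀⟩ : (U ∩ {c | HasRoot A c}).Nonempty := by
      rw [← closure_nonempty_iff, hUH]
      exact ⟨0, subset_closure (hasRoot_zero A)⟩
    obtain ⟨c, hcU, hcH, hcG⟩ := mem_closure_iff.1
      (mem_closure_of_incHom_ne_zero ha hG hc₀.2) U hU hc₀.1
    rw [← hd c ⟨hcU, hcH⟩, hcard c (hEH c hcH) hcG]
  rw [groupDeg_eq_partDeg, partDeg_pow_or_neg hEp.ne_zero hR, mul_comm, hdd',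
    ← groupDeg_eq_partDeg]
  exact mul_eq_of_card_root_eq hM hEp hEH hEG hcard

lemma Multiset.pow_card_le_prod_norm (m : Multiset ℂ) {r : ℝ} (hr : 0 ≤ r)
    (h : ∀ s ∈ m, r ≤ ‖s‖) : r ^ m.card ≤ ‖m.prod‖ := by
  induction m using Multiset.induction_on with
  | empty => simp
  | cons a m ih =>
    rw [Multiset.card_cons, Multiset.prod_cons, norm_mul, pow_succ']
    exact mul_le_mul (h a (Multiset.mem_cons_self a m))
      (ih fun s hs => h s (Multiset.mem_cons_of_mem hs)) (pow_nonneg hr _) (norm_nonneg _)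

lemma Polynomial.exists_root_norm_pow_le {f : Polynomial ℂ} (hf : f.natDegree ≠ 0) :
    ∃ s, f.eval s = 0 ∧ ‖s‖ ^ f.natDegree * ‖f.leadingCoeff‖ ≤ ‖f.eval 0‖ := by
  classical
  have hf0 : f ≠ 0 := fun h => hf (by rw [h, Polynomial.natDegree_zero])
  have hsp : f.Splits := IsAlgClosed.splits f
  have hcard : f.roots.card = f.natDegree := hsp.natDegree_eq_card_roots.symm
  have hne : f.roots.toFinset.Nonempty := by
    rw [Multiset.toFinset_nonempty, ← Multiset.card_pos, hcard]
    exact Nat.pos_of_ne_zero hf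
  obtain ⟨s, hs, hmin⟩ := Finset.exists_min_image f.roots.toFinset (fun s => ‖s‖) hne
  refine ⟨s, (Polynomial.mem_roots hf0).1 (Multiset.mem_toFinset.1 hs), ?_⟩
  rw [hsp.eval_eq_prod_roots 0, norm_mul, mul_comm, ← hcard]
  gcongr
  have := Multiset.pow_card_le_prod_norm (f.roots.map fun a => 0 - a) (norm_nonneg s) (by
    intro b hb
    obtain ⟨c, hc, rfl⟩ := Multiset.mem_map.1 hb
    rw [zero_sub, norm_neg]
    exact hmin c (Multiset.mem_toFinset.2 hc))
  rwa [Multiset.card_map] at this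

lemma continuous_aeval_int {σ : Type*} (D : MvPolynomial σ ℤ) :
    Continuous fun y : σ → ℂ => MvPolynomial.aeval y D := by
  simp only [MvPolynomial.aeval_def, MvPolynomial.eval₂_eq]
  fun_prop

/-- The points of a hypersurface away from a divisor not containing it are dense. -/
theorem mem_closure_aeval_ne_zero {σ : Type*} {E G : MvPolynomial σ ℤ} (hE : Prime E)
    (hG : ¬ E ∣ G) {x : σ → ℂ} (hx : MvPolynomial.aeval x E = 0) :
    x ∈ closure {y : σ → ℂ | MvPolynomial.aeval y E = 0 ∧ MvPolynomial.aeval y G ≠ 0} := by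
  classical
  obtain ⟨z, hz⟩ := exists_int_aeval_ne_zero (topPart_ne_zero (fun _ : σ => True) hE.ne_zero)
  have hlc := (natDegree_shiftHom_eq hz).2
  set w : σ → ℤ := fun p => if True then z p else 0 with hw
  set h := MvPolynomial.aeval (fun i => (z i : ℂ)) (topPart (fun _ : σ => True) E) with hh
  have hlc' : ∀ y : σ → ℂ, MvPolynomial.aeval y (shiftHom w E).leadingCoeff = h := by
    intro y
    rw [hlc, aeval_substHom]
    simp [hw, hh]
  have hN : (shiftHom w E).natDegree ≠ 0 := by
    intro h0
    apply hz
    rw [← hlc' x, Polynomial.leadingCoeff, h0, Polynomial.coeff_zero_eq_eval_zero,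
      eval_zero_shiftHom, hx]
  obtain ⟨r, hr, hr'⟩ := exists_ne_zero_of_not_dvd hE hG w
  obtain ⟨z₁, hz₁⟩ := exists_int_aeval_ne_zero hr
  have hev := eventually_aeval_line_ne_zero x hz₁
  set y : ℂ → σ → ℂ := fun t p => x p + t * ((z₁ p : ℂ) - x p) with hy
  have hdeg : ∀ t, (linePoly w (y t) E).natDegree = (shiftHom w E).natDegree := fun t =>
    natDegree_linePoly (by rw [hlc']; exact hz)
  have hlead : ∀ t, (linePoly w (y t) E).leadingCoeff = h := fun t => by
    rw [Polynomial.leadingCoeff, hdeg, ← hlc' (y t)]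
    exact Polynomial.coeff_map _ _
  choose s hs0 hs using fun t => Polynomial.exists_root_norm_pow_le
    (f := linePoly w (y t) E) (by rw [hdeg]; exact hN)
  have hyc : Continuous y := by fun_prop
  have hy0 : y 0 = x := by ext p; simp [hy]
  have hEy : Filter.Tendsto (fun t => ‖MvPolynomial.aeval (y t) E‖ / ‖h‖) (nhdsWithin 0 {0}ᶜ)
      (nhds 0) := by
    have h1 : Continuous fun t => ‖MvPolynomial.aeval (y t) E‖ / ‖h‖ :=
      (((continuous_aeval_int E).comp hyc).norm).div_const _
    have h2 := h1.tendsto 0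
    rw [hy0, hx, norm_zero, zero_div] at h2
    exact h2.mono_left nhdsWithin_le_nhds
  have hpow : Filter.Tendsto (fun t => ‖s t‖ ^ (shiftHom w E).natDegree) (nhdsWithin 0 {0}ᶜ)
      (nhds 0) := by
    refine squeeze_zero (fun t => by positivity) (fun t => ?_) hEy
    rw [le_div_iff₀ (norm_pos_iff.2 hz)]
    have := hs t
    rwa [hdeg, hlead, eval_linePoly, show (fun p => y t p + 0 * (w p : ℂ)) = y t by
      ext p; simp] at this
  have hst : Filter.Tendsto s (nhdsWithin 0 {0}ᶜ) (nhds 0) := by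
    rw [tendsto_zero_iff_norm_tendsto_zero]
    have h1 := ((Real.continuousAt_rpow_const 0 ((shiftHom w E).natDegree : ℝ)⁻¹
      (Or.inr (by positivity))).tendsto).comp hpow
    rw [Real.zero_rpow (by positivity)] at h1
    refine h1.congr fun t => ?_
    exact Real.pow_rpow_inv_natCast (norm_nonneg _) hN
  have hlim : Filter.Tendsto (fun t p => y t p + s t * (w p : ℂ)) (nhdsWithin 0 {0}ᶜ)
      (nhds x) := by
    rw [tendsto_pi_nhds]
    intro p
    have h1 : Filter.Tendsto (fun t => y t p) (nhdsWithin 0 {0}ᶜ) (nhds (x p)) := by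
      have h2 := (hyc.tendsto 0).mono_left (nhdsWithin_le_nhds (s := {0}ᶜ))
      rw [hy0] at h2
      exact tendsto_pi_nhds.1 h2 p
    simpa using h1.add (hst.mul_const (w p : ℂ))
  refine mem_closure_of_tendsto hlim ?_
  filter_upwards [hev] with t ht
  have h0 := hs0 t
  rw [eval_linePoly] at h0
  exact ⟨h0, fun h1 => ht (hr' (y t) (s t) h0 h1)⟩

/-- If a generic square subsystem has roots, the resultant variety is a hypersurface. -/
theorem exists_irreducible_of_ncard_pos {A : Fin (n + 1) → Finset (Fin n → ℤ)}
    (hA : ∀ j, (A j).Nonempty) {i : Fin (n + 1)} {M : ℕ}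
    (hM : ∀ D : MvPolynomial (Fin (n + 1) × (Fin n → ℤ)) ℤ, D ≠ 0 →
        ∃ c : Fin (n + 1) → (Fin n → ℤ) → ℂ, evalCoeff D c ≠ 0 ∧
          (sysRoots (fun j => A (i.succAbove j)) (fun j => c (i.succAbove j))).Finite ∧
          (sysRoots (fun j => A (i.succAbove j)) (fun j => c (i.succAbove j))).ncard = M)
    (hM0 : M ≠ 0) :
    ∃ E : MvPolynomial (Fin (n + 1) × (Fin n → ℤ)) ℤ,
      Irreducible E ∧ {c | evalCoeff E c = 0} = closure {c | HasRoot A c} := by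
  classical
  choose a ha using hA
  set T : Fin (n + 1) × (Fin n → ℤ) := (i, a i) with hT
  obtain ⟨v, hv⟩ : ∃ v : Fin (n + 1) × (Fin n → ℤ) → ℤ, v = Pi.single T 1 := ⟨_, rfl⟩
  have hvT : v (i, a i) = 1 := by rw [hv]; exact Pi.single_eq_same T 1
  have hvT' : ∀ p, p ≠ T → v p = 0 := fun p hp => by rw [hv]; exact Pi.single_eq_of_ne hp 1
  have hline : ∀ D : MvPolynomial (Fin (n + 1) × (Fin n → ℤ)) ℤ, D ≠ 0 → ∃ c s,
      evalCoeff D c ≠ 0 ∧ HasRoot A (lineCoeff v c s) := by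
    intro D hD
    obtain ⟨c, hc, hfin, hcard⟩ := hM D hD
    obtain ⟨ξ, hξ⟩ := (Set.ncard_pos hfin).1 (by omega)
    have hsum : ∑ b ∈ A i, (v (i, b) : ℂ) * chEval ξ b = chEval ξ (a i) := by
      rw [Finset.sum_eq_single_of_mem (a i) (ha i) fun b _ hb => ?_]
      · rw [hvT]; simp
      · rw [hvT' (i, b) fun h => hb (congrArg Prod.snd h)]; simp
    refine ⟨c, -(∑ b ∈ A i, c i b * chEval ξ b) / chEval ξ (a i), hc, ξ,
      (isRootOf_lineCoeff_iff fun p hp => hvT' p fun h => hp (by rw [h])).2 ⟨hξ, ?_⟩⟩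
    rw [hsum, div_mul_cancel₀ _ (chEval_ne_zero ξ (a i))]
    ring
  have halg : AlgebraicIndependent ℤ fun p : {p // p ≠ T} => incVar A a p.1 := by
    refine algebraicIndependent_incVar_of_dvd fun D hD hDT h0 => ?_
    rw [← hv] at hDT
    obtain ⟨c, s, hc, hH⟩ := hline D hD
    apply hc
    have h1 := (incHom_eq_zero_iff ha).1 h0 _ hH
    rwa [evalCoeff_lineCoeff, aeval_eq_of_natDegree_shiftHom_eq_zero hDT
      (fun p : Fin (n + 1) × (Fin n → ℤ) => c p.1 p.2) s] at h1
  obtain ⟨G, hG, d, hd, hGd⟩ := exists_card_root_eq ha halg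
  have hker : RingHom.ker (incHom A a) ≠ ⊥ := by
    intro hbot
    have hinj : AlgebraicIndependent ℤ (incVar A a) := by
      refine algebraicIndependent_iff.2 fun D hD => ?_
      have : D ∈ RingHom.ker (incHom A a) := hD
      rwa [hbot] at this
    have htr := hinj.transcendental_adjoin (s := {T}ᶜ) (i := T) (by simp)
    have := isAlgebraic_incRing_of_algebraicIndependent halg
    refine htr ?_
    have hset : incVar A a '' {T}ᶜ = Set.range fun p : {p // p ≠ T} => incVar A a p.1 :=
      Set.image_eq_range _ _
    rw [hset]
    exact Algebra.IsAlgebraic.isAlgebraic _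
  obtain ⟨E, hEker, hE⟩ := (RingHom.ker_isPrime (incHom A a)).exists_mem_prime_of_ne_bot hker
  have hdvd : ∀ D, incHom A a D = 0 → E ∣ D := by
    intro D hD
    by_contra hED
    obtain ⟨r, hr, hr'⟩ := exists_ne_zero_of_not_dvd hE hED v
    obtain ⟨c, s, hc, hH⟩ := hline r hr
    have h1 := (incHom_eq_zero_iff ha).1 hD _ hH
    have h2 := (incHom_eq_zero_iff ha).1 hEker _ hH
    rw [evalCoeff_lineCoeff] at h1 h2
    exact hc (hr' (fun p : Fin (n + 1) × (Fin n → ℤ) => c p.1 p.2) s h2 h1)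
  have hEG : ¬ E ∣ G := by
    rintro ⟨D, rfl⟩
    rw [map_mul, show incHom A a E = 0 from hEker, zero_mul] at hG
    exact hG rfl
  refine ⟨E, hE.irreducible, Set.Subset.antisymm (fun c hc => ?_) fun c hc =>
    evalCoeff_eq_zero_of_mem_closure ((incHom_eq_zero_iff ha).1 hEker) hc⟩
  have h1 := mem_closure_aeval_ne_zero hE hEG
    (x := fun p : Fin (n + 1) × (Fin n → ℤ) => c p.1 p.2) hc
  have hcont : Continuous fun (y : Fin (n + 1) × (Fin n → ℤ) → ℂ) j e => y (j, e) := by fun_prop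
  refine closure_mono ?_ (image_closure_subset_closure_image hcont ⟨_, h1, rfl⟩)
  rintro _ ⟨y, ⟨hy, hyG⟩, rfl⟩
  have hcard := hGd (fun j e => y (j, e)) (fun D hD => by
    obtain ⟨D', rfl⟩ := hdvd D hD
    rw [evalCoeff, map_mul]
    exact mul_eq_zero_of_left hy _) hyG
  have hpos : 0 < Nat.card {ξ // IsRootOf A (fun j e => y (j, e)) ξ} := by omega
  obtain ⟨⟨ξ, hξ⟩⟩ := (Nat.card_pos_iff.1 hpos).1
  exact ⟨ξ, hξ⟩

/-- For any family `A_0, …, A_n` of nonempty finite subsets of `ℤ^n`,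
the partial degree of the sparse resultant in the group of variables `u_i` equals the
mixed volume `MV(Δ_0, …, Δ_{i-1}, Δ_{i+1}, …, Δ_n)` of the convex hulls of the other
supports. -/
theorem groupDeg_resultant_eq_mixedVolume
    (A : Fin (n + 1) → Finset (Fin n → ℤ)) (hA : ∀ i, (A i).Nonempty)
    (R : MvPolynomial (Fin (n + 1) × (Fin n → ℤ)) ℤ) (hR : IsResultant A R)
    (i : Fin (n + 1)) :
    (groupDeg i R : ℝ) =
      mixedVolume n (fun j : {j : Fin (n + 1) // j ≠ i} =>
        convexHull ℝ (castR n '' ↑(A j.1))) := by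
  obtain ⟨M, hMV, hM⟩ := exists_coeff_ncard_sysRoots hA i
  rw [← hMV, Nat.cast_inj]
  obtain ⟨E, d, hEl, hR, U, hU, hUH, hd⟩ := hR
  rcases hEl with ⟨hE, hV⟩ | ⟨rfl, hno⟩
  · exact groupDeg_eq_of_irreducible hA hM hE hV hR hU hUH hd
  · have hM0 : M = 0 := by
      by_contra hM0
      obtain ⟨E, hE⟩ := exists_irreducible_of_ncard_pos hA hM hM0
      exact hno E hE
    rw [groupDeg_eq_partDeg, partDeg_pow_or_neg one_ne_zero hR, hM0]
    simp [partDeg, MvPolynomial.support_one]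

end
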